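/- For every finite group G, the set {x ∈ G : for every y ∈ G, the derived (commutator) subgroup of ⟨x,y⟩ is nilpotent} is the underlying set of a subgroup of G (i.e. the class 𝔇 of finite groups with nilpotent derived subgroup is semiregular). -/

import Mathlib

universe u

namespace ND
open Subgroup
open scoped commutatorElement
set_option linter.all false
set_option linter.style.haveILetI false
set_option linter.unusedSectionVars false

variable {G : Type u} [Group G] [Finite G]

def pel (q : ℕ) (g : G) : Prop := ∃ n, g ^ q ^ n = 1
def ppel (q : ℕ) (g : G) : Prop := (orderOf g).Coprime q

theorem exp_exists (q : ℕ) (hq : q.Prime) (n : ℕ) (hn : n ≠ 0) :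
    ∃ u : ℕ, u ≡ 1 [MOD ordProj[q] n] ∧ u ≡ 0 [MOD ordCompl[q] n] := by
  have h : (ordProj[q] n).Coprime (ordCompl[q] n) := 
    Nat.Coprime.pow_left _ (Nat.coprime_ordCompl hq hn)
  exact ⟨_, (Nat.chineseRemainder h 1 0).2⟩

open Classical in
noncomputable def ex (G : Type u) [Group G] [Finite G] (q : ℕ) : ℕ :=
  if h : q.Prime then (exp_exists q h (Nat.card G) Nat.card_pos.ne').choose else 0

theorem ex_one {q : ℕ} (hq : q.Prime) : ex G q ≡ 1 [MOD ordProj[q] (Nat.card G)] := by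
  unfold ex; rw [dif_pos hq]; exact (exp_exists q hq (Nat.card G) Nat.card_pos.ne').choose_spec.1
theorem ex_zero {q : ℕ} (hq : q.Prime) : ex G q ≡ 0 [MOD ordCompl[q] (Nat.card G)] := by
  unfold ex; rw [dif_pos hq]; exact (exp_exists q hq (Nat.card G) Nat.card_pos.ne').choose_spec.2

noncomputable def qp (q : ℕ) (g : G) : G := g ^ ex G q
noncomputable def qr (q : ℕ) (g : G) : G := (qp q g)⁻¹ * g

theorem qp_mem {q : ℕ} {g : G} {H : Subgroup G} (h : g ∈ H) : qp q g ∈ H := H.pow_mem h _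
theorem qr_mem {q : ℕ} {g : G} {H : Subgroup G} (h : g ∈ H) : qr q g ∈ H :=
  H.mul_mem (H.inv_mem (qp_mem h)) h
theorem qp_mul_qr {q : ℕ} (g : G) : qp q g * qr q g = g := by simp [qr]
theorem qp_comm {q : ℕ} {g k : G} (h : Commute g k) : Commute (qp q g) k := h.pow_left _
theorem qr_comm {q : ℕ} {g k : G} (h : Commute g k) : Commute (qr q g) k :=
  ((qp_comm h).inv_left).mul_left h
theorem qr_mul_qp {q : ℕ} (g : G) : qr q g * qp q g = g := by
  rw [← (qp_comm (qr_comm (Commute.refl g)).symm).eq, qp_mul_qr]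
theorem qp_conj {q : ℕ} (c g : G) : qp q (c * g * c⁻¹) = c * qp q g * c⁻¹ := by
  simp [qp, conj_pow]
theorem qr_conj {q : ℕ} (c g : G) : qr q (c * g * c⁻¹) = c * qr q g * c⁻¹ := by
  simp [qr, qp_conj]; group
theorem qp_mul {q : ℕ} {a b : G} (h : Commute a b) : qp q (a * b) = qp q a * qp q b := h.mul_pow _

theorem pel_iff {q : ℕ} (hq : q.Prime) {g : G} : pel q g ↔ g ^ ordProj[q] (Nat.card G) = 1 := by
  constructor
  · rintro ⟨n, hn⟩
    have h1 : orderOf g ∣ q ^ n := orderOf_dvd_of_pow_eq_one hn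
    have h2 : orderOf g ∣ Nat.card G := orderOf_dvd_natCard g
    obtain ⟨k, -, hk⟩ := (Nat.dvd_prime_pow hq).1 h1
    rw [hk] at h2
    apply orderOf_dvd_iff_pow_eq_one.1
    rw [hk]
    exact Nat.pow_dvd_pow _ ((hq.pow_dvd_iff_le_factorization Nat.card_pos.ne').1 h2)
  · intro h; exact ⟨_, h⟩

theorem pel_qp {q : ℕ} (hq : q.Prime) (g : G) : pel q (qp q g) := by
  rw [pel_iff hq, qp, ← pow_mul]
  obtain ⟨k, hk⟩ := (Nat.modEq_zero_iff_dvd.1 (ex_zero (G := G) hq))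
  rw [hk]
  have : ordCompl[q] (Nat.card G) * k * ordProj[q] (Nat.card G) = Nat.card G * k := by
    rw [← Nat.ordProj_mul_ordCompl_eq_self (Nat.card G) q]; 
    conv_rhs => rw [mul_comm, ← mul_assoc]
    rw [Nat.ordProj_mul_ordCompl_eq_self]; ring
  rw [this, pow_mul, pow_card_eq_one', one_pow]

theorem qp_of_pel {q : ℕ} (hq : q.Prime) {g : G} (h : pel q g) : qp q g = g := by
  rw [pel_iff hq] at h
  have h2 : orderOf g ∣ ordProj[q] (Nat.card G) := orderOf_dvd_of_pow_eq_one h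
  have := ((ex_one (G := G) hq).of_dvd h2)
  have h3 := pow_eq_pow_iff_modEq.2 this
  simpa [qp] using h3

theorem ppel_iff {q : ℕ} (hq : q.Prime) {g : G} : ppel q g ↔ qp q g = 1 := by
  constructor
  · intro h
    have h1 : orderOf (qp q g) ∣ orderOf g := orderOf_pow_dvd _
    obtain ⟨n, hn⟩ := pel_qp hq g
    have h2 : orderOf (qp q g) ∣ q ^ n := orderOf_dvd_of_pow_eq_one hn
    exact orderOf_eq_one_iff.1 (Nat.Coprime.eq_one_of_dvd
      (Nat.Coprime.coprime_dvd_left h1 (Nat.Coprime.pow_right n h)) h2)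
  · intro h
    by_contra hc
    have hd : q ∣ orderOf g := by
      have := (Nat.coprime_or_dvd_of_prime hq (orderOf g))
      rcases this with h | h
      · exact absurd h.symm hc
      · exact h
    have h1 : orderOf g ∣ ex G q := orderOf_dvd_of_pow_eq_one h
    have h2 : q ∣ Nat.card G := hd.trans (orderOf_dvd_natCard g)
    have h3 : q ∣ ordProj[q] (Nat.card G) :=
      dvd_pow_self q (hq.factorization_pos_of_dvd Nat.card_pos.ne' h2).ne'
    have h4 := ((ex_one (G := G) hq).of_dvd h3)
    have h5 : ex G q ≡ 0 [MOD q] := Nat.modEq_zero_iff_dvd.2 (hd.trans h1)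
    have h6 : (1:ℕ) ≡ 0 [MOD q] := h4.symm.trans h5
    exact hq.one_lt.ne' (Nat.dvd_one.1 (Nat.modEq_zero_iff_dvd.1 h6))

theorem ppel_qr {q : ℕ} (hq : q.Prime) (g : G) : ppel q (qr q g) := by
  rw [ppel_iff hq, qr, qp_mul (qp_comm (Commute.refl g)).inv_left, qp, inv_pow]
  have : qp q (qp q g) = qp q g := qp_of_pel hq (pel_qp hq g)
  rw [qp] at this; rw [this]; simp [qp]

theorem pel_ppel {q : ℕ} (hq : q.Prime) {g : G} (h : pel q g) (h' : ppel q g) : g = 1 := by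
  rw [ppel_iff hq, qp_of_pel hq h] at h'; exact h'

theorem pel.ppel_of_ne {p q : ℕ} (hp : p.Prime) (hq : q.Prime) (hne : p ≠ q) {g : G} (h : pel p g) :
    ppel q g := by
  obtain ⟨n, hn⟩ := h
  exact Nat.Coprime.coprime_dvd_left (orderOf_dvd_of_pow_eq_one hn)
    (Nat.Coprime.pow_left _ ((Nat.coprime_primes hp hq).2 hne))

theorem pel_pel {p q : ℕ} (hp : p.Prime) (hq : q.Prime) (hne : p ≠ q) {g : G} (h : pel p g)
    (h' : pel q g) : g = 1 := pel_ppel hq h' (h.ppel_of_ne hp hq hne)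

theorem pel_one {q : ℕ} : pel q (1 : G) := ⟨0, by simp⟩
theorem ppel_one {q : ℕ} : ppel q (1 : G) := by simp [ppel]
theorem pel.inv {q : ℕ} {g : G} (h : pel q g) : pel q g⁻¹ := by
  obtain ⟨n, hn⟩ := h; exact ⟨n, by simp [hn]⟩
theorem ppel.inv {q : ℕ} {g : G} (h : ppel q g) : ppel q g⁻¹ := by simpa [ppel] using h
theorem pel.conj {q : ℕ} {g : G} (h : pel q g) (c : G) : pel q (c * g * c⁻¹) := by
  obtain ⟨n, hn⟩ := h; exact ⟨n, by simp [conj_pow, hn]⟩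
theorem orderOf_conj' (g c : G) : orderOf (c * g * c⁻¹) = orderOf g := by
  simpa using orderOf_injective (MulAut.conj c).toMonoidHom (MulAut.conj c).injective g
theorem ppel.conj {q : ℕ} {g : G} (h : ppel q g) (c : G) : ppel q (c * g * c⁻¹) := by
  rw [ppel, orderOf_conj']; exact h
theorem pel.pow {q : ℕ} {g : G} (h : pel q g) (k : ℕ) : pel q (g ^ k) := by
  obtain ⟨n, hn⟩ := h; exact ⟨n, by rw [← pow_mul, mul_comm, pow_mul, hn, one_pow]⟩
theorem ppel.pow {q : ℕ} {g : G} (h : ppel q g) (k : ℕ) : ppel q (g ^ k) :=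
  Nat.Coprime.coprime_dvd_left (orderOf_pow_dvd k) h

theorem mem_of_qp {g : G} {H : Subgroup G} (h : ∀ l : ℕ, l.Prime → qp l g ∈ H) : g ∈ H := by
  classical
  have hex : ∃ k : ℕ, 0 < k ∧ g ^ k ∈ H := ⟨Nat.card G, Nat.card_pos, by simp⟩
  set k := Nat.find hex with hk
  obtain ⟨hk0, hkH⟩ := Nat.find_spec hex
  have hdiv : ∀ j : ℕ, g ^ j ∈ H → k ∣ j := by
    intro j hj
    by_contra hc
    have h1 : 0 < j % k := Nat.pos_of_ne_zero (fun h => hc (Nat.dvd_of_mod_eq_zero h))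
    have h2 : g ^ (j % k) ∈ H := by
      have : g ^ j = (g ^ k) ^ (j / k) * g ^ (j % k) := by rw [← pow_mul, ← pow_add, Nat.div_add_mod]
      rw [this] at hj
      exact (H.mul_mem_cancel_left (H.pow_mem hkH _)).1 hj
    exact absurd (Nat.find_min' hex ⟨h1, h2⟩) (not_le.2 (Nat.mod_lt _ hk0))
  by_cases h1 : k = 1
  · have := hkH; rw [← hk, h1, pow_one] at this; exact this
  · exfalso
    obtain ⟨l, hl, hlk⟩ := Nat.exists_prime_and_dvd h1
    have h2 : l ∣ Nat.card G := hlk.trans (hdiv _ (by simp))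
    have h3 : l ∣ ordProj[l] (Nat.card G) :=
      dvd_pow_self l (hl.factorization_pos_of_dvd Nat.card_pos.ne' h2).ne'
    have h4 := ((ex_one (G := G) hl).of_dvd h3)
    have h5 : ex G l ≡ 0 [MOD l] := Nat.modEq_zero_iff_dvd.2 (hlk.trans (hdiv _ (h l hl)))
    have h6 : (1:ℕ) ≡ 0 [MOD l] := h4.symm.trans h5
    exact hl.one_lt.ne' (Nat.dvd_one.1 (Nat.modEq_zero_iff_dvd.1 h6))

theorem pel_of_mem {q : ℕ} {P : Subgroup G} (hP : IsPGroup q P) {g : G} (h : g ∈ P) : pel q g := by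
  obtain ⟨n, hn⟩ := hP ⟨g, h⟩
  exact ⟨n, by simpa [Subtype.ext_iff] using hn⟩
theorem isPGroup_of {q : ℕ} {P : Subgroup G} (h : ∀ g ∈ P, pel q g) : IsPGroup q P := by
  rintro ⟨g, hg⟩
  obtain ⟨n, hn⟩ := h g hg
  exact ⟨n, by simpa [Subtype.ext_iff] using hn⟩
theorem ppel_of_mem {q : ℕ} {P : Subgroup G} (hP : (Nat.card P).Coprime q) {g : G} (h : g ∈ P) :
    ppel q g := by
  refine Nat.Coprime.coprime_dvd_left ?_ hP
  exact Subgroup.orderOf_dvd_natCard P h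
theorem coprime_of {q : ℕ} (hq : q.Prime) {P : Subgroup G} (h : ∀ g ∈ P, ppel q g) :
    (Nat.card P).Coprime q := by
  haveI := Fact.mk hq
  rcases Nat.coprime_or_dvd_of_prime hq (Nat.card P) with h1 | h1
  · exact h1.symm
  · obtain ⟨g, hg⟩ := exists_prime_orderOf_dvd_card' q h1
    have := h g g.2
    rw [ppel, Subgroup.orderOf_coe, hg, Nat.coprime_self] at this
    exact absurd this hq.one_lt.ne'
theorem isPGroup_zpowers {q : ℕ} {x : G} (h : pel q x) : IsPGroup q (zpowers x) := by
  apply isPGroup_of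
  rintro g ⟨k, rfl⟩
  obtain ⟨n, hn⟩ := h
  exact ⟨n, by
    show (x ^ k) ^ q ^ n = 1
    rw [← zpow_natCast, ← zpow_mul, mul_comm, zpow_mul, zpow_natCast, hn, one_zpow]⟩

abbrev nm (H : Subgroup G) : Subgroup G := normalizer (H : Set G)
theorem nm_conj {H : Subgroup G} {x b : G} (hx : x ∈ nm H) (hb : b ∈ H) : x * b * x⁻¹ ∈ H :=
  (mem_normalizer_iff.1 hx b).1 hb
theorem nm_conj' {H : Subgroup G} {x b : G} (hx : x ∈ nm H) (hb : b ∈ H) : x⁻¹ * b * x ∈ H := by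
  simpa using nm_conj ((nm H).inv_mem hx) hb
theorem nm_of {H : Subgroup G} {x : G} (h : ∀ b ∈ H, x * b * x⁻¹ ∈ H) : x ∈ nm H :=
  mem_normalizer_fintype (S := (H : Set G)) h
theorem nm_comm {H : Subgroup G} {x b : G} (hx : x ∈ nm H) (hb : b ∈ H) : ⁅b, x⁆ ∈ H := by
  rw [commutatorElement_def, mul_assoc, mul_assoc]
  exact H.mul_mem hb (by simpa [mul_assoc] using nm_conj hx (H.inv_mem hb))
theorem nm_comm' {H : Subgroup G} {x b : G} (hx : x ∈ nm H) (hb : b ∈ H) : ⁅x, b⁆ ∈ H := by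
  rw [← inv_mem_iff, commutatorElement_inv]; exact nm_comm hx hb
theorem le_nm (H : Subgroup G) : H ≤ nm H := fun _ hx => 
  nm_of fun _ hb => H.mul_mem (H.mul_mem hx hb) (H.inv_mem hx)
theorem nm_closure {S : Set G} {x : G} (h : ∀ b ∈ S, x * b * x⁻¹ ∈ closure S) : x ∈ nm (closure S) := by
  apply nm_of
  intro b hb
  have : closure S ≤ (closure S).comap (MulAut.conj x).toMonoidHom := by
    rw [closure_le]; intro y hy; simpa using h y hy
  simpa using this hb
theorem normal_of_nm {H : Subgroup G} (h : ∀ x, x ∈ nm H) : H.Normal := ⟨fun _ hb g => nm_conj (h g) hb⟩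

/-- elements of a join with a normalising subgroup -/
theorem mem_sup_nm {Q A : Subgroup G} (h : A ≤ nm Q) {g : G} (hg : g ∈ Q ⊔ A) :
    ∃ b ∈ Q, ∃ a ∈ A, g = b * a := by
  have := Subgroup.coe_mul_of_right_le_normalizer_left Q A h
  have hg' : g ∈ (Q ⊔ A : Subgroup G) := hg
  rw [← SetLike.mem_coe, this] at hg'
  obtain ⟨b, hb, a, ha, rfl⟩ := hg'
  exact ⟨b, hb, a, ha, rfl⟩

theorem sup_isPGroup {q : ℕ} {Q A : Subgroup G} (hQ : IsPGroup q Q) (hA : IsPGroup q A) (h : A ≤ nm Q) :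
    IsPGroup q (Q ⊔ A : Subgroup G) := IsPGroup.to_sup_of_normal_left' hQ hA h

theorem zpowers_le_nm {Q : Subgroup G} {x : G} (hx : x ∈ nm Q) : zpowers x ≤ nm Q := by
  rwa [zpowers_le]

theorem exists_nm_gt {q : ℕ} (hq : q.Prime) {P Q : Subgroup G} (hP : IsPGroup q P) (hQP : Q ≤ P)
    (hne : ¬ P ≤ Q) : ∃ g ∈ P, g ∉ Q ∧ g ∈ nm Q := by
  haveI := Fact.mk hq
  haveI : Group.IsNilpotent P := hP.isNilpotent
  have := normalizerCondition_of_isNilpotent (G := P) (Q.subgroupOf P) (lt_top_iff_ne_top.2 (by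
    intro h; exact hne (subgroupOf_eq_top.1 h)))
  obtain ⟨⟨g, hg⟩, h1, h2⟩ := SetLike.exists_of_lt this
  refine ⟨g, hg, fun h => h2 (by simpa [mem_subgroupOf] using h), nm_of fun b hb => ?_⟩
  have := (mem_normalizer_iff.1 h1 ⟨b, hQP hb⟩).1 (by simpa [mem_subgroupOf] using hb)
  simpa [mem_subgroupOf] using this

/-- Sylow conjugacy in Q ⊔ A -/
theorem SC {r : ℕ} (hr : r.Prime) {Q A L : Subgroup G} (hA : IsPGroup r A) (hQ : (Nat.card Q).Coprime r)
    (hAQ : A ≤ nm Q) (hL : IsPGroup r L) (hLQ : L ≤ Q ⊔ A) : ∃ j ∈ Q, ∀ l ∈ L, j * l * j⁻¹ ∈ A := by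
  haveI := Fact.mk hr
  let K : Subgroup G := Q ⊔ A
  let A' : Subgroup K := A.subgroupOf K
  let L' : Subgroup K := L.subgroupOf K
  have hL' : IsPGroup r L' := hL.comap_subtype
  have hidx : ¬ r ∣ Nat.card (K ⧸ A') := by
    have h1 : Nat.card (K ⧸ A') ∣ Nat.card Q := by
      have : A'.index * Nat.card A' = Nat.card K := Subgroup.index_mul_card A'
      have e1 : Nat.card A' = Nat.card A := Nat.card_congr (subgroupOfEquivOfLe (le_sup_right : A ≤ K)).toEquiv
      have hinj : Function.Injective (fun b : Q × A => (b.1 : G) * b.2) := by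
        rintro ⟨b, a⟩ ⟨b', a'⟩ h
        simp only at h
        have h2 : (b' : G)⁻¹ * b = a' * (a : G)⁻¹ := by
          rw [eq_mul_inv_iff_mul_eq, mul_assoc, h]; group
        have h3 : (b' : G)⁻¹ * b = 1 := 
          pel_ppel hr (h2 ▸ pel_of_mem hA (A.mul_mem a'.2 (A.inv_mem a.2)))
            (ppel_of_mem hQ (Q.mul_mem (Q.inv_mem b'.2) b.2))
        have h4 := h2 ▸ h3
        ext
        · exact (inv_mul_eq_one.1 h3).symm
        · exact (mul_inv_eq_one.1 h4).symm
      have hbij : Nat.card K = Nat.card (Q × A) := by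
        apply le_antisymm
        · have : Function.Surjective (fun b : Q × A => (⟨(b.1 : G) * b.2, K.mul_mem
            ((le_sup_left : Q ≤ K) b.1.2) ((le_sup_right : A ≤ K) b.2.2)⟩ : K)) := by
            rintro ⟨g, hg⟩
            obtain ⟨b, hb, a, ha, rfl⟩ := mem_sup_nm hAQ hg
            exact ⟨⟨⟨b, hb⟩, ⟨a, ha⟩⟩, rfl⟩
          exact Nat.card_le_card_of_surjective _ this
        · refine Nat.card_le_card_of_injective (fun b : Q × A => (⟨(b.1 : G) * b.2, K.mul_mem
            ((le_sup_left : Q ≤ K) b.1.2) ((le_sup_right : A ≤ K) b.2.2)⟩ : K)) ?_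
          intro a b h
          exact hinj (congrArg Subtype.val h)
      rw [hbij, Nat.card_prod, e1] at this
      have h5 := Nat.eq_of_mul_eq_mul_right Nat.card_pos this
      exact dvd_of_eq h5
    intro h
    exact hr.one_lt.ne' (Nat.eq_one_of_dvd_coprimes hQ (h.trans h1) dvd_rfl)
  obtain ⟨k, hk⟩ := hL'.nonempty_fixed_point_of_prime_not_dvd_card (K ⧸ A') hidx
  induction k using QuotientGroup.induction_on with
  | H k =>
    obtain ⟨b, hb, a, ha, hba⟩ := mem_sup_nm hAQ k.2
    refine ⟨b⁻¹, Q.inv_mem hb, fun l hl => ?_⟩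
    have := hk ⟨⟨l, hLQ hl⟩, by simpa [L', mem_subgroupOf] using hl⟩
    have h2 : ((⟨l, hLQ hl⟩ * k : K) : K ⧸ A') = k := this
    rw [eq_comm, QuotientGroup.eq] at h2
    have h3 : (k : G)⁻¹ * (l * k) ∈ A := by simpa [A', mem_subgroupOf] using h2
    rw [hba] at h3
    have h4 : b⁻¹ * l * b⁻¹⁻¹ = a * ((b * a)⁻¹ * (l * (b * a))) * a⁻¹ := by group
    rw [h4]
    exact A.mul_mem (A.mul_mem ha h3) (A.inv_mem ha)

theorem fix_of_SC {r : ℕ} (hr : r.Prime) {Q A : Subgroup G} (hA : IsPGroup r A) (hQ : (Nat.card Q).Coprime r)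
    {a a' : G} (ha : a ∈ A) (ha' : a' ∈ A) (h : a' * a⁻¹ ∈ Q) : a' = a :=
  mul_inv_eq_one.1 (pel_ppel hr (pel_of_mem hA (A.mul_mem ha' (A.inv_mem ha))) (ppel_of_mem hQ h))

theorem fixed_coset {r : ℕ} (hr : r.Prime) {V B : Subgroup G} (hB : IsPGroup r B)
    (hV : (Nat.card V).Coprime r) (hBV : B ≤ nm V) {b : G} (hb : ∀ β ∈ B, b⁻¹ * (β * b * β⁻¹) ∈ V) :
    ∃ v ∈ V, ∀ β ∈ B, Commute β (b * v) := by
  let L : Subgroup G := B.map (MulAut.conj b⁻¹).toMonoidHom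
  have hLe : L ≤ V ⊔ B := by
    rintro _ ⟨β, hβ, rfl⟩
    have : (MulAut.conj b⁻¹).toMonoidHom β = (b⁻¹ * (β * b * β⁻¹)) * β := by simp; group
    rw [this]
    exact (V ⊔ B).mul_mem ((le_sup_left : V ≤ V ⊔ B) (hb β hβ)) ((le_sup_right : B ≤ V ⊔ B) hβ)
  obtain ⟨j, hj, hjL⟩ := SC hr hB hV hBV (hB.map _) hLe
  refine ⟨j⁻¹, V.inv_mem hj, fun β hβ => ?_⟩
  have h1 := hjL _ (mem_map_of_mem _ hβ)
  have h2 := fix_of_SC hr hB hV hβ h1 (by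
    have : j * (MulAut.conj b⁻¹).toMonoidHom β * j⁻¹ * β⁻¹ =
       j * (b⁻¹ * (β * b * β⁻¹)) * (β * j⁻¹ * β⁻¹) := by simp; group
    rw [this]
    exact V.mul_mem (V.mul_mem hj (hb β hβ)) (nm_conj (hBV hβ) (V.inv_mem hj)))
  have h3 : j * (b⁻¹ * β * b) * j⁻¹ = β := by simpa using h2
  show β * (b * j⁻¹) = b * j⁻¹ * β
  conv_rhs => rw [← h3]
  group

theorem SZ {r : ℕ} (hr : r.Prime) {D : Subgroup G} {x t : G} (hx : pel r x) (hD : (Nat.card D).Coprime r)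
    (hxD : x ∈ nm D) (ht : t ∈ D) (htx : pel r (t * x)) : ∃ d ∈ D, d * x * d⁻¹ = t * x := by
  obtain ⟨j, hj, hjL⟩ := SC hr (isPGroup_zpowers hx) hD (zpowers_le_nm hxD) (isPGroup_zpowers htx)
    (by rw [zpowers_le]; exact (D ⊔ zpowers x).mul_mem ((le_sup_left : D ≤ _) ht)
          ((le_sup_right : zpowers x ≤ _) (mem_zpowers x)))
  have h1 := hjL _ (mem_zpowers _)
  have h2 := fix_of_SC hr (isPGroup_zpowers hx) hD (mem_zpowers x) h1 (by
    have : j * (t * x) * j⁻¹ * x⁻¹ = j * t * (x * j⁻¹ * x⁻¹) := by group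
    rw [this]
    exact D.mul_mem (D.mul_mem hj ht) (nm_conj hxD (D.inv_mem hj)))
  refine ⟨j⁻¹, D.inv_mem hj, ?_⟩
  conv_lhs => rw [← h2]
  group


def Nil (N : Subgroup G) : Prop :=
  ∀ a ∈ N, ∀ b ∈ N, (orderOf a).Coprime (orderOf b) → Commute a b

theorem Nil.mono {N M : Subgroup G} (h : Nil N) (hM : M ≤ N) : Nil M :=
  fun a ha b hb => h a (hM ha) b (hM hb)

theorem coprime_order_of {q : ℕ} {a b : G} (ha : pel q a) (hb : ppel q b) :
    (orderOf a).Coprime (orderOf b) := by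
  obtain ⟨n, hn⟩ := ha
  exact Nat.Coprime.coprime_dvd_left (orderOf_dvd_of_pow_eq_one hn) (Nat.Coprime.pow_left _ hb.symm)

theorem Nil.comm {N : Subgroup G} (h : Nil N) {q : ℕ} {a b : G} (ha : a ∈ N) (hb : b ∈ N)
    (ha' : pel q a) (hb' : ppel q b) : Commute a b := h a ha b hb (coprime_order_of ha' hb')

theorem Nil.sylow_normal {N : Subgroup G} (h : Nil N) {p : ℕ} [hp : Fact p.Prime] (P : Sylow p N) :
    (P : Subgroup N).Normal := by
  rw [← normalizer_eq_top_iff, ← index_eq_one]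
  by_contra hne
  obtain ⟨l, hl, hld⟩ := Nat.exists_prime_and_dvd hne
  haveI := Fact.mk hl
  by_cases hlp : l = p
  · subst hlp
    have h1 := P.not_dvd_index
    have h2 := index_dvd_of_le (le_normalizer (H := (P : Subgroup N)))
    exact h1 (hld.trans h2)
  · obtain ⟨Q⟩ : Nonempty (Sylow l N) := inferInstance
    have hQ : (Q : Subgroup N) ≤ normalizer ((P : Subgroup N) : Set N) := by
      intro y hy
      rw [mem_normalizer_iff]
      have key : ∀ g ∈ (P : Subgroup N), y * g * y⁻¹ = g := by
        intro g hg
        have h1 : pel l y := by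
          obtain ⟨n, hn⟩ := Q.2 ⟨y, hy⟩; exact ⟨n, by simpa [Subtype.ext_iff] using hn⟩
        have h2 : pel p g := by
          obtain ⟨n, hn⟩ := P.2 ⟨g, hg⟩; exact ⟨n, by simpa [Subtype.ext_iff] using hn⟩
        have h3 := coprime_order_of h1 (h2.ppel_of_ne hp.1 hl (Ne.symm hlp))
        have h4 := h y y.2 g g.2 (by simpa using h3)
        have h5 : y * g = g * y := Subtype.ext h4
        rw [h5]; group
      intro g
      constructor
      · intro hg; rw [key g hg]; exact hg
      · intro hg
        have := key _ hg
        have h6 : y * g * y⁻¹ = g := by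
          have := congrArg (fun z => y⁻¹ * z * y) this
          simp only [mul_assoc, inv_mul_cancel_left, inv_mul_cancel, mul_one] at this
          simpa [mul_assoc] using this
        rwa [h6] at hg
    exact Q.not_dvd_index (hld.trans (index_dvd_of_le hQ))

theorem Nil.isNilpotent {N : Subgroup G} (h : Nil N) : Group.IsNilpotent N :=
  (Group.isNilpotent_of_finite_tfae.out 0 3).2 fun p hp P => @Nil.sylow_normal _ _ _ _ h p hp P

theorem sylow_normal_of_nilp {N : Type u} [Group N] [Finite N] [hN : Group.IsNilpotent N] {p : ℕ} [hp : Fact p.Prime]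
    (P : Sylow p N) : (P : Subgroup N).Normal :=
  ((Group.isNilpotent_of_finite_tfae (G := N)).out 0 3 :
    Group.IsNilpotent N ↔ ∀ (p : ℕ) (_hp : Fact p.Prime) (P : Sylow p N), (↑P : Subgroup N).Normal).1 hN p hp P

theorem nil_top_of_isNilpotent {N : Type u} [Group N] [Finite N] [hN : Group.IsNilpotent N] :
    Nil (⊤ : Subgroup N) := by
  intro a _ b _ hab
  have key : ∀ l : ℕ, l.Prime → ∀ m : ℕ, m.Prime → Commute (qp l a) (qp m b) := by
    intro l hl m hm
    haveI := Fact.mk hl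
    haveI := Fact.mk hm
    by_cases hlm : l = m
    · subst hlm
      rcases Nat.coprime_or_dvd_of_prime hl (orderOf a) with h1 | h1
      · rw [(ppel_iff hl).1 h1.symm]; exact Commute.one_left _
      · have : ppel l b := Nat.Coprime.coprime_dvd_right h1 hab.symm
        rw [(ppel_iff hl).1 this]; exact Commute.one_right _
    · obtain ⟨P, hP⟩ := (isPGroup_zpowers (pel_qp hl a)).exists_le_sylow
      obtain ⟨Q, hQ⟩ := (isPGroup_zpowers (pel_qp hm b)).exists_le_sylow
      haveI := sylow_normal_of_nilp P
      haveI := sylow_normal_of_nilp Q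
      exact commute_of_normal_of_disjoint P Q ‹_› ‹_› (IsPGroup.disjoint_of_ne l m hlm _ _ P.2 Q.2) _ _
        (hP (mem_zpowers _)) (hQ (mem_zpowers _))
  have h1 : ∀ m : ℕ, m.Prime → a ∈ centralizer {qp m b} := by
    intro m hm
    apply mem_of_qp
    intro l hl
    rw [mem_centralizer_singleton_iff]
    exact (key l hl m hm).eq
  have h2 : b ∈ centralizer {a} := by
    apply mem_of_qp
    intro m hm
    have := h1 m hm
    rw [mem_centralizer_singleton_iff] at this ⊢
    exact this.symm
  rw [mem_centralizer_singleton_iff] at h2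
  exact h2.symm

theorem nil_of_isNilpotent {N : Subgroup G} (hN : Group.IsNilpotent N) : Nil N := by
  intro a ha b hb hab
  have := nil_top_of_isNilpotent (N := N) ⟨a, ha⟩ trivial ⟨b, hb⟩ trivial (by simpa using hab)
  exact congrArg Subtype.val this.eq

theorem Nil.pel_mul {N : Subgroup G} (h : Nil N) {q : ℕ} (hq : q.Prime) {a b : G} (ha : a ∈ N)
    (hb : b ∈ N) (ha' : pel q a) (hb' : pel q b) : pel q (a * b) := by
  haveI := Fact.mk hq
  have ha2 : pel q (⟨a, ha⟩ : N) := by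
    obtain ⟨n, hn⟩ := ha'; exact ⟨n, by simpa [Subtype.ext_iff] using hn⟩
  have hb2 : pel q (⟨b, hb⟩ : N) := by
    obtain ⟨n, hn⟩ := hb'; exact ⟨n, by simpa [Subtype.ext_iff] using hn⟩
  obtain ⟨P, hP⟩ := (isPGroup_zpowers ha2).exists_le_sylow
  obtain ⟨Q, hQ⟩ := (isPGroup_zpowers hb2).exists_le_sylow
  haveI := h.sylow_normal P
  have h3 : IsPGroup q (P ⊔ Q : Subgroup N) := IsPGroup.to_sup_of_normal_left P.2 Q.2
  have h4 := pel_of_mem h3 ((P ⊔ Q : Subgroup N).mul_mem ((le_sup_left : (P : Subgroup N) ≤ (P : Subgroup N) ⊔ Q) (hP (mem_zpowers _)))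
    ((le_sup_right : (Q : Subgroup N) ≤ (P : Subgroup N) ⊔ Q) (hQ (mem_zpowers _))))
  obtain ⟨n, hn⟩ := h4
  exact ⟨n, by simpa [Subtype.ext_iff] using hn⟩

theorem Nil.ppel_mul {N : Subgroup G} (h : Nil N) {q : ℕ} (hq : q.Prime) {a b : G} (ha : a ∈ N)
    (hb : b ∈ N) (ha' : ppel q a) (hb' : ppel q b) : ppel q (a * b) := by
  haveI := Fact.mk hq
  obtain ⟨P⟩ : Nonempty (Sylow q N) := inferInstance
  haveI := h.sylow_normal P
  obtain ⟨K, hK⟩ := Subgroup.exists_right_complement'_of_coprime P.card_coprime_index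
  have hKc : (Nat.card K).Coprime q := by
    have h1 : Nat.card K = (P : Subgroup N).index := by
      have := hK.symm.index_eq_card
      exact this.symm
    rw [h1]
    exact ((Nat.Prime.coprime_iff_not_dvd hq).2 P.not_dvd_index).symm
  have key : ∀ c (hc : c ∈ N), ppel q c → (⟨c, hc⟩ : N) ∈ K := by
    intro c hc hc'
    obtain ⟨⟨⟨p, hp⟩, ⟨k, hk⟩⟩, hpk⟩ := hK.2 ⟨c, hc⟩
    simp only at hpk
    have hp1 : pel q p := by
      obtain ⟨n, hn⟩ := P.2 ⟨p, hp⟩; exact ⟨n, by simpa [Subtype.ext_iff] using hn⟩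
    have hp2 : pel q (p : G) := by
      obtain ⟨n, hn⟩ := hp1; exact ⟨n, by simpa [Subtype.ext_iff] using hn⟩
    have hk2 : ppel q (k : G) := by
      have := ppel_of_mem hKc hk
      simpa [ppel] using this
    have hcm : Commute (p : G) k := h.comm p.2 k.2 hp2 hk2
    have h5 : c = p * k := by rw [Subtype.ext_iff] at hpk; simpa using hpk.symm
    rw [h5, ppel_iff hq, qp_mul hcm, qp_of_pel hq hp2, (ppel_iff hq).1 hk2, mul_one] at hc'
    have : p = 1 := Subtype.ext hc'
    rw [← hpk, this, one_mul]; exact hk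
  have := ppel_of_mem hKc (K.mul_mem (key a ha ha') (key b hb hb'))
  have h6 : (⟨a, ha⟩ : N) * ⟨b, hb⟩ = ⟨a * b, N.mul_mem ha hb⟩ := rfl
  rw [h6] at this
  rw [ppel, Subgroup.orderOf_mk] at this
  exact this

/-- the Sylow q-subgroup of a nilpotent subgroup -/
def Nil.Op {N : Subgroup G} (h : Nil N) {q : ℕ} (hq : q.Prime) : Subgroup G where
  carrier := {g | g ∈ N ∧ pel q g}
  mul_mem' := fun {a b} ha hb => ⟨N.mul_mem ha.1 hb.1, h.pel_mul hq ha.1 hb.1 ha.2 hb.2⟩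
  one_mem' := ⟨N.one_mem, pel_one⟩
  inv_mem' := fun {a} ha => ⟨N.inv_mem ha.1, ha.2.inv⟩
def Nil.Opp {N : Subgroup G} (h : Nil N) {q : ℕ} (hq : q.Prime) : Subgroup G where
  carrier := {g | g ∈ N ∧ ppel q g}
  mul_mem' := fun {a b} ha hb => ⟨N.mul_mem ha.1 hb.1, h.ppel_mul hq ha.1 hb.1 ha.2 hb.2⟩
  one_mem' := ⟨N.one_mem, ppel_one⟩
  inv_mem' := fun {a} ha => ⟨N.inv_mem ha.1, ha.2.inv⟩

section
variable {N : Subgroup G} (h : Nil N) {q : ℕ} (hq : q.Prime)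
theorem Nil.mem_Op {g : G} : g ∈ h.Op hq ↔ g ∈ N ∧ pel q g := Iff.rfl
theorem Nil.mem_Opp {g : G} : g ∈ h.Opp hq ↔ g ∈ N ∧ ppel q g := Iff.rfl
theorem Nil.Op_le : h.Op hq ≤ N := fun _ hg => hg.1
theorem Nil.Op_isPGroup : IsPGroup q (h.Op hq) := isPGroup_of fun _ hg => hg.2
theorem Nil.Opp_coprime : (Nat.card (h.Opp hq)).Coprime q := coprime_of hq fun _ hg => hg.2
theorem Nil.nm_Op {x : G} (hx : x ∈ nm N) : x ∈ nm (h.Op hq) :=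
  nm_of fun b hb => ⟨nm_conj hx hb.1, hb.2.conj x⟩
theorem Nil.nm_Opp {x : G} (hx : x ∈ nm N) : x ∈ nm (h.Opp hq) :=
  nm_of fun b hb => ⟨nm_conj hx hb.1, hb.2.conj x⟩
end

theorem Nil.map {N : Subgroup G} (h : Nil N) {G' : Type u} [Group G'] [Finite G'] (f : G →* G') :
    Nil (N.map f) := by
  haveI := h.isNilpotent
  exact nil_of_isNilpotent (Group.nilpotent_of_surjective (f.subgroupMap N) (f.subgroupMap_surjective N))

theorem nil_comap {G' : Type u} [Group G'] [Finite G'] (f : G →* G') (hf : Function.Injective f)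
    {N : Subgroup G'} (h : Nil N) : Nil (N.comap f) := by
  intro a ha b hb hab
  have := h (f a) ha (f b) hb (by simpa [orderOf_injective f hf] using hab)
  exact hf (by simpa using this.eq)

def Gd (x : G) (H : Subgroup G) : Prop :=
  ∃ N : Subgroup G, Nil N ∧ N ≤ H ∧ H ≤ nm N ∧ ∀ h ∈ H, ⁅h, x⁆ ∈ N
def InI (x : G) : Prop := ∀ y, Gd x (closure {x, y})

theorem Gd.map {x : G} {H : Subgroup G} (h : Gd x H) {G' : Type u} [Group G'] [Finite G'] (f : G →* G') :
    Gd (f x) (H.map f) := by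
  obtain ⟨N, h1, h2, h3, h4⟩ := h
  refine ⟨N.map f, h1.map f, map_mono h2, ?_, ?_⟩
  · rintro _ ⟨g, hg, rfl⟩
    apply nm_of
    rintro _ ⟨b, hb, rfl⟩
    exact ⟨g * b * g⁻¹, nm_conj (h3 hg) hb, by simp⟩
  · rintro _ ⟨g, hg, rfl⟩
    exact ⟨⁅g, x⁆, h4 g hg, by simp [map_commutatorElement]⟩

theorem Gd.comap {G' : Type u} [Group G'] [Finite G'] (f : G →* G') (hf : Function.Injective f)
    {x : G} {H : Subgroup G} (h : Gd (f x) (H.map f)) : Gd x H := by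
  obtain ⟨N, h1, h2, h3, h4⟩ := h
  refine ⟨N.comap f, nil_comap f hf h1, ?_, ?_, ?_⟩
  · intro g hg
    obtain ⟨k, hk, hkg⟩ := h2 hg
    rwa [← hf hkg]
  · intro g hg
    apply nm_of
    intro b hb
    have := nm_conj (h3 (mem_map_of_mem f hg)) hb
    simpa using this
  · intro g hg
    have := h4 _ (mem_map_of_mem f hg)
    show f ⁅g, x⁆ ∈ N
    simpa [map_commutatorElement] using this

theorem Gd.mono {x : G} {H K : Subgroup G} (h : Gd x H) (hK : K ≤ H) (hx : x ∈ K) : Gd x K := by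
  obtain ⟨N, h1, h2, h3, h4⟩ := h
  refine ⟨N ⊓ K, h1.mono inf_le_left, inf_le_right, ?_, fun k hk => ⟨h4 k (hK hk), ?_⟩⟩
  · intro k hk
    exact nm_of fun b hb => ⟨nm_conj (h3 (hK hk)) hb.1, K.mul_mem (K.mul_mem hk hb.2) (K.inv_mem hk)⟩
  · rw [commutatorElement_def]
    exact K.mul_mem (K.mul_mem (K.mul_mem hk hx) (K.inv_mem hk)) (K.inv_mem hx)

theorem Gd.pow {x : G} {H : Subgroup G} (h : Gd x H) (hx : x ∈ H) (k : ℕ) : Gd (x ^ k) H := by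
  obtain ⟨N, h1, h2, h3, h4⟩ := h
  refine ⟨N, h1, h2, h3, fun g hg => ?_⟩
  induction k with
  | zero => simp [commutatorElement_def, N.one_mem]
  | succ k ih =>
    have : ⁅g, x ^ (k+1)⁆ = ⁅g, x⁆ * (x * ⁅g, x ^ k⁆ * x⁻¹) := by
      simp only [commutatorElement_def, pow_succ']; group
    rw [this]
    exact N.mul_mem (h4 g hg) (nm_conj (h3 hx) ih)

theorem InI.pow {x : G} (h : InI x) (k : ℕ) : InI (x ^ k) := by
  intro y
  have h1 := (h y).pow (subset_closure (by simp)) k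
  refine h1.mono ?_ (subset_closure (by simp))
  rw [closure_le]
  rintro z (rfl | rfl)
  · exact Subgroup.pow_mem _ (subset_closure (by simp)) _
  · exact subset_closure (by simp)

theorem InI.map {x : G} (h : InI x) {G' : Type u} [Group G'] [Finite G'] (f : G →* G')
    (hf : Function.Surjective f) : InI (f x) := by
  intro y
  obtain ⟨y, rfl⟩ := hf y
  have := (h y).map f
  rwa [MonoidHom.map_closure, Set.image_pair] at this

theorem InI.comap {G' : Type u} [Group G'] [Finite G'] (f : G →* G') (hf : Function.Injective f)
    {x : G} (h : InI (f x)) : InI x := by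
  intro y
  apply Gd.comap f hf
  rw [MonoidHom.map_closure, Set.image_pair]
  exact h _

theorem InI.conj {x : G} (h : InI x) (c : G) : InI (c * x * c⁻¹) := by
  simpa using h.map (MulAut.conj c).toMonoidHom (MulAut.conj c).surjective

theorem closure_pair_isPGroup {p : ℕ} {u : G} (h : ∀ g : G, IsPGroup p (closure {u, g * u * g⁻¹}))
    (g k : G) : IsPGroup p (closure {g * u * g⁻¹, k * u * k⁻¹}) := by
  refine ((h (g⁻¹ * k)).map (MulAut.conj g).toMonoidHom).to_le ?_
  rw [MonoidHom.map_closure, Set.image_pair]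
  apply Subgroup.closure_mono
  rintro z (rfl | rfl)
  · left; simp
  · right; simp [mul_assoc]

theorem BS_aux {p : ℕ} (hp : p.Prime) {E D : Set G} (hE : ∀ g, ∀ e ∈ E, g * e * g⁻¹ ∈ E) {P : Subgroup G}
    (hP : IsPGroup p P) (hDP : D ⊆ P) (hDE : D ⊆ E) (hn : ∃ a ∈ P, a ∈ E ∧ a ∉ closure D) :
    ∃ a ∈ P, a ∈ E ∧ a ∉ closure D ∧ a ∈ nm (closure D) := by
  have hLP : closure D ≤ P := (closure_le _).2 hDP
  by_cases h1 : P ≤ nm (closure D)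
  · obtain ⟨a, ha, haE, haL⟩ := hn
    exact ⟨a, ha, haE, haL, h1 ha⟩
  · obtain ⟨g, hgP, hgQ, hg⟩ := exists_nm_gt hp hP (inf_le_left : P ⊓ nm (closure D) ≤ P)
      (fun h => h1 (le_inf_iff.1 h).2)
    have hgn : g ∉ nm (closure D) := fun h => hgQ ⟨hgP, h⟩
    have : ∃ b ∈ D, g * b * g⁻¹ ∉ closure D := by
      by_contra hc
      push Not at hc
      exact hgn (nm_closure hc)
    obtain ⟨b, hb, hbg⟩ := this
    have h2 := nm_conj hg (show b ∈ P ⊓ nm (closure D) from ⟨hDP hb, le_nm _ (subset_closure hb)⟩)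
    exact ⟨_, h2.1, hE _ _ (hDE hb), hbg, h2.2⟩

theorem BS {p : ℕ} (hp : p.Prime) (u : G) (h : ∀ g : G, IsPGroup p (closure {u, g * u * g⁻¹})) :
    ∃ O : Subgroup G, O.Normal ∧ IsPGroup p O ∧ u ∈ O := by
  haveI := Fact.mk hp
  let E : Set G := {e | ∃ g : G, e = g * u * g⁻¹}
  have hE : ∀ g, ∀ e ∈ E, g * e * g⁻¹ ∈ E := by
    rintro g _ ⟨k, rfl⟩
    exact ⟨g * k, by group⟩
  have hu : u ∈ E := ⟨1, by simp⟩
  have hpair : ∀ a ∈ E, ∀ b ∈ E, IsPGroup p (closure {a, b}) := by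
    rintro _ ⟨g, rfl⟩ _ ⟨k, rfl⟩
    exact closure_pair_isPGroup h g k
  by_cases hall : ∀ P Q : Sylow p G, (P : Set G) ∩ E ⊆ Q
  · refine ⟨closure E, ?_, ?_, subset_closure hu⟩
    · exact normal_of_nm fun g => nm_closure fun b hb => subset_closure (hE g b hb)
    · obtain ⟨P⟩ : Nonempty (Sylow p G) := inferInstance
      refine P.2.to_le ((closure_le _).2 ?_)
      intro e he
      obtain ⟨Q, hQ⟩ := (hpair e he e he).exists_le_sylow
      exact hall Q P ⟨hQ (subset_closure (by simp)), he⟩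
  · exfalso
    have hle : ∀ P Q : Sylow p G, ((P : Set G) ∩ E).ncard ≤ ((Q : Set G) ∩ E).ncard := by
      intro P Q
      obtain ⟨g, hg⟩ := MulAction.exists_smul_eq G P Q
      refine Set.ncard_le_ncard_of_injOn (fun z => g * z * g⁻¹) ?_ ?_ (Set.toFinite _)
      · rintro z ⟨hz, hzE⟩
        refine ⟨?_, hE _ _ hzE⟩
        rw [← hg]
        show g * z * g⁻¹ ∈ g • P
        rw [← SetLike.mem_coe, Sylow.coe_smul]
        exact ⟨z, hz, by simp⟩
      · intro a _ b _ hab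
        simpa using hab
    push Not at hall
    obtain ⟨P0, Q0, h0⟩ := hall
    let X := {PQ : Sylow p G × Sylow p G // ¬ ((PQ.1 : Set G) ∩ E ⊆ PQ.2)}
    haveI : Nonempty X := ⟨⟨(P0, Q0), h0⟩⟩
    obtain ⟨⟨⟨P, Q⟩, hPQ⟩, hmax⟩ := Finite.exists_max
      (fun z : X => ((z.1.1 : Set G) ∩ z.1.2 ∩ E).ncard)
    simp only at hPQ
    have hQP : ¬ ((Q : Set G) ∩ E ⊆ P) := by
      intro hc
      have h1 : (Q : Set G) ∩ E ⊆ (P : Set G) ∩ E := fun z hz => ⟨hc hz, hz.2⟩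
      have h2 := Set.eq_of_subset_of_ncard_le h1 (hle P Q) (Set.toFinite _)
      exact hPQ (by rw [← h2]; exact Set.inter_subset_left)
    set D : Set G := (P : Set G) ∩ Q ∩ E with hD
    have hDLP : closure D ≤ P := (closure_le _).2 fun z hz => hz.1.1
    have hDLQ : closure D ≤ Q := (closure_le _).2 fun z hz => hz.1.2
    obtain ⟨a, haP, haE, haL, han⟩ := BS_aux (D := D) (P := P) hp hE P.2 (fun z hz => hz.1.1) (fun z hz => hz.2) (by
      obtain ⟨a, ha, haQ⟩ := Set.not_subset.1 hPQ
      exact ⟨a, ha.1, ha.2, fun hc => haQ (hDLQ hc)⟩)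
    obtain ⟨b, hbQ, hbE, hbL, hbn⟩ := BS_aux (D := D) (P := Q) hp hE Q.2 (fun z hz => hz.1.2) (fun z hz => hz.2) (by
      obtain ⟨a, ha, haQ⟩ := Set.not_subset.1 hQP
      exact ⟨a, ha.1, ha.2, fun hc => haQ (hDLP hc)⟩)
    have hR : IsPGroup p (closure D ⊔ closure {a, b} : Subgroup G) := by
      refine sup_isPGroup (P.2.to_le hDLP) (hpair a haE b hbE) ?_
      rw [closure_le]
      rintro z (rfl | rfl)
      · exact han
      · exact hbn
    obtain ⟨R, hRle⟩ := hR.exists_le_sylow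
    have hDR : D ⊆ R := fun z hz => hRle ((le_sup_left : closure D ≤ _) (subset_closure hz))
    have haR : a ∈ R := hRle ((le_sup_right : closure {a, b} ≤ _) (subset_closure (by simp)))
    have hbR : b ∈ R := hRle ((le_sup_right : closure {a, b} ≤ _) (subset_closure (by simp)))
    have h1 : (P : Set G) ∩ E ⊆ R := by
      by_contra hc
      have := hmax (⟨(P, R), hc⟩ : X)
      simp only at this
      have h2 : D ⊂ (P : Set G) ∩ R ∩ E := by
        have h4 : D ⊆ (P : Set G) ∩ R ∩ E := fun z hz => ⟨⟨hz.1.1, hDR hz⟩, hz.2⟩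
        exact (Set.ssubset_iff_of_subset h4).2
          ⟨a, ⟨⟨haP, haR⟩, haE⟩, fun hc => haL (subset_closure hc)⟩
      exact absurd (Set.ncard_lt_ncard h2 (Set.toFinite _)) (not_lt.2 this)
    have h1' : (R : Set G) ∩ E ⊆ P := by
      have h3 : (P : Set G) ∩ E ⊆ (R : Set G) ∩ E := fun z hz => ⟨h1 hz, hz.2⟩
      have h2 := Set.eq_of_subset_of_ncard_le h3 (hle R P) (Set.toFinite _)
      rw [← h2]; exact Set.inter_subset_left
    have hbP : b ∈ P := h1' ⟨hbR, hbE⟩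
    exact hbL (subset_closure ⟨⟨hbP, hbQ⟩, hbE⟩)

/-- relative version -/
theorem BS_rel {p : ℕ} (hp : p.Prime) (C : Subgroup G) {u : G} (hu : u ∈ C)
    (h : ∀ c ∈ C, IsPGroup p (closure {u, c * u * c⁻¹})) :
    ∃ O : Subgroup G, O ≤ C ∧ C ≤ nm O ∧ IsPGroup p O ∧ u ∈ O := by
  obtain ⟨O, hn, hO, huO⟩ := BS hp (⟨u, hu⟩ : C) (by
    rintro ⟨g, hg⟩
    have h1 := h g hg
    have h2 : closure {u, g * u * g⁻¹} = (closure {(⟨u, hu⟩ : C), ⟨g, hg⟩ * ⟨u, hu⟩ * ⟨g, hg⟩⁻¹}).map C.subtype := by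
      rw [MonoidHom.map_closure, Set.image_pair]; rfl
    rw [h2] at h1
    exact h1.of_equiv (equivMapOfInjective _ C.subtype C.subtype_injective).symm)
  refine ⟨O.map C.subtype, map_subtype_le O, ?_, hO.map _, ⟨_, huO, rfl⟩⟩
  intro c hc
  apply nm_of
  rintro _ ⟨b, hb, rfl⟩
  exact ⟨_, hn.conj_mem b hb ⟨c, hc⟩, rfl⟩

/-! commutator / coprime action lemmas -/

theorem of_eq_one {Q : Subgroup G} {b : G} (hb : b ∈ Q) :
    Abelianization.of (⟨b, hb⟩ : Q) = 1 ↔ b ∈ ⁅Q, Q⁆ := by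
  rw [← MonoidHom.mem_ker, Abelianization.ker_of, ← map_subtype_commutator]
  constructor
  · intro h; exact ⟨_, h, rfl⟩
  · rintro ⟨c, hc, hcb⟩
    have : c = ⟨b, hb⟩ := Subtype.ext hcb
    rwa [← this]

theorem der_le (Q : Subgroup G) : ⁅Q, Q⁆ ≤ Q := commutator_le_self Q

theorem Theta {Q : Subgroup G} {x : G} (hx : x ∈ nm Q) :
    ∃ Θ : Abelianization Q →* Abelianization Q, ∀ b (hb : b ∈ Q),
      Θ (Abelianization.of ⟨b, hb⟩) = Abelianization.of ⟨⁅b, x⁆, nm_comm hx hb⟩ := by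
  let σ : Q →* Q := MonoidHom.mk' (fun b => ⟨x * b * x⁻¹, nm_conj hx b.2⟩) (by
    intro a b; ext; simp)
  refine ⟨Abelianization.lift (Abelianization.of / (Abelianization.of.comp σ)), fun b hb => ?_⟩
  rw [Abelianization.lift_apply_of, MonoidHom.div_apply, MonoidHom.comp_apply, ← map_div]
  congr 1
  ext
  simp [σ, commutatorElement_def, div_eq_mul_inv, mul_assoc]

def FQ (x : G) (Q : Subgroup G) : Prop := ∀ b ∈ Q, ⁅b, x⁆ ∈ ⁅Q, Q⁆ → b ∈ ⁅Q, Q⁆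

theorem alpha {Q : Subgroup G} {x : G} (hx : x ∈ nm Q) (h : Q ≤ closure {t | ∃ b ∈ Q, t = ⁅b, x⁆}) :
    FQ x Q := by
  obtain ⟨Θ, hΘ⟩ := Theta hx
  have hsurj : Function.Surjective Θ := by
    rw [← MonoidHom.range_eq_top, eq_top_iff]
    have key : closure {t | ∃ b ∈ Q, t = ⁅b, x⁆} ≤ (Θ.range.comap (Abelianization.of (G := Q))).map Q.subtype := by
      rw [closure_le]
      rintro _ ⟨b, hb, rfl⟩
      exact ⟨⟨⁅b, x⁆, nm_comm hx hb⟩, ⟨_, hΘ b hb⟩, rfl⟩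
    intro z _
    obtain ⟨⟨b, hb⟩, rfl⟩ := QuotientGroup.mk_surjective z
    obtain ⟨⟨c, hc⟩, h1, h2⟩ := key (h hb)
    have : (⟨b, hb⟩ : Q) = ⟨c, hc⟩ := Subtype.ext h2.symm
    rw [this]; exact h1
  have hinj : Function.Injective Θ := Finite.injective_iff_surjective.2 hsurj
  intro b hb hbx
  rw [← of_eq_one hb]
  apply hinj
  rw [hΘ, map_one, of_eq_one]; exact hbx

theorem sup_der {Q K : Subgroup G} {q : ℕ} (hq : q.Prime) (hQ : IsPGroup q Q) (hK : Q ≤ nm K) (hKQ : K ≤ Q)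
    (h : ∀ b ∈ Q, ∃ k ∈ K, k⁻¹ * b ∈ ⁅Q, Q⁆) : Q ≤ K := by
  haveI := Fact.mk hq
  haveI : Group.IsNilpotent Q := hQ.isNilpotent
  haveI : (K.subgroupOf Q).Normal := (normal_subgroupOf_iff_le_normalizer hKQ).2 hK
  by_contra hc
  haveI : Nontrivial (Q ⧸ K.subgroupOf Q) := by
    rw [QuotientGroup.nontrivial_iff]
    intro h; exact hc (subgroupOf_eq_top.1 h)
  have h1 : commutator (Q ⧸ K.subgroupOf Q) < ⊤ := IsSolvable.commutator_lt_top_of_nontrivial _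
  apply h1.ne
  rw [eq_top_iff]
  intro z _
  obtain ⟨⟨b, hb⟩, rfl⟩ := QuotientGroup.mk_surjective z
  obtain ⟨k, hk, hkb⟩ := h b hb
  have h2 : (⟨k⁻¹ * b, der_le Q hkb⟩ : Q) ∈ commutator Q := by
    rw [← Abelianization.ker_of, MonoidHom.mem_ker, of_eq_one]; exact hkb
  have h3 : commutator (Q ⧸ K.subgroupOf Q) = (commutator Q).map (QuotientGroup.mk' (K.subgroupOf Q)) := by
    rw [commutator_def, commutator_def, map_commutator, map_top_of_surjective _ (QuotientGroup.mk'_surjective _)]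
  rw [h3]
  refine ⟨_, h2, ?_⟩
  rw [QuotientGroup.mk'_apply, QuotientGroup.eq, mem_subgroupOf]
  have : b⁻¹ * k * b ∈ K := nm_conj' (hK hb) hk
  simpa using this

theorem eq_bot_of_le_der {Q : Subgroup G} {q : ℕ} (hq : q.Prime) (hQ : IsPGroup q Q) (h : Q ≤ ⁅Q, Q⁆) :
    Q = ⊥ := by
  rw [eq_bot_iff]
  refine sup_der hq hQ (fun g _ => nm_of (by simp)) bot_le fun b hb => ⟨1, by simp, by simpa using h hb⟩

theorem comm_closure_nm {Q : Subgroup G} {x : G} : Q ≤ nm (closure {t | ∃ b ∈ Q, t = ⁅b, x⁆}) := by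
  intro y hy
  apply nm_closure
  rintro _ ⟨b, hb, rfl⟩
  have : y * ⁅b, x⁆ * y⁻¹ = ⁅y * b, x⁆ * ⁅y, x⁆⁻¹ := by simp only [commutatorElement_def]; group
  rw [this]
  exact mul_mem (subset_closure ⟨_, Q.mul_mem hy hb, rfl⟩) (inv_mem (subset_closure ⟨_, hy, rfl⟩))

theorem beta {Q : Subgroup G} {q : ℕ} (hq : q.Prime) (hQ : IsPGroup q Q) {x : G} (hx : x ∈ nm Q)
    (h : FQ x Q) : Q ≤ closure {t | ∃ b ∈ Q, t = ⁅b, x⁆} := by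
  obtain ⟨Θ, hΘ⟩ := Theta hx
  have hinj : Function.Injective Θ := by
    rw [injective_iff_map_eq_one]
    intro z hz
    obtain ⟨⟨b, hb⟩, rfl⟩ := QuotientGroup.mk_surjective z
    have h1 : Θ (Abelianization.of ⟨b, hb⟩) = 1 := hz
    rw [hΘ, of_eq_one] at h1
    exact (of_eq_one hb).2 (h b hb h1)
  have hsurj : Function.Surjective Θ := Finite.injective_iff_surjective.1 hinj
  refine sup_der hq hQ comm_closure_nm ?_ ?_
  · rw [closure_le]; rintro _ ⟨b, hb, rfl⟩; exact nm_comm hx hb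
  · intro b hb
    obtain ⟨z, hz⟩ := hsurj (Abelianization.of ⟨b, hb⟩)
    obtain ⟨⟨c, hc⟩, rfl⟩ := QuotientGroup.mk_surjective z
    have h1 : Θ (Abelianization.of ⟨c, hc⟩) = Abelianization.of ⟨b, hb⟩ := hz
    rw [hΘ] at h1
    refine ⟨⁅c, x⁆, subset_closure ⟨c, hc, rfl⟩, ?_⟩
    rw [← of_eq_one (Q.mul_mem (Q.inv_mem (nm_comm hx hc)) hb)]
    have : (⟨⁅c, x⁆⁻¹ * b, Q.mul_mem (Q.inv_mem (nm_comm hx hc)) hb⟩ : Q) = ⟨⁅c, x⁆, nm_comm hx hc⟩⁻¹ * ⟨b, hb⟩ := rfl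
    rw [this, map_mul, map_inv, h1, inv_mul_cancel]

theorem qr_of_ppel {q : ℕ} (hq : q.Prime) {g : G} (h : ppel q g) : qr q g = g := by
  rw [qr, (ppel_iff hq).1 h]; simp

theorem qp_pel_ne {p q : ℕ} (hp : p.Prime) (hq : q.Prime) (hne : p ≠ q) {g : G} (h : pel p g) :
    qp q g = 1 := (ppel_iff hq).1 (h.ppel_of_ne hp hq hne)

theorem qp_qr_ne {r q : ℕ} (hr : r.Prime) (hq : q.Prime) (hne : q ≠ r) (g : G) : qp q (qr r g) = qp q g := by
  conv_rhs => rw [← qp_mul_qr (q := r) g]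
  rw [qp_mul (qp_comm (qr_comm (Commute.refl g)).symm), qp_pel_ne hr hq hne.symm (pel_qp hr g), one_mul]

theorem coprime_pgroup {p q : ℕ} (hp : p.Prime) (hq : q.Prime) (hne : p ≠ q) {Q : Subgroup G}
    (hQ : IsPGroup p Q) : (Nat.card Q).Coprime q :=
  coprime_of hq fun _ hg => (pel_of_mem hQ hg).ppel_of_ne hp hq hne

theorem nm_der {Q : Subgroup G} {x : G} (hx : x ∈ nm Q) : x ∈ nm ⁅Q, Q⁆ := by
  apply nm_of
  intro b hb
  have h1 : Q.map (MulAut.conj x).toMonoidHom ≤ Q := by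
    rintro _ ⟨z, hz, rfl⟩
    exact nm_conj hx hz
  have h2 : x * b * x⁻¹ ∈ (⁅Q, Q⁆).map (MulAut.conj x).toMonoidHom := ⟨b, hb, rfl⟩
  rw [map_commutator] at h2
  exact commutator_mono h1 h1 h2

theorem InI.get {x : G} (h : InI x) (y : G) : ∃ N, Nil N ∧ x ∈ nm N ∧ y ∈ nm N ∧ ⁅y, x⁆ ∈ N ∧
    ∀ z ∈ closure {x, y}, ⁅z, x⁆ ∈ N := by
  obtain ⟨N, hN, -, h1, h2⟩ := h y
  exact ⟨N, hN, h1 (subset_closure (by simp)), h1 (subset_closure (by simp)),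
    h2 _ (subset_closure (by simp)), h2⟩

def Dc (x t : G) : Subgroup G := closure {z | ∃ i : ℤ, z = x ^ i * t * (x ^ i)⁻¹}

theorem mem_Dc (x t : G) : t ∈ Dc x t := subset_closure ⟨0, by simp⟩
theorem Dc_nm (x t : G) : x ∈ nm (Dc x t) := by
  apply nm_closure
  rintro _ ⟨i, rfl⟩
  exact subset_closure ⟨1 + i, by rw [zpow_add]; group⟩
theorem Dc_le_of_nm {x t : G} {K : Subgroup G} (hx : x ∈ nm K) (ht : t ∈ K) : Dc x t ≤ K := by
  rw [Dc, closure_le]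
  rintro _ ⟨i, rfl⟩
  exact nm_conj ((nm K).zpow_mem hx i) ht
theorem Dc_le {x t : G} {K : Subgroup G} (hx : x ∈ K) (ht : t ∈ K) : Dc x t ≤ K :=
  Dc_le_of_nm (le_nm _ hx) ht

theorem conj_eq_comm (g x : G) : g * x * g⁻¹ = ⁅g, x⁆ * x := by simp [commutatorElement_def]

theorem A2 {x : G} (h : InI x) {r : ℕ} (hr : r.Prime) (hx : pel r x) (g : G) :
    (Nat.card (Dc x (qr r ⁅g, x⁆))).Coprime r ∧ ∃ d ∈ Dc x (qr r ⁅g, x⁆),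
      ⁅d, x⁆ = qr r ⁅g, x⁆ ∧ d * (qp r ⁅g, x⁆ * x) * d⁻¹ = g * x * g⁻¹ ∧
      IsPGroup r (closure {x, qp r ⁅g, x⁆ * x}) := by
  obtain ⟨N, hN, hxN, hgN, htN, -⟩ := h.get g
  set t := ⁅g, x⁆ with ht
  have h1 : qr r t ∈ hN.Opp hr := ⟨qr_mem htN, ppel_qr hr t⟩
  have hD : Dc x (qr r t) ≤ hN.Opp hr := Dc_le_of_nm (hN.nm_Opp hr hxN) h1
  have hDc : (Nat.card (Dc x (qr r t))).Coprime r := coprime_of hr fun z hz => (hD hz).2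
  have h2 : qp r t ∈ hN.Op hr := ⟨qp_mem htN, pel_qp hr t⟩
  have hcom : ∀ z ∈ Dc x (qr r t), Commute (qp r t) z := fun z hz =>
    hN.comm h2.1 (hD hz).1 h2.2 (hD hz).2
  have hR : IsPGroup r (hN.Op hr ⊔ zpowers x : Subgroup G) :=
    sup_isPGroup (hN.Op_isPGroup hr) (isPGroup_zpowers hx) (zpowers_le_nm (hN.nm_Op hr hxN))
  have hxR : x ∈ (hN.Op hr ⊔ zpowers x : Subgroup G) := (le_sup_right : zpowers x ≤ _) (mem_zpowers x)
  have hvR : qp r t * x ∈ (hN.Op hr ⊔ zpowers x : Subgroup G) :=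
    mul_mem ((le_sup_left : hN.Op hr ≤ _) h2) hxR
  have htx : qr r t * (qp r t * x) = g * x * g⁻¹ := by
    rw [← mul_assoc, qr_mul_qp, conj_eq_comm]
  have hv : qp r t * x ∈ nm (Dc x (qr r t)) := by
    refine mul_mem ?_ (Dc_nm _ _)
    apply nm_of
    intro b hb
    rwa [(hcom b hb).eq, mul_inv_cancel_right]
  obtain ⟨d, hd, hdv⟩ := SZ hr (pel_of_mem hR hvR) hDc hv (mem_Dc _ _) (by rw [htx]; exact hx.conj g)
  refine ⟨hDc, d, hd, ?_, hdv.trans htx, hR.to_le ?_⟩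
  · have e1 : qp r t * d = d * qp r t := (hcom d hd).eq
    have e2 : qp r t * qr r t = qr r t * qp r t := (hcom _ (mem_Dc _ _)).eq
    have e3 : qp r t * (d * x * d⁻¹) = qp r t * (qr r t * x) := by
      calc qp r t * (d * x * d⁻¹) = d * (qp r t * x) * d⁻¹ := by
            simp only [← mul_assoc, e1]
        _ = _ := by rw [hdv, ← mul_assoc, ← e2, mul_assoc]
    have e4 := mul_left_cancel e3
    rw [commutatorElement_def, e4]; simp
  · rw [closure_le]
    rintro z (rfl | rfl)
    · exact hxR
    · exact hvR

theorem A1 {x : G} (h : InI x) {r : ℕ} (hr : r.Prime) (hx : pel r x) {g : G} (ht : ppel r ⁅g, x⁆) :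
    (Nat.card (Dc x ⁅g, x⁆)).Coprime r ∧ ∃ d ∈ Dc x ⁅g, x⁆, ⁅d, x⁆ = ⁅g, x⁆ := by
  obtain ⟨h1, d, hd, h2, -⟩ := A2 h hr hx g
  rw [qr_of_ppel hr ht] at *
  exact ⟨h1, d, hd, h2⟩

theorem A1mem {x : G} (h : InI x) {r : ℕ} (hr : r.Prime) (hx : pel r x) {g : G} (ht : ppel r ⁅g, x⁆)
    {H N : Subgroup G} (hxH : x ∈ H) (htH : ⁅g, x⁆ ∈ H) (hN : ∀ z ∈ H, ⁅z, x⁆ ∈ N) : ⁅g, x⁆ ∈ N := by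
  obtain ⟨-, d, hd, h2⟩ := A1 h hr hx ht
  rw [← h2]
  exact hN _ (Dc_le hxH htH hd)

theorem Nil.qp_comm {N : Subgroup G} (hN : Nil N) {q : ℕ} (hq : q.Prime) {x d : G} (hx : x ∈ nm N) (hd : d ∈ N) :
    qp q ⁅d, x⁆ = ⁅qp q d, x⁆ := by
  have h1 : qp q d ∈ hN.Op hq := ⟨qp_mem hd, pel_qp hq d⟩
  have h2 : qr q d ∈ hN.Opp hq := ⟨qr_mem hd, ppel_qr hq d⟩
  have h3 : ⁅qp q d, x⁆ ∈ hN.Op hq := nm_comm (hN.nm_Op hq hx) h1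
  have h4 : ⁅qr q d, x⁆ ∈ hN.Opp hq := nm_comm (hN.nm_Opp hq hx) h2
  have c1 : Commute (qp q d) ⁅qr q d, x⁆ := hN.comm h1.1 h4.1 h1.2 h4.2
  have c2 : Commute ⁅qp q d, x⁆ ⁅qr q d, x⁆ := hN.comm h3.1 h4.1 h3.2 h4.2
  have e : ⁅d, x⁆ = ⁅qp q d, x⁆ * ⁅qr q d, x⁆ := by
    conv_lhs => rw [← qp_mul_qr (q := q) d]
    have : ⁅qp q d * qr q d, x⁆ = (qp q d * ⁅qr q d, x⁆ * (qp q d)⁻¹) * ⁅qp q d, x⁆ := by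
      simp only [commutatorElement_def]; group
    rw [this, c1.eq, mul_inv_cancel_right, c2.eq]
  rw [e, qp_mul c2, qp_of_pel hq h3.2, (ppel_iff hq).1 h4.2, mul_one]

theorem A3 {x : G} (h : InI x) {r : ℕ} (hr : r.Prime) (hx : pel r x) {q : ℕ} (hq : q.Prime) (hne : q ≠ r)
    (g : G) : ∃ d : G, ⁅d, x⁆ = qp q ⁅g, x⁆ := by
  obtain ⟨N, hN, hxN, hgN, htN, -⟩ := h.get g
  obtain ⟨h1, d, hd, h2, -⟩ := A2 h hr hx g
  have hdN : d ∈ N := Dc_le_of_nm hxN (qr_mem htN) hd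
  refine ⟨qp q d, ?_⟩
  rw [← hN.qp_comm hq hxN hdN, h2, qp_qr_ne hr hq hne]

theorem L2 {x : G} (h : InI x) {r : ℕ} (hr : r.Prime) (hx : pel r x) {g : G} (ht : ppel r ⁅g, x⁆)
    {c : G} (hc : Commute c x) : ∃ N, Nil N ∧ x ∈ nm N ∧ c ∈ nm N ∧ ⁅g, x⁆ ∈ N := by
  obtain ⟨-, d, hd, h2⟩ := A1 h hr hx ht
  obtain ⟨N, hN, hxN, hgN, htN, -⟩ := h.get (d * c)
  have e : ⁅d * c, x⁆ = ⁅d, x⁆ := by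
    simp only [commutatorElement_def, mul_inv_rev]
    rw [mul_assoc d c x, hc.eq]; group
  rw [e, h2] at htN
  have hdN : d ∈ N := Dc_le_of_nm hxN htN hd
  refine ⟨N, hN, hxN, ?_, htN⟩
  have := mul_mem (inv_mem (le_nm _ hdN)) hgN
  simpa using this

theorem M {x : G} (h : InI x) {r : ℕ} (hr : r.Prime) (hx : pel r x) {g : G} (ht : pel r ⁅g, x⁆) :
    ∃ R : Subgroup G, IsPGroup r R ∧ x ∈ R ∧ g ∈ nm R := by
  obtain ⟨N, hN, hxN, hgN, htN, -⟩ := h.get g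
  have hR : IsPGroup r (hN.Op hr ⊔ zpowers x : Subgroup G) :=
    sup_isPGroup (hN.Op_isPGroup hr) (isPGroup_zpowers hx) (zpowers_le_nm (hN.nm_Op hr hxN))
  have hxR : x ∈ (hN.Op hr ⊔ zpowers x : Subgroup G) := (le_sup_right : zpowers x ≤ _) (mem_zpowers x)
  have hOR : hN.Op hr ≤ (hN.Op hr ⊔ zpowers x : Subgroup G) := le_sup_left
  refine ⟨_, hR, hxR, ?_⟩
  have key : (hN.Op hr ⊔ zpowers x : Subgroup G) ≤
      (hN.Op hr ⊔ zpowers x : Subgroup G).comap (MulAut.conj g).toMonoidHom := by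
    rw [sup_le_iff, zpowers_le]
    refine ⟨fun z hz => hOR (nm_conj (hN.nm_Op hr hgN) hz), ?_⟩
    show g * x * g⁻¹ ∈ (hN.Op hr ⊔ zpowers x : Subgroup G)
    rw [conj_eq_comm]
    exact mul_mem (hOR ⟨htN, ht⟩) hxR
  exact nm_of fun b hb => key hb

theorem coset_stab {V : Subgroup G} {S : Set G} {b : G} (hS : closure S ≤ nm V)
    (h : ∀ β ∈ S, b⁻¹ * (β * b * β⁻¹) ∈ V) : ∀ β ∈ closure S, b⁻¹ * (β * b * β⁻¹) ∈ V := by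
  intro β hβ
  refine closure_induction (p := fun β _ => b⁻¹ * (β * b * β⁻¹) ∈ V) h (by simp) ?_ ?_ hβ
  · intro β γ hβ hγ h1 h2
    have : b⁻¹ * (β * γ * b * (β * γ)⁻¹) = (b⁻¹ * (β * b * β⁻¹)) * (β * (b⁻¹ * (γ * b * γ⁻¹)) * β⁻¹) := by
      group
    rw [this]
    exact mul_mem h1 (nm_conj (hS hβ) h2)
  · intro β hβ h1
    have : b⁻¹ * (β⁻¹ * b * β⁻¹⁻¹) = β⁻¹ * (b⁻¹ * (β * b * β⁻¹))⁻¹ * β := by group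
    rw [this]
    exact nm_conj' (hS hβ) (inv_mem h1)

theorem CL {x : G} (h : InI x) {r q : ℕ} (hr : r.Prime) (hx : pel r x) (hq : q.Prime) (hne : q ≠ r)
    {k : G} {A Q : Subgroup G} (hA : IsPGroup r A) (hAx : ∀ i : ℤ, k ^ i * x * (k ^ i)⁻¹ ∈ A) (hAQ : A ≤ nm Q)
    (hQ : IsPGroup q Q) (hF : FQ (k * x * k⁻¹) Q) : FQ x Q := by
  intro b hb hbx
  set X : ℤ → G := fun i => k ^ i * x * (k ^ i)⁻¹ with hX
  have hX0 : X 0 = x := by simp [hX]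
  have hQ'c : (Nat.card (⁅Q, Q⁆ : Subgroup G)).Coprime r := coprime_pgroup hq hr hne (hQ.to_le (der_le Q))
  have hQc : (Nat.card Q).Coprime r := coprime_pgroup hq hr hne hQ
  have lift : ∀ n : ℕ, ∀ b' ∈ Q, (∀ i : ℕ, i ≤ n → ⁅b', X (-i)⁆ ∈ ⁅Q, Q⁆) →
      ∃ v ∈ ⁅Q, Q⁆, ∀ i : ℕ, i ≤ n → Commute (X (-i)) (b' * v) := by
    intro n b' hb' hc
    have hBA : closure {z | ∃ i : ℕ, i ≤ n ∧ z = X (-i)} ≤ A := by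
      rw [closure_le]; rintro _ ⟨i, -, rfl⟩; exact hAx _
    have hBV : closure {z | ∃ i : ℕ, i ≤ n ∧ z = X (-i)} ≤ nm ⁅Q, Q⁆ := fun z hz => nm_der (hAQ (hBA hz))
    obtain ⟨v, hv, hv2⟩ := fixed_coset hr (hA.to_le hBA) hQ'c hBV (coset_stab (b := b') hBV (by
      rintro _ ⟨i, hi, rfl⟩
      have h1 := hc i hi
      have : b'⁻¹ * (X (-i) * b' * (X (-i))⁻¹) = b'⁻¹ * (⁅b', X (-i)⁆)⁻¹ * b' := by
        simp only [commutatorElement_def]; group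
      rw [this]
      exact nm_conj' (le_nm _ hb' |> nm_der) (inv_mem h1)))
    exact ⟨v, hv, fun i hi => hv2 _ (subset_closure ⟨i, hi, rfl⟩)⟩
  have main : ∀ n : ℕ, ∃ v ∈ ⁅Q, Q⁆, ∀ i : ℕ, i ≤ n → Commute (X (-i)) (b * v) := by
    intro n
    induction n with
    | zero =>
      apply lift 0 b hb
      intro i hi
      obtain rfl : i = 0 := by omega
      simpa [hX0] using hbx
    | succ n ih =>
      obtain ⟨v, hv, hv2⟩ := ih
      have hb'Q : b * v ∈ Q := mul_mem hb (der_le Q hv)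
      set b' := b * v with hb'
      -- the element g
      have hg : ∀ i : ℕ, i ≤ n + 1 → ((b' * k)⁻¹ ^ i) * x * ((b' * k)⁻¹ ^ i)⁻¹ = X (-i) := by
        intro i
        induction i with
        | zero => intro _; simp [hX0]
        | succ i ih2 =>
          intro hi
          have h1 := ih2 (by omega)
          have h2 := hv2 i (by omega)
          rw [pow_succ']
          have h3 : (b' * k)⁻¹ * (b' * k)⁻¹ ^ i * x * ((b' * k)⁻¹ * (b' * k)⁻¹ ^ i)⁻¹ =
            k⁻¹ * (b'⁻¹ * ((b' * k)⁻¹ ^ i * x * ((b' * k)⁻¹ ^ i)⁻¹) * b') * k := by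
            simp only [mul_inv_rev, inv_inv, mul_assoc]
          rw [h3, h1, mul_assoc b'⁻¹, h2.eq, inv_mul_cancel_left]
          simp only [hX]
          push_cast
          rw [neg_add, zpow_add, zpow_neg_one]
          have : k ^ (-(i:ℤ)) * k⁻¹ = k⁻¹ * k ^ (-(i:ℤ)) := ((Commute.refl k).zpow_left _).inv_right.eq
          rw [this]; group
      obtain ⟨R, hR, hxR, hgR⟩ := M h hr hx (g := (b' * k)⁻¹) (by
        have h1 := hg 1 (by omega)
        rw [pow_one, conj_eq_comm, ← eq_mul_inv_iff_mul_eq] at h1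
        rw [h1]
        exact pel_of_mem hA (mul_mem (hAx _) (inv_mem (by simpa using hAx 0))))
      have hY : X (-((n + 1 : ℕ) : ℤ)) ∈ R := by
        rw [← hg (n+1) le_rfl]
        exact nm_conj ((nm R).pow_mem hgR _) hxR
      have hZ : b' * X 1 * b'⁻¹ ∈ R := by
        have h1 := nm_conj' hgR hxR
        have : (b' * k)⁻¹⁻¹ * x * (b' * k)⁻¹ = b' * X 1 * b'⁻¹ := by simp [hX]; group
        rwa [this] at h1
      set Y := X (-((n + 1 : ℕ) : ℤ)) with hYd
      have hYA : Y ∈ A := hAx _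
      have hX1A : X 1 ∈ A := hAx _
      have hA1 : closure {Y, X 1} ≤ A := by
        rw [closure_le]; rintro z (rfl | rfl)
        · exact hYA
        · exact hX1A
      have hYm : Y ∈ closure {Y, X 1} := subset_closure (by simp)
      have hXm : X 1 ∈ closure {Y, X 1} := subset_closure (by simp)
      obtain ⟨j, hj, hjL⟩ := SC hr (hA.to_le hA1) hQc (hA1.trans hAQ) (L := closure {Y, b' * X 1 * b'⁻¹})
        (hR.to_le (by
          rw [closure_le]; rintro z (rfl | rfl)
          · exact hY
          · exact hZ)) (by
          rw [closure_le]; rintro z (rfl | rfl)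
          · exact (le_sup_right : closure {Y, X 1} ≤ _) hYm
          · rw [conj_eq_comm]
            exact mul_mem ((le_sup_left : Q ≤ _) (nm_comm (hAQ hX1A) hb'Q)) ((le_sup_right : closure {Y, X 1} ≤ _) hXm))
      have hA1p := hA.to_le hA1
      have e1 : j * Y * j⁻¹ = Y := fix_of_SC hr hA1p hQc hYm (hjL _ (subset_closure (by simp)))
        (by rw [← commutatorElement_def]; exact nm_comm (hAQ hYA) hj)
      have e2 : j * (b' * X 1 * b'⁻¹) * j⁻¹ = X 1 := fix_of_SC hr hA1p hQc hXm (hjL _ (subset_closure (by simp)))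
        (by
          have : j * (b' * X 1 * b'⁻¹) * j⁻¹ * (X 1)⁻¹ = ⁅j * b', X 1⁆ := by simp only [commutatorElement_def]; group
          rw [this]; exact nm_comm (hAQ hX1A) (mul_mem hj hb'Q))
      have e3 : j * b' ∈ ⁅Q, Q⁆ := by
        apply hF _ (mul_mem hj hb'Q)
        have : ⁅j * b', k * x * k⁻¹⁆ = j * (b' * X 1 * b'⁻¹) * j⁻¹ * (X 1)⁻¹ := by
          simp only [commutatorElement_def, hX]; group
        rw [this, e2, mul_inv_cancel]; exact one_mem _
      have e4 : ⁅b', Y⁆ ∈ ⁅Q, Q⁆ := by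
        have e5 : j⁻¹ * Y * j = Y := by
          conv_lhs => rw [← e1]
          group
        have : ⁅b', Y⁆ = (j⁻¹ * ⁅j * b', Y⁆ * j) * (j⁻¹ * Y * j * Y⁻¹) := by
          simp only [commutatorElement_def]; group
        rw [this, e5, mul_inv_cancel, mul_one]
        exact nm_conj' (nm_der (le_nm _ hj)) (nm_comm (nm_der (hAQ hYA)) e3)
      obtain ⟨w, hw, hw2⟩ := lift (n+1) b' hb'Q (by
        intro i hi
        rcases Nat.lt_or_ge i (n+1) with h1 | h1
        · have := hv2 i (by omega)
          rw [(commutatorElement_eq_one_iff_commute).2 this.symm]; exact one_mem _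
        · obtain rfl : i = n + 1 := by omega
          exact e4)
      exact ⟨v * w, mul_mem hv hw, fun i hi => by rw [← mul_assoc]; exact hw2 i hi⟩
  have hpos := orderOf_pos k
  obtain ⟨v, hv, hv2⟩ := main (orderOf k - 1)
  have h1 := hv2 _ le_rfl
  have h2 : X (-((orderOf k - 1 : ℕ) : ℤ)) = k * x * k⁻¹ := by
    have : k ^ (-((orderOf k - 1 : ℕ) : ℤ)) = k := by
      rw [Nat.cast_sub hpos, neg_sub, Nat.cast_one, zpow_sub, zpow_one, zpow_natCast, pow_orderOf_eq_one]; simp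
    simp only [hX, this]
  rw [h2] at h1
  have h3 := hF _ (mul_mem hb (der_le Q hv)) (by
    rw [(commutatorElement_eq_one_iff_commute).2 h1.symm]; exact one_mem _)
  exact (mul_mem_cancel_right hv).1 h3

abbrev Cn (x : G) : Subgroup G := centralizer ({x} : Set G)

theorem mem_Cn {x c : G} : c ∈ Cn x ↔ Commute c x := by
  rw [mem_centralizer_singleton_iff]; exact Iff.rfl

def Crit (G : Type u) [Group G] [Finite G] : Prop :=
  (∀ p : ℕ, p.Prime → ∀ N : Subgroup G, N.Normal → IsPGroup p N → N = ⊥) ∧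
  (∀ x : G, InI x → ∀ H : Subgroup G, H ≠ ⊤ → x ∈ H → Gd x H)

theorem Crit.Cn_ne {r : ℕ} (hC : Crit G) (hr : r.Prime) {x : G} (hx : pel r x) (h1 : x ≠ 1) : Cn x ≠ ⊤ := by
  intro h
  have h2 : (zpowers x).Normal := by
    apply normal_of_nm
    intro g
    have hg : g ∈ Cn x := by rw [h]; trivial
    apply nm_of
    rintro _ ⟨i, rfl⟩
    have : g * x ^ i = x ^ i * g := ((mem_Cn.1 hg).zpow_right i).eq
    simp only [this, mul_inv_cancel_right]
    exact ⟨i, rfl⟩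
  have h3 := hC.1 r hr _ h2 (isPGroup_zpowers hx)
  exact h1 (zpowers_eq_bot.1 h3)

def Pk (r : ℕ) (x h : G) : Prop := ∃ R : Subgroup G, IsPGroup r R ∧ (∀ i : ℤ, h ^ i * x * (h ^ i)⁻¹ ∈ R) ∧
  ∀ i : ℤ, Commute x (h ^ i * x * (h ^ i)⁻¹)

theorem Commute.conj' {a b : G} (h : Commute a b) (c : G) : Commute (c * a * c⁻¹) (c * b * c⁻¹) := by
  show c * a * c⁻¹ * (c * b * c⁻¹) = c * b * c⁻¹ * (c * a * c⁻¹)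
  have := h.eq
  calc c * a * c⁻¹ * (c * b * c⁻¹) = c * (a * b) * c⁻¹ := by group
    _ = c * (b * a) * c⁻¹ := by rw [this]
    _ = _ := by group

theorem zpow_conj_succ (h x : G) (i : ℤ) : h ^ (i + 1) * x * (h ^ (i + 1))⁻¹ = h ^ i * (h * x * h⁻¹) * (h ^ i)⁻¹ := by
  rw [zpow_add, zpow_one]; group

theorem zpow_conj_succ' (h x : G) (i : ℤ) : h ^ (i + 1) * x * (h ^ (i + 1))⁻¹ = h * (h ^ i * x * (h ^ i)⁻¹) * h⁻¹ := by
  rw [add_comm, zpow_add, zpow_one]; group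

theorem Pk.symm {r : ℕ} {x h : G} (H : Pk r x h) : Pk r (h * x * h⁻¹) h⁻¹ := by
  obtain ⟨R, hR, h1, h2⟩ := H
  have e : ∀ i : ℤ, h⁻¹ ^ i * (h * x * h⁻¹) * (h⁻¹ ^ i)⁻¹ = h ^ (-i + 1) * x * (h ^ (-i + 1))⁻¹ := by
    intro i
    rw [zpow_conj_succ, inv_zpow, zpow_neg]
  refine ⟨R, hR, fun i => by rw [e]; exact h1 _, fun i => ?_⟩
  rw [e, zpow_conj_succ']
  exact Commute.conj' (h2 _) h

theorem N1 {r : ℕ} (hr : r.Prime) {x g : G} (hne : g * x * g⁻¹ ≠ x)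
    (hp : IsPGroup r (closure {x, g * x * g⁻¹})) :
    ∃ k h : G, h * (k * x * k⁻¹) * h⁻¹ ≠ k * x * k⁻¹ ∧ Pk r (k * x * k⁻¹) h := by
  haveI := Fact.mk hr
  obtain ⟨R, hR⟩ := hp.exists_le_sylow
  have hxR : x ∈ (R : Subgroup G) := hR (subset_closure (by simp))
  have hzR : g * x * g⁻¹ ∈ (R : Subgroup G) := hR (subset_closure (by simp))
  by_cases hc : ∀ k : G, k * x * k⁻¹ ∈ (R : Subgroup G) → ∀ y ∈ (R : Subgroup G), Commute y (k * x * k⁻¹)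
  · have hcen : ∀ k : G, k * x * k⁻¹ ∈ (R : Subgroup G) → k * x * k⁻¹ ∈ centralizer ((R : Subgroup G) : Set G) := by
      intro k hk
      rw [mem_centralizer_iff]
      intro y hy
      exact (hc k hk y hy).eq
    obtain ⟨n, hn, hn2⟩ := Sylow.conj_eq_normalizer_conj_of_mem_centralizer R x g⁻¹
      (by simpa using hcen 1 (by simpa using hxR)) (by simpa using hcen g hzR)
    have hn3 : n⁻¹ * x * n⁻¹⁻¹ ≠ x := by
      rw [inv_inv, ← hn2, inv_inv]; exact hne
    have hn4 : n⁻¹ ∈ nm (R : Subgroup G) := inv_mem hn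
    refine ⟨1, n⁻¹, by simpa using hn3, R, R.2, ?_, ?_⟩
    · intro i
      simpa using nm_conj ((nm (R : Subgroup G)).zpow_mem hn4 i) hxR
    · intro i
      have h1 := nm_conj ((nm (R : Subgroup G)).zpow_mem hn4 i) hxR
      simpa using hc _ h1 x hxR
  · push Not at hc
    obtain ⟨k, hk, y, hy, hyk⟩ := hc
    refine ⟨k, ?_⟩
    set e := k * x * k⁻¹ with he
    obtain ⟨h, hhR, hh1, hh2⟩ := exists_nm_gt hr R.2 (inf_le_left : (R : Subgroup G) ⊓ Cn e ≤ R)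
      (fun h => hyk (mem_Cn.1 (h hy).2))
    have heA : e ∈ (R : Subgroup G) ⊓ Cn e := ⟨hk, mem_Cn.2 (Commute.refl e)⟩
    have hA : ∀ i : ℤ, h ^ i * e * (h ^ i)⁻¹ ∈ (R : Subgroup G) ⊓ Cn e := fun i =>
      nm_conj ((nm ((R : Subgroup G) ⊓ Cn e)).zpow_mem hh2 i) heA
    refine ⟨h, ?_, R, R.2, fun i => (hA i).1, fun i => (mem_Cn.1 (hA i).2).symm⟩
    intro hc
    apply hh1
    refine ⟨hhR, mem_Cn.2 ?_⟩
    exact mul_inv_eq_iff_eq_mul.1 hc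

theorem conj_comm_eq (c g x : G) : c * ⁅g, x⁆ * c⁻¹ = ⁅c * g * c⁻¹, c * x * c⁻¹⁆ := by
  simp only [commutatorElement_def]; group

theorem conj_comm_of_commute {c g x : G} (h : Commute c x) : c * ⁅g, x⁆ * c⁻¹ = ⁅c * g * c⁻¹, x⁆ := by
  rw [conj_comm_eq, h.eq, mul_inv_cancel_right]

theorem comm_inv_mul {c g x : G} (h : Commute c x) : ⁅g * c, x⁆ = ⁅g, x⁆ := by
  have : ⁅g * c, x⁆ = g * (c * x) * c⁻¹ * g⁻¹ * x⁻¹ := by simp only [commutatorElement_def]; group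
  rw [this, h.eq]; simp only [commutatorElement_def]; group

theorem Step1 (hC : Crit G) {x h : G} (hI : InI x) {r q : ℕ} (hr : r.Prime) (hx : pel r x) (hx1 : x ≠ 1)
    (hq : q.Prime) (hne : q ≠ r) (hP : Pk r x h) {g : G} (ht : pel q ⁅g, h * x * h⁻¹⁆)
    (htc : Commute ⁅g, h * x * h⁻¹⁆ x) : ⁅g, h * x * h⁻¹⁆ = 1 := by
  obtain ⟨R, hR, hR1, hR2⟩ := hP
  set y := h * x * h⁻¹ with hy
  have hyI : InI y := hI.conj h
  have hyp : pel r y := hx.conj h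
  have hxy : Commute x y := by simpa [hy] using hR2 1
  have hyH : y ∈ Cn x := mem_Cn.2 hxy.symm
  obtain ⟨N, hN, hNH, hHN, hNc⟩ := hC.2 y hyI (Cn x) (hC.Cn_ne hr hx hx1) hyH
  let S : Set G := {t | ∃ g : G, t = ⁅g, y⁆ ∧ pel q t ∧ t ∈ Cn x}
  have hSN : closure S ≤ hN.Op hq := by
    rw [closure_le]
    rintro _ ⟨g, rfl, hgt, hgc⟩
    exact ⟨A1mem hyI hr hyp (hgt.ppel_of_ne hq hr hne) hyH hgc hNc, hgt⟩
  have hQ : IsPGroup q (closure S) := (hN.Op_isPGroup hq).to_le hSN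
  have hSn : ∀ c, Commute c x → Commute c y → c ∈ nm (closure S) := by
    intro c hcx hcy
    apply nm_closure
    rintro _ ⟨g, rfl, hgt, hgc⟩
    refine subset_closure ⟨c * g * c⁻¹, conj_comm_of_commute hcy, hgt.conj c, ?_⟩
    exact mul_mem (mul_mem (mem_Cn.2 hcx) hgc) (inv_mem (mem_Cn.2 hcx))
  have hyn : y ∈ nm (closure S) := hSn y hxy.symm (Commute.refl y)
  have hF : FQ y (closure S) := by
    apply alpha hyn
    rw [closure_le]
    rintro _ ⟨g, rfl, hgt, hgc⟩
    obtain ⟨-, d, hd, h2⟩ := A1 hyI hr hyp (hgt.ppel_of_ne hq hr hne)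
    exact subset_closure ⟨d, Dc_le_of_nm hyn (subset_closure ⟨g, rfl, hgt, hgc⟩) hd, h2.symm⟩
  let A := closure {z | ∃ i : ℤ, z = h ^ i * x * (h ^ i)⁻¹}
  have hAR : A ≤ R := by
    rw [closure_le]; rintro _ ⟨i, rfl⟩; exact hR1 i
  have hAn : A ≤ nm (closure S) := by
    rw [closure_le]; rintro _ ⟨i, rfl⟩
    refine hSn _ (hR2 i).symm ?_
    have := Commute.conj' (hR2 (i - 1)) h
    rw [← zpow_conj_succ'] at this
    simpa using this.symm
  have hF0 := CL hI hr hx hq hne (hR.to_le hAR) (fun i => subset_closure ⟨i, rfl⟩) hAn hQ hF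
  have hbot := eq_bot_of_le_der hq hQ (fun b hb => hF0 b hb (by
    have hbc : b ∈ Cn x := hNH (hSN hb).1
    rw [commutatorElement_eq_one_iff_commute.2 (mem_Cn.1 hbc)]; exact one_mem _))
  have : ⁅g, y⁆ ∈ closure S := subset_closure ⟨g, rfl, ht, mem_Cn.2 htc⟩
  rw [hbot] at this
  exact mem_bot.1 this

theorem mem_of_pel_sup {q r : ℕ} (hq : q.Prime) (hr : r.Prime) (hne : q ≠ r) {W A : Subgroup G} (hW : IsPGroup q W)
    (hA : IsPGroup r A) (hAW : A ≤ nm W) {g : G} (hg : g ∈ W ⊔ A) (hgq : pel q g) : g ∈ W := by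
  obtain ⟨w, hw, a, ha, e⟩ := mem_sup_nm hAW hg
  have hgn : g ∈ nm W := (sup_le (le_nm W) hAW) hg
  have h1 : IsPGroup q (W ⊔ zpowers g : Subgroup G) := sup_isPGroup hW (isPGroup_zpowers hgq) (zpowers_le_nm hgn)
  have h2 : a ∈ (W ⊔ zpowers g : Subgroup G) := by
    have : a = w⁻¹ * g := by rw [e]; group
    rw [this]
    exact mul_mem (inv_mem ((le_sup_left : W ≤ _) hw)) ((le_sup_right : zpowers g ≤ _) (mem_zpowers g))
  have h3 := pel_pel hq hr hne (pel_of_mem h1 h2) (pel_of_mem hA ha)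
  rw [e, h3, mul_one]; exact hw

theorem FQ_help {r q : ℕ} (hr : r.Prime) (hq : q.Prime) (hne : q ≠ r) {x y : G} (hx : pel r x)
    (hxy : Commute x y) {W : Subgroup G} (hW : IsPGroup q W) (hxW : x ∈ nm W) (hyW : y ∈ nm W)
    (h1 : ∀ g : G, pel q ⁅g, y⁆ → Commute ⁅g, y⁆ x → ⁅g, y⁆ = 1)
    (h2 : ∀ b, Commute b x → Commute b y → b ∈ W → b ∈ ⁅W, W⁆) : FQ x W := by
  intro b hb hbx
  have hxV : zpowers x ≤ nm ⁅W, W⁆ := zpowers_le_nm (nm_der hxW)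
  obtain ⟨v, hv, hv2⟩ := fixed_coset hr (isPGroup_zpowers hx) (coprime_pgroup hq hr hne (hW.to_le (der_le W)))
    hxV (b := b) (by
      rw [zpowers_eq_closure] at hxV ⊢
      apply coset_stab hxV
      rintro z rfl
      have : b⁻¹ * (z * b * z⁻¹) = b⁻¹ * (⁅b, z⁆)⁻¹ * b := by
        simp only [commutatorElement_def]; group
      rw [this]
      exact nm_conj' (nm_der (le_nm _ hb)) (inv_mem hbx))
  have hbv : b * v ∈ W := mul_mem hb (der_le W hv)
  have c1 : Commute (b * v) x := (hv2 x (mem_zpowers x)).symm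
  have c2 := h1 (b * v) (pel_of_mem hW (nm_comm hyW hbv)) (by
    rw [commutatorElement_def]
    exact ((c1.mul_left hxy.symm).mul_left c1.inv_left).mul_left hxy.symm.inv_left)
  exact (mul_mem_cancel_right hv).1 (h2 _ c1 (commutatorElement_eq_one_iff_commute.1 c2) hbv)

theorem Step2 (hC : Crit G) {x h : G} (hI : InI x) {r q : ℕ} (hr : r.Prime) (hx : pel r x) (hx1 : x ≠ 1)
    (hq : q.Prime) (hne : q ≠ r) (hP : Pk r x h) {g : G} (ht : pel q ⁅g, x⁆) : Commute ⁅h, x⁆ ⁅g, x⁆ := by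
  by_contra hcon
  have hP' := hP
  obtain ⟨R, hR, hR1, hR2⟩ := hP
  set y := h * x * h⁻¹ with hy
  have hyI : InI y := hI.conj h
  have hyp : pel r y := hx.conj h
  have hxy : Commute x y := by simpa [hy] using hR2 1
  have hy1 : y ≠ 1 := by
    intro h1; apply hx1
    have := conj_eq_one_iff.1 h1
    exact this
  have S1 : ∀ g : G, pel q ⁅g, y⁆ → Commute ⁅g, y⁆ x → ⁅g, y⁆ = 1 := fun g h1 h2 =>
    Step1 hC hI hr hx hx1 hq hne hP' h1 h2
  have S2 : ∀ g : G, pel q ⁅g, x⁆ → Commute ⁅g, x⁆ y → ⁅g, x⁆ = 1 := fun g h1 h2 => by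
    have e : h⁻¹ * y * h⁻¹⁻¹ = x := by rw [hy]; group
    have := Step1 hC (x := y) (h := h⁻¹) hyI hr hyp hy1 hq hne hP'.symm (g := g) (by rwa [e]) (by rwa [e])
    rwa [e] at this
  set a := ⁅h, x⁆ with ha
  have hay : a = y * x⁻¹ := rfl
  have hax : Commute a x := by rw [hay]; exact hxy.symm.mul_left (Commute.refl x).inv_left
  have haY : Commute a y := by rw [hay]; exact (Commute.refl y).mul_left hxy.inv_left
  have hyR : y ∈ R := by simpa [hy] using hR1 1
  have hxR : x ∈ R := by simpa using hR1 0
  have hap : pel r a := by rw [hay]; exact pel_of_mem hR (mul_mem hyR (inv_mem hxR))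
  obtain ⟨N, hN, hxN, hyN, htN⟩ := L2 hI hr hx (ht.ppel_of_ne hq hr hne) hxy.symm
  let 𝒲 : Set (Subgroup G) := {W | W ≤ hN.Op hq ∧ x ∈ nm W ∧ y ∈ nm W ∧ ∃ w ∈ W, ¬ Commute a w}
  have hne𝒲 : 𝒲.Nonempty := ⟨hN.Op hq, le_rfl, hN.nm_Op hq hxN, hN.nm_Op hq hyN, _, ⟨htN, ht⟩, hcon⟩
  obtain ⟨W, ⟨hWJ, hxW, hyW, w0, hw0, hw0c⟩, hWmin⟩ := (Set.toFinite 𝒲).exists_minimal hne𝒲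
  have hWp : IsPGroup q W := (hN.Op_isPGroup hq).to_le hWJ
  have haW : a ∈ nm W := by rw [hay]; exact mul_mem hyW (inv_mem hxW)
  let K := closure {t | ∃ b ∈ W, t = ⁅b, a⁆}
  have hKW : K ≤ W := by
    rw [closure_le]; rintro _ ⟨b, hb, rfl⟩; exact nm_comm haW hb
  have hKn : ∀ c, Commute c a → c ∈ nm W → c ∈ nm K := by
    intro c hc hcW
    apply nm_closure
    rintro _ ⟨b, hb, rfl⟩
    exact subset_closure ⟨_, nm_conj hcW hb, conj_comm_of_commute hc⟩
  have hKmem : K ∈ 𝒲 := by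
    refine ⟨hKW.trans hWJ, hKn x hax.symm hxW, hKn y haY.symm hyW, ?_⟩
    by_contra hc
    push Not at hc
    apply hw0c
    have hk : Commute a ⁅w0, a⁆ := hc _ (subset_closure ⟨w0, hw0, rfl⟩)
    have hkq : pel q ⁅w0, a⁆ := pel_of_mem hWp (nm_comm haW hw0)
    have h1 : qp q (⁅w0, a⁆ * a) = 1 := by
      rw [← conj_eq_comm]
      exact qp_pel_ne hr hq hne.symm (hap.conj w0)
    rw [qp_mul hk.symm, qp_of_pel hq hkq, qp_pel_ne hr hq hne.symm hap, mul_one] at h1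
    exact (commutatorElement_eq_one_iff_commute.1 h1).symm
  have hWK : W ≤ K := hWmin hKmem hKW
  have Fa : FQ a W := alpha haW hWK
  have hlast : ∀ b, Commute b x → Commute b y → b ∈ W → b ∈ ⁅W, W⁆ := by
    intro b hbx hby hb
    apply Fa b hb
    have : Commute b a := by rw [hay]; exact hby.mul_right hbx.inv_right
    rw [commutatorElement_eq_one_iff_commute.2 this]; exact one_mem _
  have Fx : FQ x W := FQ_help hr hq hne hx hxy hWp hxW hyW S1 hlast
  have Fy : FQ y W := FQ_help hr hq hne hyp hxy.symm hWp hyW hxW S2 (fun b h1 h2 => hlast b h2 h1)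
  have hbex : ∃ b ∈ W, b ∉ ⁅W, W⁆ := by
    by_contra hc
    push Not at hc
    have := eq_bot_of_le_der hq hWp hc
    rw [this, mem_bot] at hw0
    exact hw0c (by rw [hw0]; exact Commute.one_right a)
  obtain ⟨b, hb, hbn⟩ := hbex
  apply hbn
  apply Fy b hb
  have hvW : ⁅b, y⁆ ∈ W := nm_comm hyW hb
  set v := ⁅b, y⁆ with hv
  set u := ⁅b * h, x⁆ with hu
  have huv : u = v * a := by
    rw [hu, hv, hay, hy]; simp only [commutatorElement_def]; group
  apply Fx v hvW
  have huq : qp q u ∈ W := by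
    refine mem_of_pel_sup hq hr hne hWp (isPGroup_zpowers hap) (zpowers_le_nm haW) (qp_mem ?_) (pel_qp hq u)
    rw [huv]
    exact mul_mem ((le_sup_left : W ≤ _) hvW) ((le_sup_right : zpowers a ≤ _) (mem_zpowers a))
  have huq' : qp q u ∈ ⁅W, W⁆ := by
    apply Fa _ huq
    have hc : ⁅qp q u, v * a⁆ = 1 := by
      rw [← huv]; exact commutatorElement_eq_one_iff_commute.2 (qp_comm (Commute.refl u))
    have e : ⁅qp q u, a⁆ = v⁻¹ * ((⁅qp q u, v⁆)⁻¹ * ⁅qp q u, v * a⁆) * v := by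
      simp only [commutatorElement_def]; group
    rw [e, hc, mul_one]
    exact nm_conj' (nm_der (le_nm _ hvW)) (inv_mem (commutator_mem_commutator huq hvW))
  have e1 : ⁅v, x⁆ = ⁅u, x⁆ := by rw [huv, comm_inv_mul hax]
  obtain ⟨N', hN', hxN', -, huN', -⟩ := hI.get (b * h)
  have e2 := hN'.qp_comm hq hxN' huN'
  rw [← hu, ← e1, qp_of_pel hq (pel_of_mem hWp (nm_comm hxW hvW))] at e2
  rw [e2]
  exact nm_comm (nm_der hxW) huq'

def Kq (q : ℕ) (x : G) : Subgroup G := closure {t | ∃ g : G, t = ⁅g, x⁆ ∧ pel q t}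

theorem Kq_nm (q : ℕ) {x c : G} (h : Commute c x) : c ∈ nm (Kq q x) := by
  apply nm_closure
  rintro _ ⟨g, rfl, hg⟩
  exact subset_closure ⟨_, conj_comm_of_commute h, hg.conj c⟩

theorem Kq_core {x : G} (hI : InI x) {r q : ℕ} (hr : r.Prime) (hx : pel r x) (hq : q.Prime) (hne : q ≠ r)
    (hK : IsPGroup q (Kq q x)) {A : Subgroup G} (hA : IsPGroup r A) (hAK : A ≤ nm (Kq q x)) {n : G}
    (hn : ∀ i : ℤ, n ^ i * x * (n ^ i)⁻¹ ∈ A) : n ∈ nm (Kq q x) := by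
  have hxK : x ∈ nm (Kq q x) := Kq_nm q (Commute.refl x)
  have hF : FQ x (Kq q x) := by
    apply alpha hxK
    conv_lhs => rw [Kq]
    rw [closure_le]
    rintro _ ⟨g, rfl, hgt⟩
    obtain ⟨-, d, hd, h2⟩ := A1 hI hr hx (hgt.ppel_of_ne hq hr hne)
    exact subset_closure ⟨d, Dc_le_of_nm hxK (subset_closure ⟨g, rfl, hgt⟩) hd, h2.symm⟩
  set y := n⁻¹ * x * n⁻¹⁻¹ with hy
  have e : n * y * n⁻¹ = x := by rw [hy]; group
  have hyA : ∀ i : ℤ, n ^ i * y * (n ^ i)⁻¹ ∈ A := by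
    intro i
    have := hn (i - 1)
    have e2 : n ^ i * y * (n ^ i)⁻¹ = n ^ (i - 1) * x * (n ^ (i - 1))⁻¹ := by
      rw [hy, zpow_sub, zpow_one]; group
    rwa [e2]
  have hFy : FQ y (Kq q x) := CL (hI.conj n⁻¹) hr (hx.conj n⁻¹) hq hne hA hyA hAK hK (by rw [e]; exact hF)
  have hyK : y ∈ nm (Kq q x) := hAK (by simpa using hyA 0)
  have hb := beta hq hK hyK hFy
  have hle : closure {t | ∃ b ∈ Kq q x, t = ⁅b, y⁆} ≤ (Kq q x).comap (MulAut.conj n).toMonoidHom := by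
    rw [closure_le]
    rintro _ ⟨b, hb, rfl⟩
    show n * ⁅b, y⁆ * n⁻¹ ∈ Kq q x
    rw [conj_comm_eq, e]
    refine subset_closure ⟨_, rfl, ?_⟩
    have := (pel_of_mem hK (nm_comm hyK hb)).conj n
    rwa [conj_comm_eq, e] at this
  exact nm_of fun z hz => hle (hb hz)

theorem nonisolated (hC : Crit G) {x h : G} (hI : InI x) {r : ℕ} (hr : r.Prime) (hx : pel r x) (hx1 : x ≠ 1)
    (hne : h * x * h⁻¹ ≠ x) (hP : Pk r x h) : False := by
  have ha1 : ⁅h, x⁆ ≠ 1 := by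
    intro h1; apply hne; rw [conj_eq_comm, h1, one_mul]
  have hax : Commute ⁅h, x⁆ x := by
    obtain ⟨R, hR, hR1, hR2⟩ := hP
    have h1 : Commute x (h * x * h⁻¹) := by simpa using hR2 1
    exact h1.symm.mul_left (Commute.refl x).inv_left
  have hap : pel r ⁅h, x⁆ := by
    obtain ⟨R, hR, hR1, hR2⟩ := hP
    exact pel_of_mem hR (mul_mem (by simpa using hR1 1) (inv_mem (by simpa using hR1 0)))
  have hxa : x ∈ Cn ⁅h, x⁆ := mem_Cn.2 hax.symm
  obtain ⟨N, hN, -, -, hNc⟩ := hC.2 x hI (Cn ⁅h, x⁆) (hC.Cn_ne hr hap ha1) hxa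
  have hKN : ∀ q : ℕ, ∀ hq : q.Prime, q ≠ r → Kq q x ≤ hN.Op hq := by
    intro q hq hqr
    rw [Kq, closure_le]
    rintro _ ⟨g, rfl, hg⟩
    exact ⟨A1mem hI hr hx (hg.ppel_of_ne hq hr hqr) hxa
      (mem_Cn.2 (Step2 hC hI hr hx hx1 hq hqr hP hg).symm) hNc, hg⟩
  have hKp : ∀ q : ℕ, q.Prime → q ≠ r → IsPGroup q (Kq q x) := fun q hq hqr =>
    (hN.Op_isPGroup hq).to_le (hKN q hq hqr)
  have N3 : ∀ q : ℕ, q.Prime → q ≠ r → ∀ R : Subgroup G, IsPGroup r R → x ∈ R → R ≤ nm (Kq q x) := by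
    intro q hq hqr R hR hxR
    by_contra hc
    obtain ⟨n, hnR, hn1, hn2⟩ := exists_nm_gt hr hR (inf_le_left : R ⊓ nm (Kq q x) ≤ R)
      (fun h => hc (le_inf_iff.1 h).2)
    apply hn1
    refine ⟨hnR, Kq_core hI hr hx hq hqr (hKp q hq hqr) (hR.to_le inf_le_left) (inf_le_right : R ⊓ nm (Kq q x) ≤ _) ?_⟩
    intro i
    exact nm_conj (zpow_mem hn2 i) ⟨hxR, Kq_nm q (Commute.refl x)⟩
  have N3' : ∀ q : ℕ, q.Prime → q ≠ r → ∀ g : G, pel r ⁅g, x⁆ → g ∈ nm (Kq q x) := by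
    intro q hq hqr g hg
    obtain ⟨R, hR, hxR, hgR⟩ := M hI hr hx hg
    exact Kq_core hI hr hx hq hqr (hKp q hq hqr) hR (N3 q hq hqr R hR hxR) fun i => nm_conj (zpow_mem hgR i) hxR
  have hKm : ∀ l : ℕ, l.Prime → l ≠ r → ∀ g : G, qp l ⁅g, x⁆ ∈ Kq l x := by
    intro l hl hlr g
    obtain ⟨d, hd⟩ := A3 hI hr hx hl hlr g
    exact subset_closure ⟨d, hd.symm, pel_qp hl _⟩
  have N4 : ∀ q : ℕ, q.Prime → q ≠ r → Kq q x = ⊥ := by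
    intro q hq hqr
    refine hC.1 q hq _ (normal_of_nm fun y => ?_) (hKp q hq hqr)
    obtain ⟨-, d, hd, h2, h3, -⟩ := A2 hI hr hx y
    have hdK : d ∈ nm (Kq q x) := by
      refine Dc_le (Kq_nm q (Commute.refl x)) ?_ hd
      apply mem_of_qp
      intro l hl
      by_cases hlr : l = r
      · subst hlr
        rw [(ppel_iff hl).1 (ppel_qr hl _)]; exact one_mem _
      · rw [qp_qr_ne hr hl hlr]
        have h4 := hKm l hl hlr y
        by_cases hlq : l = q
        · subst hlq; exact le_nm _ h4
        · apply nm_of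
          intro b hb
          have h5 := hKN l hl hlr h4
          have h6 := hKN q hq hqr hb
          have := hN.comm h5.1 h6.1 h5.2 (h6.2.ppel_of_ne hq hl (Ne.symm hlq))
          rw [this.eq, mul_inv_cancel_right]; exact hb
    have hg : d⁻¹ * y ∈ nm (Kq q x) := by
      apply N3' q hq hqr
      have : ⁅d⁻¹ * y, x⁆ = qp r ⁅y, x⁆ := by
        have e : ⁅d⁻¹ * y, x⁆ = d⁻¹ * (y * x * y⁻¹) * d * x⁻¹ := by simp only [commutatorElement_def]; group
        rw [e, ← h3]; group
      rw [this]; exact pel_qp hr _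
    have := mul_mem hdK hg
    simpa using this
  have hall : ∀ g : G, pel r ⁅g, x⁆ := by
    intro g
    have h1 : qr r ⁅g, x⁆ ∈ (⊥ : Subgroup G) := by
      apply mem_of_qp
      intro l hl
      by_cases hlr : l = r
      · subst hlr
        rw [(ppel_iff hl).1 (ppel_qr hl _)]; exact one_mem _
      · rw [qp_qr_ne hr hl hlr, ← N4 l hl hlr]
        exact hKm l hl hlr g
    have h2 := qp_mul_qr (q := r) ⁅g, x⁆
    rw [mem_bot.1 h1, mul_one] at h2
    rw [← h2]; exact pel_qp hr _
  obtain ⟨O, hOn, hOp, hxO⟩ := BS hr x (by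
    intro g
    obtain ⟨R, hR, hxR, hgR⟩ := M hI hr hx (hall g)
    refine hR.to_le ?_
    rw [closure_le]; rintro z (rfl | rfl)
    · exact hxR
    · exact nm_conj hgR hxR)
  rw [hC.1 r hr O hOn hOp, mem_bot] at hxO
  exact hx1 hxO

structure Iso (r : ℕ) (x : G) : Prop where
  hC : Crit G
  hI : InI x
  hr : r.Prime
  hx : pel r x
  hx1 : x ≠ 1
  hT : ∀ g : G, ppel r ⁅g, x⁆

theorem Iso.of (hC : Crit G) {x : G} (hI : InI x) {r : ℕ} (hr : r.Prime) (hx : pel r x) (hx1 : x ≠ 1) :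
    Iso r x := by
  refine ⟨hC, hI, hr, hx, hx1, fun g => ?_⟩
  obtain ⟨-, d, hd, h2, h3, h4⟩ := A2 hI hr hx g
  have h5 : qp r ⁅g, x⁆ * x = (d⁻¹ * g) * x * (d⁻¹ * g)⁻¹ := by
    have : (d⁻¹ * g) * x * (d⁻¹ * g)⁻¹ = d⁻¹ * (g * x * g⁻¹) * d := by group
    rw [this, ← h3]; group
  by_cases hv : (d⁻¹ * g) * x * (d⁻¹ * g)⁻¹ = x
  · rw [ppel_iff hr]
    rw [hv] at h5
    simpa using h5
  · exfalso
    rw [h5] at h4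
    obtain ⟨k, h, hne, hP⟩ := N1 hr hv h4
    exact nonisolated hC (hI.conj k) hr (hx.conj k) (fun h => hx1 (conj_eq_one_iff.1 h)) hne hP

theorem Crit.nm_ne (hC : Crit G) {q : ℕ} (hq : q.Prime) {P : Subgroup G} (hP : IsPGroup q P) (h : P ≠ ⊥) : nm P ≠ ⊤ := by
  intro h1
  exact h (hC.1 q hq P (normal_of_nm fun g => by rw [h1]; trivial) hP)

theorem Dc_pgroup {x : G} (hI : InI x) {q : ℕ} (hq : q.Prime) {g : G} (h : pel q ⁅g, x⁆) : IsPGroup q (Dc x ⁅g, x⁆) := by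
  obtain ⟨N, hN, hxN, hgN, htN, -⟩ := hI.get g
  exact (hN.Op_isPGroup hq).to_le (Dc_le_of_nm (hN.nm_Op hq hxN) ⟨htN, h⟩)

theorem comm_eq_iff {d g x : G} (h : ⁅d, x⁆ = ⁅g, x⁆) : Commute (d⁻¹ * g) x := by
  have h1 : d * x * d⁻¹ = g * x * g⁻¹ := by rw [conj_eq_comm, h, conj_eq_comm]
  have h2 : (d⁻¹ * g) * x * (d⁻¹ * g)⁻¹ = x := by
    have : (d⁻¹ * g) * x * (d⁻¹ * g)⁻¹ = d⁻¹ * (g * x * g⁻¹) * d := by group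
    rw [this, ← h1]; group
  exact mul_inv_eq_iff_eq_mul.1 h2

theorem qprime_mul {q : ℕ} (hq : q.Prime) {V : Subgroup G} (hV : (Nat.card V).Coprime q) {v a : G} (hv : v ∈ V)
    (ha : a ∈ nm V) (haq : ppel q a) (h : pel q (v * a)) : v * a = 1 := by
  have h1 : ∀ n : ℕ, (v * a) ^ n * (a ^ n)⁻¹ ∈ V := by
    intro n
    induction n with
    | zero => simp
    | succ n ih =>
      have : (v * a) ^ (n + 1) * (a ^ (n + 1))⁻¹ = v * (a * ((v * a) ^ n * (a ^ n)⁻¹) * a⁻¹) := by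
        rw [pow_succ', pow_succ']; group
      rw [this]
      exact mul_mem hv (nm_conj ha ih)
  have h2 := h1 (orderOf a)
  rw [pow_orderOf_eq_one, inv_one, mul_one] at h2
  have h3 := pel_ppel hq (h.pow _) (ppel_of_mem hV h2)
  exact pel_ppel hq h (Nat.Coprime.of_dvd_left (orderOf_dvd_of_pow_eq_one h3) haq)

def XS (q : ℕ) (x : G) (P : Subgroup G) : Prop :=
  IsPGroup q P ∧ x ∈ nm P ∧ ∀ Q : Subgroup G, IsPGroup q Q → P ≤ Q → Q ≤ P

namespace Iso
variable {r : ℕ} {x : G}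

theorem C_ne (I : Iso r x) : Cn x ≠ ⊤ := I.hC.Cn_ne I.hr I.hx I.hx1

theorem dex (I : Iso r x) (g : G) : ∃ d ∈ Dc x ⁅g, x⁆, ⁅d, x⁆ = ⁅g, x⁆ := (A1 I.hI I.hr I.hx (I.hT g)).2

theorem dex_mem (I : Iso r x) {K : Subgroup G} {g : G} (hx : x ∈ nm K) (ht : ⁅g, x⁆ ∈ K) : ∃ d ∈ K, ⁅d, x⁆ = ⁅g, x⁆ := by
  obtain ⟨d, hd, h⟩ := I.dex g
  exact ⟨d, Dc_le_of_nm hx ht hd, h⟩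

theorem ne_of_pel (I : Iso r x) {q : ℕ} (hq : q.Prime) {g : G} (h : pel q ⁅g, x⁆) (h1 : ⁅g, x⁆ ≠ 1) : q ≠ r := by
  rintro rfl
  exact h1 (pel_ppel hq h (I.hT g))

theorem S1 (I : Iso r x) {q : ℕ} (hq : q.Prime) {P0 : Subgroup G} (h0 : IsPGroup q P0) (hx0 : x ∈ nm P0)
    (hb : P0 ≠ ⊥) : ∃ P, P0 ≤ P ∧ XS q x P := by
  haveI := Fact.mk hq
  let 𝒲 : Set (Subgroup G) := {W | P0 ≤ W ∧ x ∈ nm W ∧ IsPGroup q W}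
  obtain ⟨P, ⟨hP0, hxP, hP⟩, hmax⟩ := (Set.toFinite 𝒲).exists_maximal ⟨P0, le_rfl, hx0, h0⟩
  have hmax' : ∀ A : Subgroup G, IsPGroup q A → x ∈ nm A → A ≤ nm P → A ≤ P := by
    intro A hA hxA hAP
    have h1 : (P ⊔ A : Subgroup G) ∈ 𝒲 := by
      refine ⟨hP0.trans le_sup_left, ?_, sup_isPGroup hP hA hAP⟩
      apply nm_of
      intro b hb
      obtain ⟨p, hp, a, ha, rfl⟩ := mem_sup_nm hAP hb
      have : x * (p * a) * x⁻¹ = (x * p * x⁻¹) * (x * a * x⁻¹) := by group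
      rw [this]
      exact mul_mem ((le_sup_left : P ≤ _) (nm_conj hxP hp)) ((le_sup_right : A ≤ _) (nm_conj hxA ha))
    exact le_sup_right.trans (hmax h1 le_sup_left)
  refine ⟨P, hP0, hP, hxP, fun S hS hPS => ?_⟩
  by_contra hc
  obtain ⟨s, hsS, hsP, hs⟩ := exists_nm_gt hq hS hPS hc
  have hPb : P ≠ ⊥ := fun h => hb (le_bot_iff.1 (h ▸ hP0))
  obtain ⟨N, hN, hNH, hHN, hNc⟩ := I.hC.2 x I.hI (nm P) (I.hC.nm_ne hq hP hPb) hxP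
  have hxN := hHN hxP
  obtain ⟨k, hk, hks⟩ := I.dex_mem hxN (hNc s hs)
  have hcx := comm_eq_iff hks
  set c := k⁻¹ * s with hc
  have hcP : c ∈ nm P := mul_mem (inv_mem (hNH hk)) hs
  have hkq : qp q k ∈ P := hmax' _ (hN.Op_isPGroup hq) (hN.nm_Op hq hxN) ((hN.Op_le hq).trans hNH)
    ⟨qp_mem hk, pel_qp hq k⟩
  have hcq : qp q c ∈ P := by
    refine hmax' (zpowers (qp q c)) (isPGroup_zpowers (pel_qp hq c)) ?_ ?_ (mem_zpowers _)
    · apply nm_of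
      rintro _ ⟨i, rfl⟩
      have : x * qp q c ^ i = qp q c ^ i * x := ((qp_comm (q := q) hcx).symm.zpow_right i).eq
      simp only [this, mul_inv_cancel_right]
      exact ⟨i, rfl⟩
    · rw [zpowers_le]; exact qp_mem hcP
  have hs1 : s = qp q k * (qr q k * qr q c) * qp q c := by
    have : s = k * c := by rw [hc]; group
    rw [this]
    conv_lhs => rw [← qp_mul_qr (q := q) k, ← qr_mul_qp (q := q) c]
    group
  have h1 : qr q k * qr q c = 1 := by
    refine qprime_mul hq (hN.Opp_coprime hq) (V := hN.Opp hq) ⟨qr_mem hk, ppel_qr hq k⟩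
      (hN.nm_Opp hq (hHN (qr_mem hcP))) (ppel_qr hq c) ?_
    have : qr q k * qr q c = (qp q k)⁻¹ * s * (qp q c)⁻¹ := by rw [hs1]; group
    rw [this]
    exact pel_of_mem hS (mul_mem (mul_mem (inv_mem (hPS hkq)) hsS) (inv_mem (hPS hcq)))
  apply hsP
  rw [hs1, h1, mul_one]
  exact mul_mem hkq hcq

theorem S2 (I : Iso r x) {q : ℕ} (hq : q.Prime) {P P' : Subgroup G} (hP : XS q x P) (hP' : XS q x P') :
    ∃ c, Commute c x ∧ ∀ b, b ∈ P' ↔ c * b * c⁻¹ ∈ P := by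
  haveI := Fact.mk hq
  let S : Sylow q G := ⟨P, hP.1, fun {Q} hQ h => le_antisymm (hP.2.2 Q hQ h) h⟩
  let S' : Sylow q G := ⟨P', hP'.1, fun {Q} hQ h => le_antisymm (hP'.2.2 Q hQ h) h⟩
  obtain ⟨g, hg⟩ := MulAction.exists_smul_eq G S S'
  have hg1 : ∀ b, b ∈ P' ↔ g⁻¹ * b * g ∈ P := by
    intro b
    have : b ∈ P' ↔ b ∈ (g • S : Sylow q G) := by rw [hg]; exact Iff.rfl
    rw [this, ← SetLike.mem_coe, Sylow.coe_smul, Set.mem_smul_set_iff_inv_smul_mem]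
    simp only [SetLike.mem_coe]
    rw [← map_inv, MulAut.smul_def, MulAut.conj_apply, inv_inv]
    exact Iff.rfl
  have ht : ⁅g⁻¹, x⁆ ∈ nm P := by
    have h1 : g⁻¹ * x * g ∈ nm P := by
      apply nm_of
      intro b hb
      have h2 : g * b * g⁻¹ ∈ P' := by rw [hg1]; simpa [mul_assoc] using hb
      have h3 := (hg1 _).1 (nm_conj hP'.2.1 h2)
      have : g⁻¹ * x * g * b * (g⁻¹ * x * g)⁻¹ = g⁻¹ * (x * (g * b * g⁻¹) * x⁻¹) * g := by group
      rwa [this]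
    have := mul_mem h1 (inv_mem hP.2.1)
    simpa [commutatorElement_def] using this
  obtain ⟨d, hd, h⟩ := I.dex_mem (le_nm _ hP.2.1) ht
  refine ⟨d⁻¹ * g⁻¹, comm_eq_iff h, fun b => ?_⟩
  rw [hg1]
  have e : d⁻¹ * g⁻¹ * b * (d⁻¹ * g⁻¹)⁻¹ = d⁻¹ * (g⁻¹ * b * g) * d⁻¹⁻¹ := by group
  rw [e]
  exact mem_normalizer_iff.1 (inv_mem hd) _

theorem S3 (I : Iso r x) {q : ℕ} (hq : q.Prime) {P B : Subgroup G} (hP : XS q x P) (hB : IsPGroup q B) (hxB : x ∈ nm B) :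
    ∃ c, Commute c x ∧ ∀ b ∈ B, c * b * c⁻¹ ∈ P := by
  by_cases hb : B = ⊥
  · refine ⟨1, Commute.one_left x, ?_⟩
    rw [hb]; intro b hb
    rw [mem_bot.1 hb]; simp
  · obtain ⟨P', hBP', hP'⟩ := I.S1 hq hB hxB hb
    obtain ⟨c, hc, h⟩ := I.S2 hq hP hP'
    exact ⟨c, hc, fun b hb => (h b).1 (hBP' hb)⟩

end Iso

def Wq (q : ℕ) (x : G) : Subgroup G := sInf {P | XS q x P}

theorem Wq_le {q : ℕ} {x : G} {P : Subgroup G} (h : XS q x P) : Wq q x ≤ P := sInf_le h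

theorem nm_map_conj {P : Subgroup G} {x c : G} (hx : x ∈ nm P) (h : Commute c x) :
    x ∈ nm (P.map (MulAut.conj c).toMonoidHom) := by
  apply nm_of
  rintro _ ⟨b, hb, rfl⟩
  refine ⟨x * b * x⁻¹, nm_conj hx hb, ?_⟩
  simp only [MulEquiv.coe_toMonoidHom, MulAut.conj_apply]
  have h1 := h.eq
  calc c * (x * b * x⁻¹) * c⁻¹ = (c * x) * b * (c * x)⁻¹ := by group
    _ = (x * c) * b * (x * c)⁻¹ := by rw [h1]
    _ = _ := by group

theorem XS.conj {q : ℕ} {x c : G} {P : Subgroup G} (h : XS q x P) (hc : Commute c x) :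
    XS q x (P.map (MulAut.conj c).toMonoidHom) := by
  refine ⟨h.1.map _, nm_map_conj h.2.1 hc, fun Q hQ hPQ => ?_⟩
  have h1 := h.2.2 (Q.map (MulAut.conj c⁻¹).toMonoidHom) (hQ.map _) (fun b hb =>
    ⟨c * b * c⁻¹, hPQ ⟨b, hb, rfl⟩, by simp [mul_assoc]⟩)
  intro b hb
  exact ⟨c⁻¹ * b * c⁻¹⁻¹, h1 ⟨b, hb, rfl⟩, by simp [mul_assoc]⟩

theorem Wq_nm {q : ℕ} {x : G} : Cn x ≤ nm (Wq q x) := by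
  intro c hc
  have hc' := mem_Cn.1 hc
  apply nm_of
  intro b hb
  rw [Wq, mem_sInf]
  intro P hP
  have h1 := (mem_sInf.1 hb) _ (hP.conj hc'.inv_left)
  obtain ⟨b', hb', e⟩ := h1
  rw [← e]
  simpa [mul_assoc] using hb'

theorem Iso.le_Wq {r : ℕ} {x : G} (I : Iso r x) {q : ℕ} (hq : q.Prime) {B : Subgroup G} (hB : IsPGroup q B)
    (hCB : Cn x ≤ nm B) : B ≤ Wq q x := by
  rw [Wq, le_sInf_iff]
  intro P hP
  obtain ⟨c, hc, h⟩ := I.S3 hq hP hB (hCB (mem_Cn.2 (Commute.refl x)))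
  intro b hb
  have := h _ (nm_conj' (hCB (mem_Cn.2 hc)) hb)
  simpa [mul_assoc] using this

theorem Iso.I4 {r : ℕ} {x : G} (I : Iso r x) {q : ℕ} (hq : q.Prime) (hqr : q ≠ r) (hW1 : Wq q x ≠ ⊥)
    (hWp : IsPGroup q (Wq q x)) {g0 : G} (h0 : pel q ⁅g0, x⁆) : ⁅g0, x⁆ ∈ Wq q x := by
  by_contra hcon
  set W := Wq q x with hW
  have hxC : x ∈ Cn x := mem_Cn.2 (Commute.refl x)
  have hCW : Cn x ≤ nm W := Wq_nm
  have hxW : x ∈ nm W := hCW hxC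
  obtain ⟨N, hN, hNH, hHN, hNc⟩ := I.hC.2 x I.hI (nm W) (I.hC.nm_ne hq hWp hW1) hxW
  have hOW : hN.Op hq ≤ W := I.le_Wq hq (hN.Op_isPGroup hq) fun c hc => hN.nm_Op hq (hHN (hCW hc))
  have hTM : ∀ g : G, pel q ⁅g, x⁆ → ⁅g, x⁆ ∈ nm W → ⁅g, x⁆ ∈ W := fun g hg hgW =>
    hOW ⟨A1mem I.hI I.hr I.hx (I.hT g) hxW hgW hNc, hg⟩
  have ht0D : ⁅g0, x⁆ ∈ Dc x ⁅g0, x⁆ := mem_Dc _ _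
  obtain ⟨P, hDP, hP⟩ := I.S1 hq (Dc_pgroup I.hI hq h0) (Dc_nm _ _) (by
    intro h
    rw [h, mem_bot] at ht0D
    exact hcon (by rw [ht0D]; exact one_mem _))
  have hWP : W ≤ P := Wq_le hP
  have hT1 : P ⊓ Cn x ≤ nm W := inf_le_right.trans hCW
  have hWT : W ⊔ (P ⊓ Cn x) ≤ nm W := sup_le (le_nm W) hT1
  obtain ⟨n, hnP, hn1, hn2⟩ := exists_nm_gt hq hP.1 (sup_le hWP inf_le_left : W ⊔ (P ⊓ Cn x) ≤ P) (fun h =>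
    hcon (hTM g0 h0 (hWT (h (hDP ht0D)))))
  have htP : ⁅n, x⁆ ∈ P := nm_comm hP.2.1 hnP
  have htq : pel q ⁅n, x⁆ := pel_of_mem hP.1 htP
  have htW : ⁅n, x⁆ ∉ nm W := by
    intro h
    obtain ⟨d, hd, h2⟩ := I.dex_mem hxW (hTM n htq h)
    apply hn1
    have : n = d * (d⁻¹ * n) := by group
    rw [this]
    exact mul_mem ((le_sup_left : W ≤ _) hd) ((le_sup_right : P ⊓ Cn x ≤ _)
      ⟨P.mul_mem (P.inv_mem (hWP hd)) hnP, mem_Cn.2 (comm_eq_iff h2)⟩)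
  have hxWT : x ∈ nm (W ⊔ (P ⊓ Cn x)) := by
    apply nm_of
    intro b hb
    obtain ⟨w, hw, c, hc, rfl⟩ := mem_sup_nm hT1 hb
    have : x * (w * c) * x⁻¹ = (x * w * x⁻¹) * (x * c * x⁻¹) := by group
    rw [this, (mem_Cn.1 hc.2).symm.eq, mul_inv_cancel_right]
    exact mul_mem ((le_sup_left : W ≤ _) (nm_conj hxW hw)) ((le_sup_right : P ⊓ Cn x ≤ _) hc)
  have htWT : ⁅n, x⁆ ∈ nm (W ⊔ (P ⊓ Cn x)) := by
    rw [commutatorElement_def]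
    exact Subgroup.mul_mem _ (Subgroup.mul_mem _ (Subgroup.mul_mem _ hn2 hxWT) (Subgroup.inv_mem _ hn2)) (Subgroup.inv_mem _ hxWT)
  have hXC : ∀ u ∈ W ⊔ zpowers ⁅n, x⁆, u ∈ Cn x → u ∈ W := by
    intro u hu huC
    obtain ⟨O, hOC, hCO, hO, huO⟩ := BS_rel hq (Cn x) huC (by
      intro c hc
      obtain ⟨N', hN', hxN', hcN', htN'⟩ := L2 I.hI I.hr I.hx (I.hT n) (mem_Cn.1 hc)
      have hJt : ⁅n, x⁆ ∈ hN'.Op hq := ⟨htN', htq⟩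
      obtain ⟨P'', hJP, hP''⟩ := I.S1 hq (hN'.Op_isPGroup hq) (hN'.nm_Op hq hxN') (by
        intro h
        rw [h, mem_bot] at hJt
        exact htW (by rw [hJt]; exact one_mem _))
      have hX : W ⊔ zpowers ⁅n, x⁆ ≤ P'' := sup_le (Wq_le hP'') (by rw [zpowers_le]; exact hJP hJt)
      have hX' : W ⊔ zpowers ⁅n, x⁆ ≤ P''.comap (MulAut.conj c).toMonoidHom := by
        refine sup_le (fun w hw => Wq_le hP'' (nm_conj (hCW hc) hw)) ?_
        rw [zpowers_le]
        exact hJP (nm_conj (hN'.nm_Op hq hcN') hJt)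
      refine hP''.1.to_le ?_
      rw [closure_le]
      rintro z (rfl | rfl)
      · exact hX hu
      · exact hX' hu)
    exact I.le_Wq hq hO hCO huO
  apply htW
  apply nm_of
  intro w hw
  have h1 : ⁅n, x⁆ * w * ⁅n, x⁆⁻¹ ∈ W ⊔ (P ⊓ Cn x) := nm_conj htWT ((le_sup_left : W ≤ _) hw)
  have hzm : ⁅n, x⁆ ∈ W ⊔ zpowers ⁅n, x⁆ := (le_sup_right : zpowers ⁅n, x⁆ ≤ _) (mem_zpowers _)
  have h2 : ⁅n, x⁆ * w * ⁅n, x⁆⁻¹ ∈ W ⊔ zpowers ⁅n, x⁆ :=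
    mul_mem (mul_mem hzm ((le_sup_left : W ≤ _) hw)) (inv_mem hzm)
  obtain ⟨w', hw', c, hc, e⟩ := mem_sup_nm hT1 h1
  rw [e] at h2 ⊢
  refine mul_mem hw' (hXC c ?_ hc.2)
  have := mul_mem (inv_mem ((le_sup_left : W ≤ W ⊔ zpowers ⁅n, x⁆) hw')) h2
  simpa using this

theorem pel_of_qp {q : ℕ} (hq : q.Prime) {t : G} (h : ∀ l : ℕ, l.Prime → l ≠ q → qp l t = 1) : pel q t := by
  have h1 : qr q t ∈ (⊥ : Subgroup G) := by
    apply mem_of_qp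
    intro l hl
    by_cases hlq : l = q
    · subst hlq; rw [(ppel_iff hl).1 (ppel_qr hl _)]; exact one_mem _
    · rw [qp_qr_ne hq hl hlq, h l hl hlq]; exact one_mem _
  rw [← qp_mul_qr (q := q) t, mem_bot.1 h1, mul_one]
  exact pel_qp hq t

theorem conj_closure_nm (x t : G) : Cn x ≤ nm (closure {z | ∃ c ∈ Cn x, z = c * t * c⁻¹}) := by
  intro c hc
  apply nm_closure
  rintro _ ⟨c', hc', rfl⟩
  exact subset_closure ⟨c * c', mul_mem hc hc', by group⟩

section I3
variable {r : ℕ} {x : G} {q : ℕ}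

theorem I3i (I : Iso r x) (hq : q.Prime) (hqr : q ≠ r)
    (hW : ∀ B : Subgroup G, IsPGroup q B → Cn x ≤ nm B → B = ⊥) {l : ℕ} (hl : l.Prime) (hlq : l ≠ q) (g : G) :
    qp q ⁅g, x⁆ = 1 ∨ qp l ⁅g, x⁆ = 1 := by
  by_cases hlr : l = r
  · subst hlr; right; exact (ppel_iff hl).1 (I.hT g)
  by_contra hcon
  push Not at hcon
  obtain ⟨h1, h2⟩ := hcon
  obtain ⟨e, he⟩ := A3 I.hI I.hr I.hx hl hlr g
  obtain ⟨f, hf⟩ := A3 I.hI I.hr I.hx hq hqr g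
  have hep : pel l ⁅e, x⁆ := by rw [he]; exact pel_qp hl _
  have hfp : pel q ⁅f, x⁆ := by rw [hf]; exact pel_qp hq _
  set D := Dc x ⁅e, x⁆ with hD
  have hDl : IsPGroup l D := Dc_pgroup I.hI hl hep
  have hDb : D ≠ ⊥ := by
    intro h
    have : ⁅e, x⁆ ∈ D := mem_Dc _ _
    rw [h, mem_bot, he] at this
    exact h2 this
  obtain ⟨N, hN, hNH, hHN, hNc⟩ := I.hC.2 x I.hI (nm D) (I.hC.nm_ne hl hDl hDb) (Dc_nm _ _)
  have hle : closure {z | ∃ c ∈ Cn x, z = c * ⁅f, x⁆ * c⁻¹} ≤ hN.Op hq := by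
    rw [closure_le]
    rintro _ ⟨c, hc, rfl⟩
    refine ⟨?_, hfp.conj c⟩
    rw [conj_comm_of_commute (mem_Cn.1 hc)]
    refine A1mem I.hI I.hr I.hx (I.hT _) (Dc_nm _ _) ?_ hNc
    rw [← conj_comm_of_commute (mem_Cn.1 hc)]
    obtain ⟨N', hN', hxN', hcN', htN'⟩ := L2 I.hI I.hr I.hx (I.hT g) (mem_Cn.1 hc)
    have hDN : D ≤ hN'.Op hl := Dc_le_of_nm (hN'.nm_Op hl hxN') ⟨by rw [he]; exact qp_mem htN', hep⟩
    have hfN : c * ⁅f, x⁆ * c⁻¹ ∈ hN'.Op hq :=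
      nm_conj (hN'.nm_Op hq hcN') ⟨by rw [hf]; exact qp_mem htN', hfp⟩
    apply nm_of
    intro b hb
    have := hN'.comm hfN.1 (hDN hb).1 hfN.2 ((hDN hb).2.ppel_of_ne hl hq hlq)
    rw [this.eq, mul_inv_cancel_right]; exact hb
  have hb := hW _ ((hN.Op_isPGroup hq).to_le hle) (conj_closure_nm x _)
  have : ⁅f, x⁆ ∈ closure {z | ∃ c ∈ Cn x, z = c * ⁅f, x⁆ * c⁻¹} := subset_closure ⟨1, one_mem _, by simp⟩
  rw [hb, mem_bot, hf] at this
  exact h1 this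

theorem I3ii (I : Iso r x) (hq : q.Prime)
    (hW : ∀ B : Subgroup G, IsPGroup q B → Cn x ≤ nm B → B = ⊥) {g0 : G} (h0 : pel q ⁅g0, x⁆) (h01 : ⁅g0, x⁆ ≠ 1) :
    ∃ c ∈ Cn x, pel q c ∧ c ≠ 1 := by
  by_contra hcon
  push Not at hcon
  have TI : ∀ P P', XS q x P → XS q x P' → P ≠ P' → P ⊓ P' = ⊥ := by
    by_contra hc
    push Not at hc
    obtain ⟨P0, P0', h1, h2, h3, h4⟩ := hc
    let X := {PQ : Subgroup G × Subgroup G // XS q x PQ.1 ∧ XS q x PQ.2 ∧ PQ.1 ≠ PQ.2 ∧ PQ.1 ⊓ PQ.2 ≠ ⊥}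
    haveI : Nonempty X := ⟨⟨(P0, P0'), h1, h2, h3, h4⟩⟩
    obtain ⟨⟨⟨P, P'⟩, hP, hP', hne, hb⟩, hmax⟩ := Finite.exists_max (fun z : X => Nat.card (z.1.1 ⊓ z.1.2 : Subgroup G))
    simp only at hP hP' hne hb hmax
    set B := P ⊓ P' with hB
    have hxB : x ∈ nm B := nm_of fun b hb => ⟨nm_conj hP.2.1 hb.1, nm_conj hP'.2.1 hb.2⟩
    have hBp : IsPGroup q B := hP.1.to_le inf_le_left
    obtain ⟨N, hN, hNH, hHN, hNc⟩ := I.hC.2 x I.hI (nm B) (I.hC.nm_ne hq hBp hb) hxB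
    have key : ∀ R, XS q x R → B ≤ R → ∀ s ∈ R, s ∈ nm B → s ∈ hN.Op hq := by
      intro R hR hBR s hsR hsB
      have htR : ⁅s, x⁆ ∈ R := nm_comm hR.2.1 hsR
      have htN : ⁅s, x⁆ ∈ hN.Op hq := ⟨hNc s hsB, pel_of_mem hR.1 htR⟩
      obtain ⟨d, hd, h2⟩ := I.dex_mem (K := hN.Op hq ⊓ R) (g := s)
        (nm_of fun b hb => ⟨nm_conj (hN.nm_Op hq (hHN hxB)) hb.1, nm_conj hR.2.1 hb.2⟩) ⟨htN, htR⟩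
      have h3 := hcon (d⁻¹ * s) (mem_Cn.2 (comm_eq_iff h2)) (pel_of_mem hR.1 (mul_mem (inv_mem hd.2) hsR))
      rw [inv_mul_eq_one] at h3
      rw [← h3]; exact hd.1
    have hOb : hN.Op hq ≠ ⊥ := by
      intro h
      apply hb
      rw [eq_bot_iff]
      intro b hbB
      rw [← h]
      exact key P hP inf_le_left b hbB.1 (le_nm _ hbB)
    obtain ⟨P'', hJP, hP''⟩ := I.S1 hq (hN.Op_isPGroup hq) (hN.nm_Op hq (hHN hxB)) hOb
    have key2 : ∀ R, XS q x R → B ≤ R → ¬ R ≤ B → R = P'' := by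
      intro R hR hBR hRB
      by_contra hne2
      obtain ⟨s, hsR, hsB, hs⟩ := exists_nm_gt hq hR.1 hBR hRB
      have hlt : B < R ⊓ P'' := by
        refine lt_of_le_of_ne (fun b hbB => ⟨hBR hbB, hJP (key R hR hBR b (hBR hbB) (le_nm _ hbB))⟩) ?_
        intro h
        apply hsB; rw [h]
        exact ⟨hsR, hJP (key R hR hBR s hsR hs)⟩
      have h5 := hmax (⟨(R, P''), hR, hP'', hne2, fun h => hb (by rw [h] at hlt; exact (not_lt_bot hlt).elim)⟩ : X)
      have h6 : Nat.card B < Nat.card (R ⊓ P'' : Subgroup G) :=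
        Set.Finite.card_lt_card (Set.toFinite _) hlt
      exact absurd h5 (not_le.2 h6)
    have h1 : ¬ P ≤ B := fun h => hne (le_antisymm (h.trans inf_le_right) (hP.2.2 P' hP'.1 (h.trans inf_le_right)))
    have h2 : ¬ P' ≤ B := fun h => hne (le_antisymm (hP'.2.2 P hP.1 (h.trans inf_le_left)) (h.trans inf_le_left))
    exact hne ((key2 P hP inf_le_left h1).trans (key2 P' hP' inf_le_right h2).symm)
  have ht0D : ⁅g0, x⁆ ∈ Dc x ⁅g0, x⁆ := mem_Dc _ _
  obtain ⟨P, hDP, hP⟩ := I.S1 hq (Dc_pgroup I.hI hq h0) (Dc_nm _ _) (by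
    intro h
    rw [h, mem_bot] at ht0D
    exact h01 ht0D)
  have hle : closure {z | ∃ c ∈ Cn x, z = c * ⁅g0, x⁆ * c⁻¹} ≤ P := by
    rw [closure_le]
    rintro _ ⟨c, hc, rfl⟩
    obtain ⟨N', hN', hxN', hcN', htN'⟩ := L2 I.hI I.hr I.hx (I.hT g0) (mem_Cn.1 hc)
    have hJt : ⁅g0, x⁆ ∈ hN'.Op hq := ⟨htN', h0⟩
    obtain ⟨P'', hJP, hP''⟩ := I.S1 hq (hN'.Op_isPGroup hq) (hN'.nm_Op hq hxN') (by
      intro h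
      rw [h, mem_bot] at hJt
      exact h01 hJt)
    have : P = P'' := by
      by_contra hne
      have h1 := TI P P'' hP hP'' hne
      have h2 : ⁅g0, x⁆ ∈ P ⊓ P'' := ⟨hDP ht0D, hJP hJt⟩
      rw [h1, mem_bot] at h2
      exact h01 h2
    rw [this]
    exact hJP (nm_conj (hN'.nm_Op hq hcN') hJt)
  have hb := hW _ (hP.1.to_le hle) (conj_closure_nm x _)
  have : ⁅g0, x⁆ ∈ closure {z | ∃ c ∈ Cn x, z = c * ⁅g0, x⁆ * c⁻¹} := subset_closure ⟨1, one_mem _, by simp⟩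
  rw [hb, mem_bot] at this
  exact h01 this

end I3

theorem pow_mul_inv_mem {V : Subgroup G} {v a : G} (hv : v ∈ V) (ha : a ∈ nm V) (n : ℕ) :
    (v * a) ^ n * (a ^ n)⁻¹ ∈ V := by
  induction n with
  | zero => simp
  | succ n ih =>
    have : (v * a) ^ (n + 1) * (a ^ (n + 1))⁻¹ = v * (a * ((v * a) ^ n * (a ^ n)⁻¹) * a⁻¹) := by
      rw [pow_succ', pow_succ']; group
    rw [this]
    exact V.mul_mem hv (nm_conj ha ih)

theorem not_dvd_index_of_max {p : ℕ} (hp : p.Prime) {P : Subgroup G} (hP : IsPGroup p P)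
    (hmax : ∀ Q : Subgroup G, IsPGroup p Q → P ≤ Q → Q ≤ P) : ¬ p ∣ P.index := by
  haveI := Fact.mk hp
  let S : Sylow p G := ⟨P, hP, fun {Q} hQ h => le_antisymm (hmax Q hQ h) h⟩
  exact S.not_dvd_index

section J
variable {r : ℕ} {x : G} {q : ℕ}

theorem J1a (I : Iso r x) (hq : q.Prime) (hqr : q ≠ r) (hall : ∀ g : G, pel q ⁅g, x⁆) {p : ℕ} (hp : p.Prime)
    (hpq : p ≠ q) : ¬ p ∣ (Cn x).index := by
  haveI := Fact.mk hp
  by_cases hpr : p = r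
  · subst hpr
    obtain ⟨R, hR⟩ := (isPGroup_zpowers I.hx).exists_le_sylow
    have hxR : x ∈ (R : Subgroup G) := hR (mem_zpowers x)
    have hRC : (R : Subgroup G) ≤ Cn x := by
      intro g hg
      have h1 : ⁅g, x⁆ ∈ (R : Subgroup G) := nm_comm (le_nm _ hxR) hg
      have := pel_pel hp hq hpq (pel_of_mem R.2 h1) (hall g)
      exact mem_Cn.2 (commutatorElement_eq_one_iff_commute.1 this)
    exact fun h => R.not_dvd_index (h.trans (index_dvd_of_le hRC))
  by_cases hpG : p ∣ Nat.card G
  swap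
  · exact fun h => hpG (h.trans (index_dvd_card _))
  obtain ⟨y, hy⟩ := exists_prime_orderOf_dvd_card' p hpG
  have hyp : pel p y := ⟨1, by rw [pow_one, ← hy, pow_orderOf_eq_one]⟩
  have hy1 : y ≠ 1 := by
    rintro rfl
    rw [orderOf_one] at hy
    exact hp.one_lt.ne hy
  obtain ⟨N, hN, hxN, hyN, htN, -⟩ := I.hI.get y
  have hxJ := hN.nm_Op hq hxN
  have hyJ := hN.nm_Op hq hyN
  have htJ : ⁅y, x⁆ ∈ hN.Op hq := ⟨htN, hall y⟩
  have hcy : x * y * x⁻¹ = ⁅y, x⁆⁻¹ * y := by simp [commutatorElement_def]; group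
  obtain ⟨j, hj, hjL⟩ := SC hp (isPGroup_zpowers hyp) (coprime_pgroup hq hp (Ne.symm hpq) (hN.Op_isPGroup hq))
    (zpowers_le_nm hyJ) (L := zpowers (x * y * x⁻¹)) (isPGroup_zpowers (hyp.conj x)) (by
      rw [zpowers_le, hcy]
      exact Subgroup.mul_mem _ ((le_sup_left : hN.Op hq ≤ _) (Subgroup.inv_mem _ htJ))
        ((le_sup_right : zpowers y ≤ _) (mem_zpowers y)))
  have hjx : j * x ∈ nm (zpowers y) := by
    rw [zpowers_eq_closure]
    apply nm_closure
    rintro b rfl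
    rw [← zpowers_eq_closure]
    have := hjL _ (mem_zpowers _)
    have e : j * x * b * (j * x)⁻¹ = j * (x * b * x⁻¹) * j⁻¹ := by group
    rw [e]; exact this
  have hx'n : qp r (j * x) ∈ nm (zpowers y) := qp_mem hjx
  have h3 : qp r (j * x) * x⁻¹ ∈ hN.Op hq := by
    have := pow_mul_inv_mem hj hxJ (ex G r)
    have e : x ^ ex G r = x := qp_of_pel I.hr I.hx
    rw [e] at this
    exact this
  obtain ⟨d, hd, hdx⟩ := SZ I.hr I.hx (coprime_pgroup hq I.hr hqr (hN.Op_isPGroup hq)) hxJ h3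
    (by rw [inv_mul_cancel_right]; exact pel_qp I.hr _)
  rw [inv_mul_cancel_right] at hdx
  have hxz : x ∈ nm (zpowers (d⁻¹ * y * d)) := by
    rw [zpowers_eq_closure]
    apply nm_closure
    rintro b rfl
    rw [← zpowers_eq_closure]
    have h5 : qp r (j * x) * y * (qp r (j * x))⁻¹ ∈ zpowers y := nm_conj hx'n (mem_zpowers y)
    obtain ⟨k, hk⟩ := h5
    refine ⟨k, ?_⟩
    simp only at hk ⊢
    rw [← hdx] at hk
    have e1 : (d⁻¹ * y * d) ^ k = d⁻¹ * y ^ k * d := by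
      simpa using (conj_zpow (a := d⁻¹) (b := y) (i := k))
    rw [e1, hk]; group
  obtain ⟨P, hzP, hP⟩ := I.S1 hp (isPGroup_zpowers (by simpa using hyp.conj d⁻¹)) hxz (by
    intro h
    rw [zpowers_eq_bot] at h
    apply hy1
    have : y = d * (d⁻¹ * y * d) * d⁻¹ := by group
    rw [this, h]; simp)
  have hPC : P ≤ Cn x := by
    intro g hg
    have h1 : ⁅g, x⁆ ∈ P := nm_comm hP.2.1 hg
    have := pel_pel hp hq hpq (pel_of_mem hP.1 h1) (hall g)
    exact mem_Cn.2 (commutatorElement_eq_one_iff_commute.1 this)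
  exact fun h => not_dvd_index_of_max hp hP.1 hP.2.2 (h.trans (index_dvd_of_le hPC))

theorem exists_mul_of_coprime {P C : Subgroup G} (h : P.index.Coprime C.index) (g : G) :
    ∃ b ∈ P, ∃ c ∈ C, g = b * c := by
  have h1 : C.index ∣ C.relIndex P := by
    have e1 := relIndex_mul_index (inf_le_left : P ⊓ C ≤ P)
    have e2 := relIndex_mul_index (inf_le_right : P ⊓ C ≤ C)
    rw [inf_relIndex_left] at e1
    have : C.index ∣ C.relIndex P * P.index := ⟨(P ⊓ C).relIndex C, by rw [e1, ← e2, mul_comm]⟩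
    exact h.symm.dvd_of_dvd_mul_right this
  let f : P ⧸ C.subgroupOf P → G ⧸ C := Quotient.map' (fun b => (b : G)) (by
    intro a b hab
    rw [QuotientGroup.leftRel_apply] at hab ⊢
    simpa [mem_subgroupOf] using hab)
  have hf : Function.Injective f := by
    intro a b
    induction a using QuotientGroup.induction_on with | H a => ?_
    induction b using QuotientGroup.induction_on with | H b => ?_
    intro hab
    have hab' : ((a : G) : G ⧸ C) = ((b : G) : G ⧸ C) := hab
    rw [QuotientGroup.eq] at hab'
    rw [QuotientGroup.eq]
    simpa [mem_subgroupOf] using hab'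
  have hc : Nat.card (G ⧸ C) ≤ Nat.card (P ⧸ C.subgroupOf P) :=
    Nat.le_of_dvd Nat.card_pos h1
  obtain ⟨b, hb⟩ := (hf.bijective_of_nat_card_le hc).2 (g : G ⧸ C)
  induction b using QuotientGroup.induction_on with | H b => ?_
  have hb' : ((b : G) : G ⧸ C) = (g : G ⧸ C) := hb
  rw [QuotientGroup.eq] at hb'
  exact ⟨b, b.2, _, hb', by group⟩

theorem J1 (I : Iso r x) (hq : q.Prime) (hqr : q ≠ r)
    (hW : ∀ B : Subgroup G, IsPGroup q B → Cn x ≤ nm B → B = ⊥) (hall : ∀ g : G, pel q ⁅g, x⁆) : False := by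
  obtain ⟨g0, h01⟩ : ∃ g0 : G, ⁅g0, x⁆ ≠ 1 := by
    by_contra hcon
    push Not at hcon
    apply I.C_ne
    rw [eq_top_iff]
    intro g _
    exact mem_Cn.2 (commutatorElement_eq_one_iff_commute.1 (hcon g))
  have ht0D : ⁅g0, x⁆ ∈ Dc x ⁅g0, x⁆ := mem_Dc _ _
  obtain ⟨P, hDP, hP⟩ := I.S1 hq (Dc_pgroup I.hI hq (hall g0)) (Dc_nm _ _) (by
    intro h
    rw [h, mem_bot] at ht0D
    exact h01 ht0D)
  have hcop : P.index.Coprime (Cn x).index := by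
    apply Nat.Coprime.symm
    apply Nat.coprime_of_dvd
    intro p hp h1 h2
    by_cases hpq : p = q
    · subst hpq; exact not_dvd_index_of_max hp hP.1 hP.2.2 h2
    · exact J1a I hq hqr hall hp hpq h1
  have hle : closure {z | ∃ g : G, z = ⁅g, x⁆} ≤ P := by
    rw [closure_le]
    rintro _ ⟨g, rfl⟩
    obtain ⟨b, hb, c, hc, rfl⟩ := exists_mul_of_coprime hcop g
    rw [comm_inv_mul (mem_Cn.1 hc)]
    exact nm_comm hP.2.1 hb
  have hb := hW _ (hP.1.to_le hle) (by
    intro c hc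
    apply nm_closure
    rintro _ ⟨g, rfl⟩
    rw [conj_comm_of_commute (mem_Cn.1 hc)]
    exact subset_closure ⟨_, rfl⟩)
  have : ⁅g0, x⁆ ∈ closure {z | ∃ g : G, z = ⁅g, x⁆} := subset_closure ⟨_, rfl⟩
  rw [hb, mem_bot] at this
  exact h01 this

theorem I3iii (I : Iso r x) (hq : q.Prime) (hqr : q ≠ r)
    (hW : ∀ B : Subgroup G, IsPGroup q B → Cn x ≤ nm B → B = ⊥) {g0 : G} (h0 : pel q ⁅g0, x⁆) (h01 : ⁅g0, x⁆ ≠ 1) :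
    False := by
  obtain ⟨c, hcC, hcq, hc1⟩ := I3ii I hq hW h0 h01
  have hcx : Commute c x := mem_Cn.1 hcC
  obtain ⟨P, hcP, hP⟩ := I.S1 hq (isPGroup_zpowers hcq) (by
    apply nm_of
    intro b hb
    obtain ⟨k, rfl⟩ := hb
    refine ⟨k, ?_⟩
    have : Commute (c ^ k) x := hcx.zpow_left k
    simp only
    rw [this.symm.eq, mul_inv_cancel_right]) (by simpa using hc1)
  rw [zpowers_le] at hcP
  have hPC : ¬ P ≤ P ⊓ Cn x := by
    intro hPC
    have hPC : P ≤ Cn x := hPC.trans inf_le_right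
    have ht0D : ⁅g0, x⁆ ∈ Dc x ⁅g0, x⁆ := mem_Dc _ _
    obtain ⟨P', hDP, hP'⟩ := I.S1 hq (Dc_pgroup I.hI hq h0) (Dc_nm _ _) (by
      intro h
      rw [h, mem_bot] at ht0D
      exact h01 ht0D)
    obtain ⟨c1, hc1, h2⟩ := I.S2 hq hP hP'
    obtain ⟨d, hd, hd2⟩ := I.dex g0
    have h3 := hPC ((h2 d).1 (hDP hd))
    have h4 : d ∈ Cn x := by
      have e : d = c1⁻¹ * (c1 * d * c1⁻¹) * c1 := by group
      rw [e]
      exact Subgroup.mul_mem _ (Subgroup.mul_mem _ (Subgroup.inv_mem _ (mem_Cn.2 hc1)) h3) (mem_Cn.2 hc1)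
    apply h01
    rw [← hd2]
    exact commutatorElement_eq_one_iff_commute.2 (mem_Cn.1 h4)
  obtain ⟨n, hnP, hn1, hn2⟩ := exists_nm_gt hq hP.1 inf_le_left hPC
  set s := ⁅n, x⁆ with hs
  have hsP : s ∈ P := nm_comm hP.2.1 hnP
  have hsq : pel q s := pel_of_mem hP.1 hsP
  have hs1 : s ≠ 1 := fun h => hn1 ⟨hnP, mem_Cn.2 (commutatorElement_eq_one_iff_commute.1 h)⟩
  have hsc : Commute s c := by
    have h1 : n⁻¹ * c * n ∈ P ⊓ Cn x := nm_conj' hn2 ⟨hcP, hcC⟩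
    have h2 : x * (n⁻¹ * c * n) * x⁻¹ = n⁻¹ * c * n := by
      rw [(mem_Cn.1 h1.2).symm.eq, mul_inv_cancel_right]
    have h3 : x⁻¹ * c * x = c := by rw [mul_assoc, hcx.eq]; group
    have h4 : s * c * s⁻¹ = c := by
      have : s * c * s⁻¹ = n * (x * (n⁻¹ * (x⁻¹ * c * x) * n) * x⁻¹) * n⁻¹ := by
        rw [hs, commutatorElement_def]; group
      rw [this, h3, h2]; group
    exact mul_inv_eq_iff_eq_mul.1 h4
  -- elements of T in the centraliser of c
  have hTc : ∀ g : G, Commute ⁅g, x⁆ c → pel q ⁅g, x⁆ := by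
    intro g hg
    have hxc : x ∈ Cn c := mem_Cn.2 hcx.symm
    obtain ⟨N, hN, hNH, hHN, hNc⟩ := I.hC.2 x I.hI (Cn c) (I.hC.Cn_ne hq hcq hc1) hxc
    have htN : ⁅g, x⁆ ∈ N := A1mem I.hI I.hr I.hx (I.hT _) hxc (mem_Cn.2 hg) hNc
    have hsN : s ∈ N := A1mem I.hI I.hr I.hx (I.hT _) hxc (mem_Cn.2 hsc) hNc
    have hxN : x ∈ nm N := hHN hxc
    apply pel_of_qp hq
    intro l hl hlq
    by_cases hlr : l = r
    · subst hlr; exact (ppel_iff hl).1 (I.hT g)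
    obtain ⟨e, he⟩ := A3 I.hI I.hr I.hx hl hlr g
    obtain ⟨ds, hds, hds2⟩ := I.dex_mem (K := hN.Op hq) (hN.nm_Op hq hxN) (⟨hsN, hsq⟩ : ⁅n, x⁆ ∈ hN.Op hq)
    obtain ⟨dl, hdl, hdl2⟩ := I.dex_mem (K := hN.Op hl) (g := e) (hN.nm_Op hl hxN)
      ⟨by rw [he]; exact qp_mem htN, by rw [he]; exact pel_qp hl _⟩
    have hcm : Commute ds dl := hN.comm hds.1 hdl.1 hds.2 (hdl.2.ppel_of_ne hl hq hlq)
    have hv : ds * dl ∈ N := N.mul_mem hds.1 hdl.1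
    have e1 : qp q (ds * dl) = ds := by
      rw [qp_mul hcm, qp_of_pel hq hds.2, qp_pel_ne hl hq hlq hdl.2, mul_one]
    have e2 : qp l (ds * dl) = dl := by
      rw [qp_mul hcm, qp_of_pel hl hdl.2, qp_pel_ne hq hl (Ne.symm hlq) hds.2, one_mul]
    rcases I3i I hq hqr hW hl hlq (ds * dl) with h | h
    · rw [hN.qp_comm hq hxN hv, e1, hds2] at h
      exact absurd h hs1
    · rw [hN.qp_comm hl hxN hv, e2, hdl2, he] at h
      exact h
  let Γ : Set G := {w | ∃ g, w = g * x * g⁻¹ ∧ pel q (w * x⁻¹)}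
  have hxG : x ∈ Γ := ⟨1, by simp, by simpa using pel_one⟩
  have hCG : Cn x ≤ normalizer Γ := by
    intro a ha
    apply mem_normalizer_fintype
    rintro w ⟨g, rfl, hg⟩
    refine ⟨a * g, by group, ?_⟩
    have e : a * (g * x * g⁻¹) * a⁻¹ * x⁻¹ = a * (g * x * g⁻¹ * x⁻¹) * a⁻¹ := by
      have : x⁻¹ * a⁻¹ = a⁻¹ * x⁻¹ := ((mem_Cn.1 ha).inv_inv.eq).symm
      rw [mul_assoc _ a⁻¹ x⁻¹, ← this]; group
    rw [e]; exact hg.conj a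
  have hnG : n ∈ normalizer Γ := by
    apply mem_normalizer_fintype
    rintro w ⟨g, rfl, hg⟩
    refine ⟨n * g, by group, ?_⟩
    set z := n * x * n⁻¹ with hz
    have hzs : z = s * x := conj_eq_comm n x
    have hcz : Commute c z := by rw [hzs]; exact hsc.symm.mul_right hcx
    set w := n * (g * x * g⁻¹) * n⁻¹ with hw
    have hwt : w = ⁅n * g, x⁆ * x := by rw [← conj_eq_comm]; rw [hw]; group
    have hwt' : w = ⁅n * g * n⁻¹, z⁆ * z := by rw [← conj_eq_comm]; rw [hw, hz]; group
    have hq' : pel q ⁅n * g * n⁻¹, z⁆ := by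
      have : ⁅n * g * n⁻¹, z⁆ = n * (g * x * g⁻¹ * x⁻¹) * n⁻¹ := by
        rw [commutatorElement_def, hz]; group
      rw [this]; exact hg.conj n
    have ec : ⁅⁅n * g, x⁆, c⁆ = ⁅⁅n * g * n⁻¹, z⁆, c⁆ := by
      rw [← comm_inv_mul hcx.symm (g := ⁅n * g, x⁆), ← hwt, ← comm_inv_mul hcz.symm (g := ⁅n * g * n⁻¹, z⁆), ← hwt']
    have hp1 : pel q ⁅⁅n * g, x⁆, c⁆ := by
      rw [ec]
      obtain ⟨N', hN', hzN', hcN', htN'⟩ := L2 (I.hI.conj n) I.hr (I.hx.conj n)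
        (hq'.ppel_of_ne hq I.hr hqr) hcz
      exact (nm_comm (hN'.nm_Op hq hcN') (⟨htN', hq'⟩ : _ ∈ hN'.Op hq)).2
    obtain ⟨N', hN', hxN', hcN', htN'⟩ := L2 I.hI I.hr I.hx (I.hT (n * g)) hcx
    have e5 : w * x⁻¹ = ⁅n * g, x⁆ := by rw [hwt]; group
    rw [e5]
    apply pel_of_qp hq
    intro l hl hlq
    by_cases hlr : l = r
    · subst hlr; exact (ppel_iff hl).1 (I.hT _)
    have h6 := hN'.qp_comm hl hcN' htN'
    rw [qp_pel_ne hq hl (Ne.symm hlq) hp1] at h6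
    obtain ⟨e, he⟩ := A3 I.hI I.hr I.hx hl hlr (n * g)
    rw [← he] at h6 ⊢
    refine pel_pel hl hq hlq ?_ (hTc e (commutatorElement_eq_one_iff_commute.1 h6.symm))
    rw [he]; exact pel_qp hl _
  by_cases htop : normalizer Γ = ⊤
  · apply J1 I hq hqr hW
    intro g
    have hg : g ∈ normalizer Γ := by rw [htop]; trivial
    obtain ⟨g1, h1, h2⟩ := (hg x).1 hxG
    exact h2
  · have hxM : x ∈ normalizer Γ := hCG (mem_Cn.2 (Commute.refl x))
    obtain ⟨N, hN, hNH, hHN, hNc⟩ := I.hC.2 x I.hI _ htop hxM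
    have hsN : s ∈ hN.Op hq := ⟨hNc n hnG, hsq⟩
    rw [hW _ (hN.Op_isPGroup hq) (fun a ha => hN.nm_Op hq (hHN (hCG ha))), mem_bot] at hsN
    exact hs1 hsN

end J

section I5
variable {r : ℕ} {x : G} {q : ℕ}

theorem TqW (I : Iso r x) (hq : q.Prime) {g0 : G} (h0 : pel q ⁅g0, x⁆) (h01 : ⁅g0, x⁆ ≠ 1) :
    (∃ P, XS q x P) ∧ ∀ g : G, pel q ⁅g, x⁆ → ⁅g, x⁆ ∈ Wq q x := by
  have ht0D : ⁅g0, x⁆ ∈ Dc x ⁅g0, x⁆ := mem_Dc _ _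
  obtain ⟨P, hDP, hP⟩ := I.S1 hq (Dc_pgroup I.hI hq h0) (Dc_nm _ _) (by
    intro h
    rw [h, mem_bot] at ht0D
    exact h01 ht0D)
  have hqr := I.ne_of_pel hq h0 h01
  refine ⟨⟨P, hP⟩, fun g hg => ?_⟩
  by_cases hb : Wq q x = ⊥
  · exact (I3iii I hq hqr (fun B hB hCB => by rw [eq_bot_iff, ← hb]; exact I.le_Wq hq hB hCB) h0 h01).elim
  · exact I.I4 hq hqr hb (hP.1.to_le (Wq_le hP)) hg

theorem Kq_pgroup (I : Iso r x) (hq : q.Prime) : IsPGroup q (Kq q x) := by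
  by_cases h : ∃ g0 : G, pel q ⁅g0, x⁆ ∧ ⁅g0, x⁆ ≠ 1
  · obtain ⟨g0, h0, h01⟩ := h
    obtain ⟨⟨P, hP⟩, h2⟩ := TqW I hq h0 h01
    refine (hP.1.to_le (Wq_le hP)).to_le ?_
    rw [Kq, closure_le]
    rintro _ ⟨g, rfl, hg⟩
    exact h2 g hg
  · push Not at h
    apply isPGroup_of
    intro g hg
    have : Kq q x ≤ ⊥ := by
      rw [Kq, closure_le]
      rintro _ ⟨g, rfl, hg⟩
      rw [h g hg]; exact one_mem _
    rw [mem_bot.1 (this hg)]; exact pel_one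

abbrev Tq (q : ℕ) (x : G) : Type u := {t : G // ∃ g : G, t = ⁅g, x⁆ ∧ pel q t}
abbrev Tt (x : G) : Type u := {t : G // ∃ g : G, t = ⁅g, x⁆}

theorem comm_eq_of {d g x : G} (h : Commute (d⁻¹ * g) x) : ⁅d, x⁆ = ⁅g, x⁆ := by
  rw [← comm_inv_mul h]; congr 1; group

theorem card_Tt (x : G) : Nat.card (Tt x) = (Cn x).index := by
  refine (Nat.card_eq_of_bijective (α := G ⧸ Cn x) (β := Tt x)
    (fun c => Quotient.liftOn' c (fun g => (⟨⁅g, x⁆, g, rfl⟩ : Tt x)) ?_) ⟨?_, ?_⟩).symm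
  · intro a b hab
    rw [QuotientGroup.leftRel_apply] at hab
    exact Subtype.ext (comm_eq_of (mem_Cn.1 hab))
  · intro a b
    induction a using QuotientGroup.induction_on with | H a => ?_
    induction b using QuotientGroup.induction_on with | H b => ?_
    intro hab
    have hab' : ⁅a, x⁆ = ⁅b, x⁆ := congrArg Subtype.val hab
    rw [QuotientGroup.eq]
    exact mem_Cn.2 (comm_eq_iff hab')
  · rintro ⟨_, g, rfl⟩
    exact ⟨(g : G ⧸ Cn x), rfl⟩

theorem card_Tq (I : Iso r x) (hq : q.Prime) : Nat.card (Tq q x) ≤ q ^ (Cn x).index.factorization q := by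
  haveI := Fact.mk hq
  by_cases h : ∃ g0 : G, pel q ⁅g0, x⁆ ∧ ⁅g0, x⁆ ≠ 1
  swap
  · push Not at h
    haveI : Subsingleton (Tq q x) := ⟨by
      rintro ⟨_, g, rfl, hg⟩ ⟨_, g', rfl, hg'⟩
      apply Subtype.ext
      simp only
      rw [h g hg, h g' hg']⟩
    exact (Finite.card_le_one_iff_subsingleton.2 this).trans (Nat.one_le_pow _ _ hq.pos)
  obtain ⟨g0, h0, h01⟩ := h
  obtain ⟨⟨P, hP⟩, h2⟩ := TqW I hq h0 h01
  have hle : Nat.card (Tq q x) ≤ (Cn x).relIndex P := by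
    refine Nat.card_le_card_of_surjective (α := P ⧸ (Cn x).subgroupOf P) (β := Tq q x)
      (fun c => Quotient.liftOn' c (fun g => (⟨⁅(g : G), x⁆, g, rfl, pel_of_mem hP.1 (nm_comm hP.2.1 g.2)⟩ : Tq q x)) ?_) ?_
    · intro a b hab
      rw [QuotientGroup.leftRel_apply] at hab
      exact Subtype.ext (comm_eq_of (mem_Cn.1 (by simpa [mem_subgroupOf] using hab)))
    · rintro ⟨_, g, rfl, hg⟩
      obtain ⟨d, hd, h3⟩ := I.dex_mem hP.2.1 (Wq_le hP (h2 g hg))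
      exact ⟨((⟨d, hd⟩ : P) : P ⧸ (Cn x).subgroupOf P), Subtype.ext h3⟩
  refine hle.trans (Nat.le_of_dvd (pow_pos hq.pos _) ?_)
  obtain ⟨n, hn⟩ := (hP.1.index ((Cn x).subgroupOf P))
  have hn : (Cn x).relIndex P = q ^ n := hn
  have hcop : q.Coprime ((P ⊓ Cn x).relIndex (Cn x)) := by
    rw [Nat.Prime.coprime_iff_not_dvd hq]
    obtain ⟨R⟩ : Nonempty (Sylow q (Cn x)) := inferInstance
    let R' : Subgroup G := (R : Subgroup (Cn x)).map (Cn x).subtype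
    have hR'C : R' ≤ Cn x := map_subtype_le _
    obtain ⟨c, hc, hcR⟩ := I.S3 hq hP (B := R') (R.2.map _) (by
      apply nm_of
      intro b hb
      rw [(mem_Cn.1 (hR'C hb)).symm.eq, mul_inv_cancel_right]; exact hb)
    have hS : IsPGroup q ((P ⊓ Cn x).subgroupOf (Cn x)) := (hP.1.to_le inf_le_left).comap_subtype
    have hcard : Nat.card R ≤ Nat.card ((P ⊓ Cn x).subgroupOf (Cn x)) := by
      refine Nat.card_le_card_of_injective (fun b : R => (⟨⟨c * (b : Cn x) * c⁻¹,
        Subgroup.mul_mem _ (Subgroup.mul_mem _ (mem_Cn.2 hc) (b : Cn x).2) (Subgroup.inv_mem _ (mem_Cn.2 hc))⟩, ?_⟩ :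
          (P ⊓ Cn x).subgroupOf (Cn x))) ?_
      · rw [mem_subgroupOf]
        exact ⟨hcR _ (mem_map_of_mem _ b.2), Subgroup.mul_mem _ (Subgroup.mul_mem _ (mem_Cn.2 hc) (b : Cn x).2) (Subgroup.inv_mem _ (mem_Cn.2 hc))⟩
      · intro a b hab
        have h5 := congrArg (fun z : ((P ⊓ Cn x).subgroupOf (Cn x)) => ((z : Cn x) : G)) hab
        exact Subtype.ext (Subtype.ext (mul_left_cancel (mul_right_cancel h5)))
    obtain ⟨R1, hR1⟩ := hS.exists_le_sylow
    have h6 : (P ⊓ Cn x).subgroupOf (Cn x) = R1 := by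
      apply Subgroup.eq_of_le_of_card_ge hR1
      rw [Sylow.card_eq_multiplicity R1, ← Sylow.card_eq_multiplicity R]
      exact hcard
    have := R1.not_dvd_index
    rw [← h6] at this
    exact this
  have e1 := relIndex_mul_index (inf_le_left : P ⊓ Cn x ≤ P)
  have e2 := relIndex_mul_index (inf_le_right : P ⊓ Cn x ≤ Cn x)
  rw [inf_relIndex_left] at e1
  have h7 : (Cn x).relIndex P ∣ (P ⊓ Cn x).relIndex (Cn x) * (Cn x).index := by
    rw [e2, ← e1]; exact Dvd.intro _ rfl
  rw [hn] at h7 ⊢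
  have h8 := (hcop.pow_left n).dvd_of_dvd_mul_left h7
  exact pow_dvd_pow _ ((hq.pow_dvd_iff_le_factorization index_ne_zero_of_finite).1 h8)

theorem eq_of_qp {t t' : G} (h : ∀ q : ℕ, q.Prime → qp q t = qp q t') : t = t' := by
  have h1 : t ∈ zpowers t' := mem_of_qp fun l hl => by rw [h l hl]; exact qp_mem (mem_zpowers _)
  have h2 : Commute t t' := by
    obtain ⟨k, rfl⟩ := h1
    exact (Commute.refl t').zpow_left k
  have h3 : t⁻¹ * t' ∈ (⊥ : Subgroup G) := mem_of_qp fun l hl => by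
    rw [qp_mul h2.inv_left]
    have : qp l t⁻¹ = (qp l t)⁻¹ := by simp [qp]
    rw [this, h l hl, inv_mul_cancel]; exact one_mem _
  exact inv_mul_eq_one.1 (mem_bot.1 h3)

theorem pel_not_dvd (hq : q.Prime) (h : ¬ q ∣ Nat.card G) {g : G} (hg : pel q g) : g = 1 := by
  rw [pel_iff hq, Nat.factorization_eq_zero_of_not_dvd h] at hg
  simpa using hg

theorem Tcomm (I : Iso r x) (hq : q.Prime) {l : ℕ} (hl : l.Prime) (hlq : q ≠ l) {g h : G}
    (hg : pel q ⁅g, x⁆) (hh : pel l ⁅h, x⁆) : Commute ⁅g, x⁆ ⁅h, x⁆ := by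
  classical
  let S := (Nat.card G).primeFactors
  have hS : ∀ p : S, (p : ℕ).Prime := fun p => Nat.prime_of_mem_primeFactors p.2
  by_cases hqS : q ∈ S
  swap
  · rw [pel_not_dvd hq (fun hd => hqS (Nat.mem_primeFactors.2 ⟨hq, hd, Nat.card_pos.ne'⟩)) hg]
    exact Commute.one_left _
  by_cases hlS : l ∈ S
  swap
  · rw [pel_not_dvd hl (fun hd => hlS (Nat.mem_primeFactors.2 ⟨hl, hd, Nat.card_pos.ne'⟩)) hh]
    exact Commute.one_right _
  have hA3 : ∀ p : S, ∀ g : G, ∃ d : G, qp (p : ℕ) ⁅g, x⁆ = ⁅d, x⁆ ∧ pel (p : ℕ) (qp (p : ℕ) ⁅g, x⁆) := by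
    intro p g
    by_cases hpr : (p : ℕ) = r
    · refine ⟨1, ?_, pel_qp (hS p) _⟩
      rw [hpr, (ppel_iff I.hr).1 (I.hT g)]; simp
    · obtain ⟨d, hd⟩ := A3 I.hI I.hr I.hx (hS p) hpr g
      exact ⟨d, hd.symm, pel_qp (hS p) _⟩
  let F : Tt x → (∀ p : S, Tq (p : ℕ) x) := fun t p => ⟨qp (p : ℕ) t.1, by
    obtain ⟨_, g, rfl⟩ := t
    exact hA3 p g⟩
  have hF : Function.Injective F := by
    intro t t' htt
    apply Subtype.ext
    apply eq_of_qp
    intro p hp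
    by_cases hpS : p ∈ S
    · exact congrArg Subtype.val (congrFun htt ⟨p, hpS⟩)
    · have hd : ¬ p ∣ Nat.card G := fun hd => hpS (Nat.mem_primeFactors.2 ⟨hp, hd, Nat.card_pos.ne'⟩)
      rw [pel_not_dvd hp hd (pel_qp hp _), pel_not_dvd hp hd (pel_qp hp _)]
  have hcard : Nat.card (∀ p : S, Tq (p : ℕ) x) ≤ Nat.card (Tt x) := by
    rw [Nat.card_pi, card_Tt]
    calc ∏ p : S, Nat.card (Tq (p : ℕ) x) ≤ ∏ p : S, (p : ℕ) ^ (Cn x).index.factorization p :=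
          Finset.prod_le_prod' fun p _ => card_Tq I (hS p)
      _ = ∏ p ∈ S, p ^ (Cn x).index.factorization p :=
          Finset.prod_coe_sort S (fun p => p ^ (Cn x).index.factorization p)
      _ = (Cn x).index.factorization.prod (fun p k => p ^ k) := by
          rw [Finsupp.prod_of_support_subset _ _ _ (by simp)]
          rw [Nat.support_factorization]
          exact Nat.primeFactors_mono (index_dvd_card _) Nat.card_pos.ne'
      _ = (Cn x).index := Nat.prod_factorization_pow_eq_self index_ne_zero_of_finite
  obtain ⟨t, ht⟩ := (hF.bijective_of_nat_card_le hcard).2 (fun p =>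
    if h1 : (p : ℕ) = q then ⟨⁅g, x⁆, g, rfl, by rw [h1]; exact hg⟩ else
    if h2 : (p : ℕ) = l then ⟨⁅h, x⁆, h, rfl, by rw [h2]; exact hh⟩ else
    ⟨1, 1, by simp, pel_one⟩)
  have e1 := congrArg Subtype.val (congrFun ht ⟨q, hqS⟩)
  have e2 := congrArg Subtype.val (congrFun ht ⟨l, hlS⟩)
  simp only [F] at e1 e2
  have e1' : qp q t.1 = ⁅g, x⁆ := by rw [e1, dif_pos trivial]
  have e2' : qp l t.1 = ⁅h, x⁆ := by rw [e2, dif_neg (Ne.symm hlq), dif_pos trivial]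
  rw [← e1', ← e2']
  exact qp_comm (qp_comm (Commute.refl _)).symm

theorem Iso.false (I : Iso r x) : False := by
  have hxC : x ∈ Cn x := mem_Cn.2 (Commute.refl x)
  have hK : ∀ q : ℕ, q.Prime → ∀ g : G, pel q ⁅g, x⁆ → ⁅g, x⁆ = 1 := by
    intro q hq g0 h0
    have hCK : Cn x ≤ nm (Kq q x) := fun c hc => Kq_nm q (mem_Cn.1 hc)
    have hT : ∀ g : G, ⁅g, x⁆ ∈ nm (Kq q x) := by
      intro g
      apply mem_of_qp
      intro l hl
      by_cases hlr : l = r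
      · subst hlr; rw [(ppel_iff hl).1 (I.hT g)]; exact Subgroup.one_mem _
      obtain ⟨d, hd⟩ := A3 I.hI I.hr I.hx hl hlr g
      have hdl : pel l ⁅d, x⁆ := by rw [hd]; exact pel_qp hl _
      rw [← hd]
      by_cases hlq : l = q
      · subst hlq
        exact le_nm _ (subset_closure ⟨d, rfl, hdl⟩)
      · apply nm_closure
        rintro _ ⟨g', rfl, hg'⟩
        rw [(Tcomm I hl hq hlq hdl hg').eq, mul_inv_cancel_right]
        exact subset_closure ⟨g', rfl, hg'⟩
    have hn : (Kq q x).Normal := by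
      apply normal_of_nm
      intro g
      obtain ⟨d, hd, h2⟩ := I.dex g
      have : g = d * (d⁻¹ * g) := by group
      rw [this]
      exact Subgroup.mul_mem _ (Dc_le (hCK hxC) (hT g) hd) (hCK (mem_Cn.2 (comm_eq_iff h2)))
    have hb := I.hC.1 q hq _ hn (Kq_pgroup I hq)
    have : ⁅g0, x⁆ ∈ Kq q x := subset_closure ⟨g0, rfl, h0⟩
    rw [hb] at this
    exact mem_bot.1 this
  apply I.C_ne
  rw [eq_top_iff]
  intro g _
  refine mem_Cn.2 (commutatorElement_eq_one_iff_commute.1 (mem_bot.1 (mem_of_qp (H := (⊥ : Subgroup G)) ?_)))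
  intro l hl
  by_cases hlr : l = r
  · subst hlr; rw [(ppel_iff hl).1 (I.hT g)]; exact Subgroup.one_mem _
  obtain ⟨d, hd⟩ := A3 I.hI I.hr I.hx hl hlr g
  rw [← hd]
  exact hK l hl d (by rw [hd]; exact pel_qp hl _)

end I5

theorem Crit.false (hC : Crit G) {x : G} (hI : InI x) {r : ℕ} (hr : r.Prime) (hx : pel r x) (hx1 : x ≠ 1) : False :=
  (Iso.of hC hI hr hx hx1).false

def CM (N : Subgroup G) (b : G) : Subgroup G where
  carrier := {a | a ∈ nm N ∧ ⁅a, b⁆ ∈ N}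
  one_mem' := ⟨Subgroup.one_mem _, by simp [N.one_mem]⟩
  mul_mem' := by
    rintro a a' ⟨h1, h2⟩ ⟨h3, h4⟩
    refine ⟨Subgroup.mul_mem _ h1 h3, ?_⟩
    have : ⁅a * a', b⁆ = (a * ⁅a', b⁆ * a⁻¹) * ⁅a, b⁆ := by simp only [commutatorElement_def]; group
    rw [this]
    exact N.mul_mem (nm_conj h1 h4) h2
  inv_mem' := by
    rintro a ⟨h1, h2⟩
    refine ⟨Subgroup.inv_mem _ h1, ?_⟩
    have : ⁅a⁻¹, b⁆ = a⁻¹ * ⁅a, b⁆⁻¹ * a := by simp only [commutatorElement_def]; group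
    rw [this]
    exact nm_conj' h1 (N.inv_mem h2)

theorem comm_gen {N : Subgroup G} {x y : G} (hx : x ∈ nm N) (hy : y ∈ nm N) (h : ⁅y, x⁆ ∈ N) :
    ⁅closure {x, y}, closure {x, y}⁆ ≤ N := by
  have h' : ⁅x, y⁆ ∈ N := by rw [← commutatorElement_inv]; exact N.inv_mem h
  have key : ∀ b : G, ⁅x, b⁆ ∈ N → ⁅y, b⁆ ∈ N → ∀ a ∈ closure {x, y}, ⁅a, b⁆ ∈ N := by
    intro b h1 h2 a ha
    have : closure {x, y} ≤ CM N b := by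
      rw [closure_le]
      rintro z (rfl | rfl)
      · exact ⟨hx, h1⟩
      · exact ⟨hy, h2⟩
    exact (this ha).2
  have kx := key x (by simp [N.one_mem]) h
  have ky := key y h' (by simp [N.one_mem])
  rw [commutator_le]
  intro a ha b hb
  refine key b ?_ ?_ a ha
  · rw [← commutatorElement_inv]; exact N.inv_mem (kx b hb)
  · rw [← commutatorElement_inv]; exact N.inv_mem (ky b hb)

abbrev Mx (x y : G) : Subgroup G := ⁅closure {x, y}, closure {x, y}⁆

theorem Mx_nm {x y z : G} (hz : z ∈ closure {x, y}) : z ∈ nm (Mx x y) := by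
  apply nm_of
  intro b hb
  have h : Mx x y ≤ closure {x, y} := by
    rw [Mx, commutator_le]
    intro a ha b hb
    rw [commutatorElement_def]
    exact Subgroup.mul_mem _ (Subgroup.mul_mem _ (Subgroup.mul_mem _ ha hb) (Subgroup.inv_mem _ ha)) (Subgroup.inv_mem _ hb)
  have : z * b * z⁻¹ = ⁅z, b⁆ * b := conj_eq_comm z b
  rw [this]
  exact Subgroup.mul_mem _ (commutator_mem_commutator hz (h hb)) hb

theorem InI.nil {x : G} (h : InI x) (y : G) : Nil (Mx x y) := by
  obtain ⟨N, hN, h1, h2, h3, -⟩ := h.get y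
  exact hN.mono (comm_gen h1 h2 h3)

theorem comm_triv {a b : G} (h1 : Commute ⁅a, b⁆ a) (h2 : Commute ⁅a, b⁆ b) (h : (orderOf a).Coprime (orderOf b)) :
    ⁅a, b⁆ = 1 := by
  set c := ⁅a, b⁆ with hc
  have e1 : c ^ orderOf b = 1 := by
    have : (a * b * a⁻¹) ^ orderOf b = c ^ orderOf b * b ^ orderOf b := by
      rw [conj_eq_comm, ← hc, h2.mul_pow]
    rw [conj_pow, pow_orderOf_eq_one] at this
    simpa using this.symm
  have e2 : c ^ orderOf a = 1 := by
    have e : b * a⁻¹ * b⁻¹ = a⁻¹ * c := by rw [hc, commutatorElement_def]; group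
    have : (b * a⁻¹ * b⁻¹) ^ orderOf a = a⁻¹ ^ orderOf a * c ^ orderOf a := by
      rw [e, (h1.symm.inv_left).mul_pow]
    rw [conj_pow, inv_pow, pow_orderOf_eq_one] at this
    simpa using this.symm
  have := Nat.dvd_gcd (orderOf_dvd_of_pow_eq_one e2) (orderOf_dvd_of_pow_eq_one e1)
  rw [h] at this
  exact orderOf_eq_one_iff.1 (Nat.dvd_one.1 this)

def Ecen (N U : Subgroup G) [hN : N.Normal] : Subgroup G where
  carrier := {g | ∀ n ∈ N, ⁅g, n⁆ ∈ U}
  one_mem' := by intro n hn; simp [U.one_mem]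
  mul_mem' := by
    intro g g' h h' n hn
    have : ⁅g * g', n⁆ = ⁅g, g' * n * g'⁻¹⁆ * ⁅g', n⁆ := by simp only [commutatorElement_def]; group
    rw [this]
    exact U.mul_mem (h _ (hN.conj_mem n hn g')) (h' n hn)
  inv_mem' := by
    intro g h n hn
    have : ⁅g⁻¹, n⁆ = ⁅g, g⁻¹ * n * g⁻¹⁻¹⁆⁻¹ := by simp only [commutatorElement_def]; group
    rw [this]
    exact U.inv_mem (h _ (hN.conj_mem n hn g⁻¹))

section star
variable {p q : ℕ} {N : Subgroup G} {x : G}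

theorem star1 (hp : p.Prime) [hNn : N.Normal] (hN : IsPGroup p N) (hI : InI x) (hq : q.Prime) (hqp : q ≠ p) (y : G)
    {w : G} (hw : w ∈ N) : ∃ n ∈ N, ∀ l ∈ (hI.nil (w * y)).Op hq, n * l * n⁻¹ ∈ (hI.nil y).Op hq := by
  have hnm : ∀ g, g ∈ nm N := fun g => nm_of fun b hb => hNn.conj_mem b hb g
  refine SC hq ((hI.nil y).Op_isPGroup hq) (coprime_pgroup hp hq (Ne.symm hqp) hN) (fun g _ => hnm g)
    ((hI.nil (w * y)).Op_isPGroup hq) ?_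
  have hM : Mx x (w * y) ≤ N ⊔ Mx x y := by
    have h1 : (Mx x (w * y)).map (QuotientGroup.mk' N) = (Mx x y).map (QuotientGroup.mk' N) := by
      have e : QuotientGroup.mk' N (w * y) = QuotientGroup.mk' N y := by
        rw [map_mul, (QuotientGroup.eq_one_iff w).2 hw |> (fun h => (h : QuotientGroup.mk' N w = 1)), one_mul]
      rw [Mx, Mx, map_commutator, map_commutator, MonoidHom.map_closure, MonoidHom.map_closure, Set.image_pair,
        Set.image_pair, e]
    calc Mx x (w * y) ≤ ((Mx x (w * y)).map (QuotientGroup.mk' N)).comap (QuotientGroup.mk' N) := le_comap_map _ _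
      _ = N ⊔ Mx x y := by rw [h1, comap_map_eq, QuotientGroup.ker_mk', sup_comm]
  rintro a ⟨haM, haq⟩
  obtain ⟨n, hn, m, hm, e⟩ := mem_sup_nm (fun g _ => hnm g) (hM haM)
  have h2 := pow_mul_inv_mem hn (hnm m) (ex G q)
  rw [← e] at h2
  have h3 : a * (qp q m)⁻¹ ∈ N := by
    have e3 : a ^ ex G q = a := qp_of_pel hq haq
    rw [e3] at h2; exact h2
  have : a = a * (qp q m)⁻¹ * qp q m := by group
  rw [this]
  exact Subgroup.mul_mem _ ((le_sup_left : N ≤ _) h3) ((le_sup_right : (hI.nil y).Op hq ≤ _) ⟨qp_mem hm, pel_qp hq _⟩)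

theorem star2 (hp : p.Prime) [hNn : N.Normal] (hN : IsPGroup p N) (hI : InI x) (hq : q.Prime) (hqp : q ≠ p) (y : G)
    {w : G} (hw : w ∈ N) : ∃ n ∈ N, ∀ l, l ∈ (hI.nil (w * y)).Op hq ↔ n * l * n⁻¹ ∈ (hI.nil y).Op hq := by
  obtain ⟨n, hn, h1⟩ := star1 hp hN hI hq hqp y hw
  obtain ⟨n', hn', h2⟩ := star1 hp hN hI hq hqp (w * y) (N.inv_mem hw)
  rw [inv_mul_cancel_left] at h2
  refine ⟨n, hn, fun l => ⟨h1 l, fun hl => ?_⟩⟩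
  have hc : Nat.card ((hI.nil y).Op hq) ≤ Nat.card ((hI.nil (w * y)).Op hq) :=
    Nat.card_le_card_of_injective (fun b : (hI.nil y).Op hq => (⟨n' * b * n'⁻¹, h2 b b.2⟩ : (hI.nil (w * y)).Op hq)) (by
      intro a b hab
      exact Subtype.ext (mul_left_cancel (mul_right_cancel (congrArg Subtype.val hab))))
  have hinj : Function.Injective (fun b : (hI.nil (w * y)).Op hq => (⟨n * b * n⁻¹, h1 b b.2⟩ : (hI.nil y).Op hq)) := by
    intro a b hab
    exact Subtype.ext (mul_left_cancel (mul_right_cancel (congrArg Subtype.val hab)))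
  obtain ⟨b, hb⟩ := (hinj.bijective_of_nat_card_le hc).2 ⟨_, hl⟩
  have : (b : G) = l := mul_left_cancel (mul_right_cancel (congrArg Subtype.val hb))
  rw [← this]; exact b.2

theorem star (hp : p.Prime) [hNn : N.Normal] (hN : IsPGroup p N) (hab : ∀ a ∈ N, ∀ b ∈ N, Commute a b) (hI : InI x)
    (hq : q.Prime) (hqp : q ≠ p) (y : G) {s : G} (hs : s ∈ (hI.nil y).Op hq) {n : G} (hn : n ∈ N) : Commute s n := by
  set S := (hI.nil y).Op hq with hS
  have hSp : IsPGroup q S := (hI.nil y).Op_isPGroup hq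
  have hHS : ∀ z ∈ closure {x, y}, z ∈ nm S := fun z hz => (hI.nil y).nm_Op hq (Mx_nm hz)
  have hxS : x ∈ nm S := hHS x (subset_closure (by simp))
  have hyS : y ∈ nm S := hHS y (subset_closure (by simp))
  let U : Subgroup G := N ⊓ nm S
  have hSU : ∀ s ∈ S, ∀ u ∈ U, Commute s u := by
    intro s hs u hu
    have h1 : ⁅s, u⁆ ∈ S := nm_comm hu.2 hs
    have h2 : ⁅s, u⁆ ∈ N := by
      rw [commutatorElement_def]
      exact N.mul_mem (hNn.conj_mem u hu.1 s) (N.inv_mem hu.1)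
    exact commutatorElement_eq_one_iff_commute.1 (pel_pel hp hq (Ne.symm hqp) (pel_of_mem hN h2) (pel_of_mem hSp h1))
  have hHU : ∀ z ∈ nm S, z ∈ nm U := by
    intro z hz
    apply nm_of
    intro u hu
    exact ⟨hNn.conj_mem u hu.1 z, Subgroup.mul_mem _ (Subgroup.mul_mem _ hz hu.2) (Subgroup.inv_mem _ hz)⟩
  -- choose conjugating elements
  have key : ∀ w : N, ∃ n : G, n ∈ N ∧ ⁅n, x⁆ ∈ U ∧ n * w * (y * n⁻¹ * y⁻¹) ∈ U := by
    intro w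
    obtain ⟨n, hn, h⟩ := star2 hp hN hI hq hqp y w.2
    have hz : ∀ z ∈ closure {x, (w : G) * y}, n * z * n⁻¹ ∈ nm S := by
      intro z hz
      apply nm_of
      intro b hb
      have hz' := (hI.nil (w * y)).nm_Op hq (Mx_nm hz)
      have h1 : n⁻¹ * b * n ∈ (hI.nil (w * y)).Op hq := by
        rw [h]
        have : n * (n⁻¹ * b * n) * n⁻¹ = b := by group
        rw [this]; exact hb
      have h2 := (h _).1 (nm_conj hz' h1)
      have : n * z * n⁻¹ * b * (n * z * n⁻¹)⁻¹ = n * (z * (n⁻¹ * b * n) * z⁻¹) * n⁻¹ := by group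
      rw [this]; exact h2
    refine ⟨n, hn, ⟨?_, ?_⟩, ?_, ?_⟩
    · have : ⁅n, x⁆ = n * (x * n⁻¹ * x⁻¹) := by rw [commutatorElement_def]; group
      rw [this]
      exact N.mul_mem hn (hNn.conj_mem _ (N.inv_mem hn) x)
    · rw [commutatorElement_def]
      exact Subgroup.mul_mem _ (hz x (subset_closure (by simp))) (Subgroup.inv_mem _ hxS)
    · exact N.mul_mem (N.mul_mem hn w.2) (hNn.conj_mem _ (N.inv_mem hn) y)
    · have : n * w * (y * n⁻¹ * y⁻¹) = (n * (w * y) * n⁻¹) * y⁻¹ := by group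
      rw [this]
      exact Subgroup.mul_mem _ (hz _ (subset_closure (by simp))) (Subgroup.inv_mem _ hyS)
  choose f hf1 hf2 hf3 using key
  let A : Set G := {n | n ∈ N ∧ ⁅n, x⁆ ∈ U}
  have hUN : ∀ u : U, (u : G) ∈ N := fun u => u.2.1
  let F : N × U → A × U := fun z => (⟨z.2 * f z.1, by
      refine ⟨N.mul_mem (hUN z.2) (hf1 z.1), ?_⟩
      have : ⁅(z.2 : G) * f z.1, x⁆ = ((z.2 : G) * ⁅f z.1, x⁆ * (z.2 : G)⁻¹) * ⁅(z.2 : G), x⁆ := by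
        simp only [commutatorElement_def]; group
      rw [this]
      exact U.mul_mem (U.mul_mem (U.mul_mem z.2.2 (hf2 z.1)) (U.inv_mem z.2.2)) (nm_comm (hHU x hxS) z.2.2)⟩,
    ⟨z.2 * (f z.1 * z.1 * (y * (f z.1)⁻¹ * y⁻¹)) * (y * (z.2 : G)⁻¹ * y⁻¹), 
      U.mul_mem (U.mul_mem z.2.2 (hf3 z.1)) (nm_conj (hHU y hyS) (U.inv_mem z.2.2))⟩)
  have hF : Function.Injective F := by
    rintro ⟨w, v⟩ ⟨w', v'⟩ h
    have h1 : (v : G) * f w = v' * f w' := congrArg (fun z => (z.1 : G)) h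
    have h2 : (v : G) * (f w * w * (y * (f w)⁻¹ * y⁻¹)) * (y * (v : G)⁻¹ * y⁻¹) = 
      (v' : G) * (f w' * w' * (y * (f w')⁻¹ * y⁻¹)) * (y * (v' : G)⁻¹ * y⁻¹) := congrArg (fun z => (z.2 : G)) h
    have e : ∀ v w f : G, v * (f * w * (y * f⁻¹ * y⁻¹)) * (y * v⁻¹ * y⁻¹) = (v * f) * w * (y * (v * f)⁻¹ * y⁻¹) := by
      intro v w f; group
    rw [e, e, h1] at h2
    have hw : w = w' := Subtype.ext (mul_left_cancel (mul_right_cancel h2))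
    subst hw
    rw [Subtype.ext (mul_right_cancel h1)]
  have hcard := Nat.card_le_card_of_injective F hF
  rw [Nat.card_prod, Nat.card_prod] at hcard
  have hcard2 : Nat.card N ≤ Nat.card A := Nat.le_of_mul_le_mul_right hcard Nat.card_pos
  have hAN : A = (N : Set G) := by
    apply Set.eq_of_subset_of_ncard_le (fun a ha => ha.1) _ (Set.toFinite _)
    exact hcard2
  have hxE : x ∈ Ecen N U := by
    intro n hn
    have : n ∈ A := by rw [hAN]; exact hn
    rw [← commutatorElement_inv]
    exact U.inv_mem this.2
  have hHE : ∀ z ∈ nm S, z ∈ nm (Ecen N U) := by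
    intro z hz
    apply nm_of
    intro g hg n hn
    have : ⁅z * g * z⁻¹, n⁆ = z * ⁅g, z⁻¹ * n * z⁻¹⁻¹⁆ * z⁻¹ := by simp only [commutatorElement_def]; group
    rw [this]
    exact nm_conj (hHU z hz) (hg _ (hNn.conj_mem n hn _))
  have hME : Mx x y ≤ Ecen N U := comm_gen (hHE x hxS) (hHE y hyS) (nm_comm' (hHE y hyS) hxE)
  have hu : ⁅s, n⁆ ∈ U := hME hs.1 n hn
  refine commutatorElement_eq_one_iff_commute.1 (comm_triv (hSU s hs _ hu).symm (hab _ hu.1 _ hn) ?_)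
  exact coprime_order_of hs.2 ((pel_of_mem hN hn).ppel_of_ne hp hq (Ne.symm hqp))

end star

theorem nil_of_parts {N : Subgroup G}
    (h : ∀ a ∈ N, ∀ b ∈ N, ∀ l : ℕ, l.Prime → ∀ m : ℕ, m.Prime → l ≠ m → Commute (qp l a) (qp m b)) : Nil N := by
  intro a ha b hb hab
  have key : ∀ l : ℕ, l.Prime → ∀ m : ℕ, m.Prime → Commute (qp l a) (qp m b) := by
    intro l hl m hm
    by_cases hlm : l = m
    · subst hlm
      rcases Nat.coprime_or_dvd_of_prime hl (orderOf a) with h1 | h1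
      · rw [(ppel_iff hl).1 h1.symm]; exact Commute.one_left _
      · have : ppel l b := Nat.Coprime.coprime_dvd_right h1 hab.symm
        rw [(ppel_iff hl).1 this]; exact Commute.one_right _
    · exact h a ha b hb l hl m hm hlm
  have h1 : ∀ m : ℕ, m.Prime → a ∈ centralizer {qp m b} := by
    intro m hm
    apply mem_of_qp
    intro l hl
    rw [mem_centralizer_singleton_iff]
    exact (key l hl m hm).eq
  have h2 : b ∈ centralizer {a} := by
    apply mem_of_qp
    intro m hm
    have := h1 m hm
    rw [mem_centralizer_singleton_iff] at this ⊢
    exact this.symm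
  rw [mem_centralizer_singleton_iff] at h2
  exact h2.symm

theorem comm_mem_of_nm {A B : Subgroup G} (hA : ∀ g, g ∈ nm A) (hB : ∀ g, g ∈ nm B) {a b : G} (ha : a ∈ A)
    (hb : b ∈ B) : ⁅a, b⁆ ∈ A ∧ ⁅a, b⁆ ∈ B := ⟨nm_comm (hA b) ha, nm_comm' (hB a) hb⟩

theorem Nil.fitting {N M : Subgroup G} (hN : Nil N) (hM : Nil M) (hNn : ∀ g, g ∈ nm N) (hMn : ∀ g, g ∈ nm M) :
    Nil (N ⊔ M) := by
  have hP : ∀ l (hl : l.Prime), (∀ g, g ∈ nm (hN.Op hl ⊔ hM.Op hl)) ∧ IsPGroup l (hN.Op hl ⊔ hM.Op hl : Subgroup G) := by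
    intro l hl
    have h1 : ∀ g, g ∈ nm (hN.Op hl) := fun g => hN.nm_Op hl (hNn g)
    have h2 : ∀ g, g ∈ nm (hM.Op hl) := fun g => hM.nm_Op hl (hMn g)
    refine ⟨fun g => ?_, sup_isPGroup (hN.Op_isPGroup hl) (hM.Op_isPGroup hl) (fun g _ => h1 g)⟩
    haveI := normal_of_nm h1
    haveI := normal_of_nm h2
    exact nm_of fun b hb => (inferInstance : (hN.Op hl ⊔ hM.Op hl).Normal).conj_mem b hb g
  have key : ∀ a ∈ N ⊔ M, ∀ l (hl : l.Prime), qp l a ∈ hN.Op hl ⊔ hM.Op hl := by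
    intro a ha l hl
    obtain ⟨n, hn, m, hm, e⟩ := mem_sup_nm (fun g _ => hNn g) ha
    have h2 := pow_mul_inv_mem hn (hNn m) (ex G l)
    rw [← e] at h2
    change qp l a * (qp l m)⁻¹ ∈ N at h2
    set b := qp l m with hb
    have hbM : b ∈ hM.Op hl := ⟨qp_mem hm, pel_qp hl _⟩
    set c := qp l a * b⁻¹ with hc
    have e1 : qp l a = qr l c * (qp l c * b) := by rw [← mul_assoc, qr_mul_qp, hc]; group
    have hr : qr l c ∈ hN.Opp hl := ⟨qr_mem h2, ppel_qr hl _⟩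
    have c1 : Commute (qr l c) (qp l c) := (ND.qp_comm (ND.qr_comm (Commute.refl c)).symm).symm
    have c2 : Commute (qr l c) b := by
      obtain ⟨h3, h4⟩ := comm_mem_of_nm (fun g => hN.nm_Opp hl (hNn g)) (fun g => hM.nm_Op hl (hMn g)) hr hbM
      exact commutatorElement_eq_one_iff_commute.1 (pel_ppel hl h4.2 h3.2)
    have hmem : qp l c * b ∈ hN.Op hl ⊔ hM.Op hl :=
      Subgroup.mul_mem _ ((le_sup_left : hN.Op hl ≤ _) ⟨qp_mem h2, pel_qp hl _⟩) ((le_sup_right : hM.Op hl ≤ _) hbM)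
    have e2 : qp l (qp l a) = qp l a := qp_of_pel hl (pel_qp hl a)
    rw [← e2, e1, qp_mul (c1.mul_right c2), (ppel_iff hl).1 hr.2, one_mul]
    exact qp_mem hmem
  apply nil_of_parts
  intro a ha b hb l hl m hm hlm
  obtain ⟨h3, h4⟩ := comm_mem_of_nm (hP l hl).1 (hP m hm).1 (key a ha l hl) (key b hb m hm)
  exact commutatorElement_eq_one_iff_commute.1
    (pel_pel hl hm hlm (pel_of_mem (hP l hl).2 h3) (pel_of_mem (hP m hm).2 h4))

theorem nil_bot : Nil (⊥ : Subgroup G) := by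
  intro a ha b hb _
  rw [mem_bot.1 ha]; exact Commute.one_left _

theorem Gd_one (H : Subgroup G) : Gd (1 : G) H :=
  ⟨⊥, nil_bot, bot_le, fun g _ => nm_of (by simp), fun h _ => by simp⟩

theorem Gd.mul {x y : G} (h : Gd x ⊤) (h' : Gd y ⊤) : Gd (x * y) ⊤ := by
  obtain ⟨N, h1, -, h3, h4⟩ := h
  obtain ⟨M, k1, -, k3, k4⟩ := h'
  refine ⟨N ⊔ M, h1.fitting k1 (fun g => h3 trivial) (fun g => k3 trivial), le_top, ?_, ?_⟩
  · intro g _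
    haveI := normal_of_nm (fun g => h3 (trivial : g ∈ (⊤ : Subgroup G)))
    haveI := normal_of_nm (fun g => k3 (trivial : g ∈ (⊤ : Subgroup G)))
    exact nm_of fun b hb => (inferInstance : (N ⊔ M).Normal).conj_mem b hb g
  · intro g _
    have : ⁅g, x * y⁆ = ⁅g, x⁆ * (x * ⁅g, y⁆ * x⁻¹) := by simp only [commutatorElement_def]; group
    rw [this]
    exact Subgroup.mul_mem _ ((le_sup_left : N ≤ _) (h4 g trivial))
      ((le_sup_right : M ≤ _) (nm_conj (k3 trivial) (k4 g trivial)))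

theorem exists_min_abelian {p : ℕ} (hp : p.Prime) {N0 : Subgroup G} (hn : N0.Normal) (hN0 : IsPGroup p N0)
    (hne : N0 ≠ ⊥) : ∃ N : Subgroup G, N.Normal ∧ N ≠ ⊥ ∧ IsPGroup p N ∧ (∀ a ∈ N, ∀ b ∈ N, Commute a b) ∧
      ∀ F : Subgroup G, F.Normal → F ≠ ⊥ → F ≤ N → F = N := by
  haveI := Fact.mk hp
  let S : Set (Subgroup G) := {N | N.Normal ∧ N ≠ ⊥ ∧ IsPGroup p N ∧ (∀ a ∈ N, ∀ b ∈ N, Commute a b)}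
  have hS : S.Nonempty := by
    refine ⟨(center N0).map N0.subtype, ?_, ?_, ?_, ?_⟩
    · haveI := hn
      exact ConjAct.normal_of_characteristic_of_normal
    · haveI : Nontrivial N0 := (nontrivial_iff_ne_bot N0).2 hne
      haveI := hN0.center_nontrivial
      intro h
      rw [map_eq_bot_iff_of_injective _ N0.subtype_injective] at h
      exact (nontrivial_iff_ne_bot _).1 this h
    · exact (hN0.to_subgroup _).map _
    · rintro _ ⟨a, ha, rfl⟩ _ ⟨b, hb, rfl⟩
      have := mem_center_iff.1 ha b
      exact (congrArg Subtype.val this).symm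
  obtain ⟨N, hN⟩ := (Set.toFinite S).exists_minimal hS
  obtain ⟨h1, h2, h3, h4⟩ := hN.1
  refine ⟨N, h1, h2, h3, h4, fun F hF hF' hFN => ?_⟩
  exact hN.eq_of_le ⟨hF, hF', h3.to_le hFN, fun a ha b hb => h4 a (hFN ha) b (hFN hb)⟩ hFN

theorem comm_mem_Mx (x g : G) : ⁅g, x⁆ ∈ Mx x g :=
  commutator_mem_commutator (subset_closure (by simp)) (subset_closure (by simp))

theorem pel.map {q : ℕ} {g : G} (h : pel q g) {G' : Type u} [Group G'] [Finite G'] (f : G →* G') : pel q (f g) := by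
  obtain ⟨n, hn⟩ := h
  exact ⟨n, by rw [← map_pow, hn, map_one]⟩

theorem gd_step {p : ℕ} (hp : p.Prime) {N : Subgroup G} (hNn : N.Normal) (hNb : N ≠ ⊥) (hN : IsPGroup p N)
    (hab : ∀ a ∈ N, ∀ b ∈ N, Commute a b) (hmin : ∀ F : Subgroup G, F.Normal → F ≠ ⊥ → F ≤ N → F = N)
    {x : G} (hI : InI x)
    (IH : ∀ (G' : Type u) [Group G'] [Finite G'], Nat.card G' < Nat.card G → ∀ x : G', InI x → Gd x ⊤) :
    Gd x ⊤ := by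
  haveI := Fact.mk hp
  haveI := hNn
  set L : Subgroup G := closure {t | ∃ b ∈ (⊤ : Subgroup G), t = ⁅b, x⁆} with hL
  have hLn : ∀ g, g ∈ nm L := fun g => comm_closure_nm (trivial : g ∈ (⊤ : Subgroup G))
  haveI hLn' := normal_of_nm hLn
  have hLx : ∀ g : G, ⁅g, x⁆ ∈ L := fun g => subset_closure ⟨g, trivial, rfl⟩
  haveI : Nontrivial N := (nontrivial_iff_ne_bot N).2 hNb
  have hNc : 1 < Nat.card N := Finite.one_lt_card
  -- L centralises N
  have hcent : ∀ a ∈ L, ∀ n ∈ N, Commute a n := by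
    let φ : G →* MulAut N := MulAut.conjNormal
    have hφ : ∀ (g : G) (n : N), ((φ g n : N) : G) = g * n * g⁻¹ := fun g n => MulAut.conjNormal_apply g n
    have hker : ∀ g : G, (∀ n ∈ N, Commute g n) → g ∈ φ.ker := by
      intro g h
      rw [MonoidHom.mem_ker]
      ext n
      rw [hφ, (h n n.2).eq]; simp
    haveI : Finite φ.range := Finite.of_surjective _ φ.rangeRestrict_surjective
    have hcard : Nat.card φ.range < Nat.card G := by
      have h1 : Nat.card φ.ker * φ.ker.index = Nat.card G := φ.ker.card_mul_index
      rw [index_ker] at h1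
      have h2 : Nat.card N ≤ Nat.card φ.ker := card_le_of_le (fun a ha => hker a fun n hn => hab a ha n hn)
      have h3 : 0 < Nat.card φ.range := Nat.card_pos
      nlinarith
    obtain ⟨N1, hN1, -, -, hN1x⟩ := IH φ.range hcard _ (hI.map φ.rangeRestrict φ.rangeRestrict_surjective)
    let J : Subgroup (MulAut N) := (hN1.Op hp).map φ.range.subtype
    have hJ : IsPGroup p J := (hN1.Op_isPGroup hp).map _
    have hLJ : L ≤ J.comap φ := by
      rw [hL, closure_le]
      rintro _ ⟨g, -, rfl⟩
      set t := ⁅g, x⁆ with ht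
      have htM : t ∈ Mx x g := comm_mem_Mx x g
      have h1 : qr p t ∈ φ.ker := by
        apply mem_of_qp
        intro l hl
        by_cases hlp : l = p
        · subst hlp
          rw [(ppel_iff hl).1 (ppel_qr hl t)]; exact Subgroup.one_mem _
        · exact hker _ fun n hn => star hp hN hab hI hl hlp g (s := qp l (qr p t))
            ⟨qp_mem (qr_mem htM), pel_qp hl _⟩ hn
      have h2 : φ.rangeRestrict t = φ.rangeRestrict (qp p t) := by
        apply Subtype.ext
        show φ t = φ (qp p t)
        have h3 : φ (qr p t) = 1 := h1
        rw [← qp_mul_qr (q := p) t, map_mul, h3, mul_one, qp_mul_qr]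
      refine ⟨φ.rangeRestrict t, ⟨?_, ?_⟩, rfl⟩
      · rw [ht, map_commutatorElement]; exact hN1x _ trivial
      · rw [h2]; exact (pel_qp hp t).map _
    have hdvd : p ∣ Nat.card N := by
      obtain ⟨k, hk⟩ := IsPGroup.iff_card.1 hN
      rw [hk]
      apply dvd_pow_self
      rintro rfl
      rw [pow_zero] at hk
      omega
    have hfix1 : (1 : N) ∈ MulAction.fixedPoints J N := fun j => map_one (j : MulAut N)
    obtain ⟨n, hn, hn1⟩ := hJ.exists_fixed_point_of_prime_dvd_card_of_fixed_point N hdvd hfix1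
    let F : Subgroup G := N ⊓ centralizer (L : Set G)
    have hFn : F.Normal := inferInstance
    have hF : F = N := by
      refine hmin F hFn ?_ inf_le_left
      intro hb
      have : (n : G) ∈ F := by
        refine mem_inf.2 ⟨n.2, ?_⟩
        rw [mem_centralizer_iff]
        intro a ha
        have h5 : φ a n = n := hn ⟨φ a, hLJ ha⟩
        have h6 := hφ a n
        rw [h5] at h6
        calc a * (n : G) = (a * n * a⁻¹) * a := by group
          _ = n * a := by rw [← h6]
      rw [hb, mem_bot] at this
      exact hn1 (Subtype.ext this.symm)
    intro a ha n hn
    rw [← hF] at hn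
    exact mem_centralizer_iff.1 hn.2 a ha
  have hcard2 : Nat.card (G ⧸ N) < Nat.card G := by
    have h1 := card_eq_card_quotient_mul_card_subgroup N
    have h3 : 0 < Nat.card (G ⧸ N) := Nat.card_pos
    nlinarith
  obtain ⟨N2, hN2, -, -, hN2x⟩ := IH (G ⧸ N) hcard2 _ (hI.map (QuotientGroup.mk' N) (QuotientGroup.mk'_surjective N))
  have hLN2 : L ≤ N2.comap (QuotientGroup.mk' N) := by
    rw [hL, closure_le]
    rintro _ ⟨g, -, rfl⟩
    show QuotientGroup.mk' N ⁅g, x⁆ ∈ N2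
    rw [map_commutatorElement]; exact hN2x _ trivial
  refine ⟨L, ?_, le_top, fun g _ => hLn g, fun g _ => hLx g⟩
  intro a ha b hb hco
  have h1 := hN2 _ (hLN2 ha) _ (hLN2 hb) (Nat.Coprime.of_dvd (orderOf_map_dvd _ a) (orderOf_map_dvd _ b) hco)
  have h2 : ⁅a, b⁆ ∈ N := by
    rw [← commutatorElement_eq_one_iff_commute, ← map_commutatorElement] at h1
    exact (QuotientGroup.eq_one_iff _).1 h1
  exact commutatorElement_eq_one_iff_commute.1 (comm_triv (hcent a ha _ h2).symm (hcent b hb _ h2).symm hco)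

theorem thmS_aux (n : ℕ) : ∀ (G : Type u) [Group G] [Finite G], Nat.card G = n → ∀ x : G, InI x → Gd x ⊤ := by
  induction n using Nat.strong_induction_on with
  | _ n ih =>
  intro G _ _ hn x hI
  have IH : ∀ (G' : Type u) [Group G'] [Finite G'], Nat.card G' < Nat.card G → ∀ x : G', InI x → Gd x ⊤ := by
    intro G' _ _ h
    exact ih _ (hn ▸ h) G' rfl
  by_cases h1 : ∀ p : ℕ, p.Prime → ∀ N : Subgroup G, N.Normal → IsPGroup p N → N = ⊥
  · have hC : Crit G := by
      refine ⟨h1, fun x hI H hH hx => ?_⟩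
      have hc : Nat.card H < Nat.card G := by
        refine lt_of_le_of_ne (card_le_card_group H) fun h => hH (eq_top_of_card_eq H h)
      have h2 : InI (⟨x, hx⟩ : H) := InI.comap H.subtype H.subtype_injective (x := (⟨x, hx⟩ : H)) hI
      have h3 := (IH H hc _ h2).map H.subtype
      rw [← MonoidHom.range_eq_map, range_subtype] at h3
      exact h3
    have hx : x ∈ (⊥ : Subgroup G) := by
      apply mem_of_qp
      intro l hl
      by_contra hne
      exact hC.false (x := qp l x) (hI.pow _) hl (pel_qp hl x) (fun h => hne (by rw [h]; exact Subgroup.one_mem _))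
    rw [mem_bot.1 hx]
    exact Gd_one _
  · push Not at h1
    obtain ⟨p, hp, N0, hn0, hN0, hne⟩ := h1
    obtain ⟨N, a1, a2, a3, a4, a5⟩ := exists_min_abelian hp hn0 hN0 hne
    exact gd_step hp a1 a2 a3 a4 a5 hI IH

theorem thmS {x : G} (hI : InI x) : Gd x ⊤ := thmS_aux _ G rfl x hI

theorem InI_of_Gd {x : G} (h : Gd x ⊤) : InI x := fun _ => h.mono le_top (subset_closure (by simp))

theorem nil_iff (x y : G) : Group.IsNilpotent (commutator (closure {x, y})) ↔ Nil (Mx x y) := by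
  set H := closure {x, y} with hH
  have e : (commutator H).map H.subtype = Mx x y := map_subtype_commutator H
  rw [← e]
  let f := (commutator H).equivMapOfInjective H.subtype H.subtype_injective
  constructor
  · intro h
    exact nil_of_isNilpotent (Group.nilpotent_of_surjective f.toMonoidHom f.surjective)
  · intro h
    haveI := h.isNilpotent
    exact Group.nilpotent_of_surjective f.symm.toMonoidHom f.symm.surjective

theorem InI_iff (x : G) : InI x ↔ ∀ y : G, Group.IsNilpotent (commutator (closure {x, y})) := by
  constructor
  · intro h y
    exact (nil_iff x y).2 (h.nil y)
  · intro h y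
    refine ⟨Mx x y, (nil_iff x y).1 (h y), der_le _, fun z hz => Mx_nm hz, fun z hz => ?_⟩
    exact commutator_mem_commutator hz (subset_closure (by simp))

theorem final (G : Type u) [Group G] [Finite G] : ∃ H : Subgroup G, (H : Set G) =
    {x : G | ∀ y : G, Group.IsNilpotent ↥(commutator ↥(Subgroup.closure {x, y}))} := by
  refine ⟨{ carrier := {x | Gd x ⊤}, one_mem' := Gd_one _, mul_mem' := fun h h' => Gd.mul h h', inv_mem' := ?_ }, ?_⟩
  · intro x h
    have : x⁻¹ = x ^ (orderOf x - 1) := by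
      rw [inv_eq_iff_mul_eq_one, ← pow_succ', Nat.sub_add_cancel (orderOf_pos x), pow_orderOf_eq_one]
    rw [Set.mem_setOf_eq, this]
    exact Gd.pow h trivial _
  · ext x
    show Gd x ⊤ ↔ _
    rw [Set.mem_setOf_eq, ← InI_iff]
    exact ⟨InI_of_Gd, thmS⟩


end ND

theorem nilpotent_derived_semiregular (G : Type u) [Group G] [Finite G] :
    ∃ H : Subgroup G,
      (H : Set G) =
        {x : G | ∀ y : G, Group.IsNilpotent ↥(commutator ↥(Subgroup.closure {x, y}))} :=
  ND.final G
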